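/- arXiv:2508.08119 — 2 statements merged into one kernel-verified Lean document; each statement's English description precedes it below -/
import Mathlib

section
/- Let t ≥ 1 be an integer and let G be a finite simple bipartite graph with minimum degree at least 14t + 14. Then G admits a totally even immersion of K_t. -/
open SimpleGraph

/-- An immersion of `H` in `G`: an injection `φ` of the vertices of `H` into `G`
(the branch vertices), together with, for each edge `uv` of `H`, a trail in `G`
from `φ u` to `φ v` (the branch trails), such that the branch trails are
pairwise edge-disjoint.  The trail assigned to the reversed adjacency is the
reversed trail, so there is one branch trail per edge of `H`. -/
structure Immersion {V : Type*} {W : Type*} (G : SimpleGraph V) (H : SimpleGraph W) where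
  φ : W ↪ V
  trail : ∀ ⦃u v : W⦄, H.Adj u v → G.Walk (φ u) (φ v)
  isTrail : ∀ ⦃u v : W⦄ (h : H.Adj u v), (trail h).IsTrail
  symm : ∀ ⦃u v : W⦄ (h : H.Adj u v), trail h.symm = (trail h).reverse
  disjoint : ∀ ⦃u v a b : W⦄ (h₁ : H.Adj u v) (h₂ : H.Adj a b),
      s(u, v) ≠ s(a, b) → List.Disjoint (trail h₁).edges (trail h₂).edges

/-- `G` admits an immersion of `H`. -/
def HasImmersion {V W : Type*} (G : SimpleGraph V) (H : SimpleGraph W) : Prop :=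
  Nonempty (Immersion G H)

/-- `G` admits a totally odd immersion of `H`: every branch trail has odd length. -/
def HasTotallyOddImmersion {V W : Type*} (G : SimpleGraph V) (H : SimpleGraph W) : Prop :=
  ∃ I : Immersion G H, ∀ ⦃u v : W⦄ (h : H.Adj u v), Odd (I.trail h).length

/-- `G` admits a totally even immersion of `H`: every branch trail has even length. -/
def HasTotallyEvenImmersion {V W : Type*} (G : SimpleGraph V) (H : SimpleGraph W) : Prop :=
  ∃ I : Immersion G H, ∀ ⦃u v : W⦄ (h : H.Adj u v), Even (I.trail h).length

open SimpleGraph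

namespace TE
set_option linter.unusedSectionVars false
set_option linter.deprecated false
open Classical
variable {V : Type*} [Fintype V]

/-- neighbours as a finset -/
noncomputable def nb (G : SimpleGraph V) (x : V) : Finset V := Finset.univ.filter (G.Adj x)

@[simp] lemma mem_nb {G : SimpleGraph V} {x y : V} : y ∈ nb G x ↔ G.Adj x y := by
  simp [nb]

/-- weak immersion with identity branch map -/
def Imm (H G : SimpleGraph V) : Prop := ∃ F : Sym2 V → Set (Sym2 V),
  (∀ e ∈ H.edgeSet, F e ⊆ G.edgeSet) ∧
  (∀ e ∈ H.edgeSet, ∀ e' ∈ H.edgeSet, e ≠ e' → Disjoint (F e) (F e')) ∧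
  ∀ x y, H.Adj x y → (fromEdgeSet (F s(x,y))).Reachable x y

lemma Imm.of_le {H G : SimpleGraph V} (h : H ≤ G) : Imm H G := by
  refine ⟨fun e => {e}, ?_, ?_, ?_⟩
  · intro e he f hf
    simp only [Set.mem_singleton_iff] at hf
    subst hf
    exact edgeSet_mono h he
  · intro e _ e' _ hne
    simpa using hne
  · intro x y hxy
    apply Adj.reachable
    simp [hxy.ne]

lemma Imm.refl (G : SimpleGraph V) : Imm G G := Imm.of_le le_rfl

lemma Imm.trans {K H G : SimpleGraph V} (h1 : Imm K H) (h2 : Imm H G) : Imm K G := by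
  obtain ⟨F1, a1, b1, c1⟩ := h1
  obtain ⟨F2, a2, b2, c2⟩ := h2
  refine ⟨fun e => ⋃ f ∈ F1 e, F2 f, ?_, ?_, ?_⟩
  · intro e he g hg
    simp only [Set.mem_iUnion] at hg
    obtain ⟨f, hf, hg⟩ := hg
    exact a2 f (a1 e he hf) hg
  · intro e he e' he' hne
    rw [Set.disjoint_left]
    intro g hg hg'
    simp only [Set.mem_iUnion] at hg hg'
    obtain ⟨f, hf, hg⟩ := hg
    obtain ⟨f', hf', hg'⟩ := hg'
    have hff : f ≠ f' := by
      rintro rfl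
      exact Set.disjoint_left.1 (b1 e he e' he' hne) hf hf'
    exact Set.disjoint_left.1 (b2 f (a1 e he hf) f' (a1 e' he' hf') hff) hg hg'
  · intro x y hxy
    have key : ∀ a b, (fromEdgeSet (F1 s(x,y))).Walk a b →
        (fromEdgeSet (⋃ f ∈ F1 s(x,y), F2 f)).Reachable a b := by
      intro a b w
      induction w with
      | nil => exact Reachable.refl _
      | @cons a c b h _ ih =>
        refine Reachable.trans ?_ ih
        rw [fromEdgeSet_adj] at h
        have hH : H.Adj a c := by
          have := a1 s(x,y) hxy h.1
          simpa using this
        refine (c2 a c hH).mono ?_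
        apply fromEdgeSet_mono
        intro g hg
        simp only [Set.mem_iUnion]
        exact ⟨_, h.1, hg⟩
    obtain ⟨w⟩ := c1 x y hxy
    exact key _ _ w

/-- clique graph on a finset -/
def KZ (Z : Finset V) : SimpleGraph V where
  Adj x y := x ≠ y ∧ x ∈ Z ∧ y ∈ Z
  symm := ⟨fun _ _ h => ⟨h.1.symm, h.2.2, h.2.1⟩⟩
  loopless := ⟨fun _ h => h.1 rfl⟩

def HasK (t : ℕ) (G : SimpleGraph V) : Prop := ∃ Z : Finset V, Z.card = t ∧ Imm (KZ Z) G

lemma HasK.mono {t : ℕ} {H G : SimpleGraph V} (h : HasK t H) (hi : Imm H G) : HasK t G := by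
  obtain ⟨Z, hZ, h⟩ := h
  exact ⟨Z, hZ, h.trans hi⟩

lemma HasK.of_clique {t : ℕ} {G : SimpleGraph V} (Z : Finset V) (hZ : t ≤ Z.card)
    (h : ∀ x ∈ Z, ∀ y ∈ Z, x ≠ y → G.Adj x y) : HasK t G := by
  obtain ⟨W, hW, hc⟩ := Finset.exists_subset_card_eq hZ
  refine ⟨W, hc, Imm.of_le ?_⟩
  intro x y hxy
  exact h x (hW hxy.2.1) y (hW hxy.2.2) hxy.1

/-- toggling the pairs of a matching in the neighbourhood of `v`, deleting edges to `v` -/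
def split (G : SimpleGraph V) (v : V) (M : SimpleGraph V) : SimpleGraph V where
  Adj x y := x ≠ y ∧ ((M.Adj x y ∧ ¬ G.Adj x y) ∨
    (¬ M.Adj x y ∧ G.Adj x y ∧ (x = v → ∀ z, ¬ M.Adj y z) ∧ (y = v → ∀ z, ¬ M.Adj x z)))
  symm := ⟨fun x y h => ⟨h.1.symm, by
    rcases h.2 with h | h
    · exact Or.inl ⟨h.1.symm, fun h' => h.2 h'.symm⟩
    · exact Or.inr ⟨fun h' => h.1 h'.symm, h.2.1.symm, h.2.2.2, h.2.2.1⟩⟩⟩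
  loopless := ⟨fun _ h => h.1 rfl⟩

structure IsM (G : SimpleGraph V) (v : V) (M : SimpleGraph V) : Prop where
  uniq : ∀ x y z, M.Adj x y → M.Adj x z → y = z
  nbr : ∀ x y, M.Adj x y → G.Adj v x

lemma split_imm {G M : SimpleGraph V} {v : V} (hM : IsM G v M) : Imm (split G v M) G := by
  have hv : ∀ x, ¬ M.Adj v x := fun x h => (hM.nbr _ _ h).ne rfl
  refine ⟨fun e => if e ∈ G.edgeSet then {e} else {f | ∃ x ∈ e, f = s(x, v)}, ?_, ?_, ?_⟩
  · intro e
    induction e with | _ x y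
    intro he f hf
    by_cases hG : s(x,y) ∈ G.edgeSet
    · simp only [hG, if_true, Set.mem_singleton_iff] at hf
      rw [hf]; exact hG
    · simp only [hG, if_false, Set.mem_setOf_eq] at hf
      obtain ⟨z, hz, rfl⟩ := hf
      rcases he.2 with h | h
      · rw [Sym2.mem_iff] at hz
        rcases hz with rfl | rfl
        · exact (hM.nbr _ _ h.1).symm
        · exact (hM.nbr _ _ h.1.symm).symm
      · exact absurd h.2.1 hG
  · intro e
    induction e with | _ x y
    intro he e'
    induction e' with | _ x' y'
    intro he' hne
    have main : ∀ x y x' y', (split G v M).Adj x y → (split G v M).Adj x' y' →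
        G.Adj x y → ¬ G.Adj x' y' → ∀ z ∈ s(x',y'), s(x,y) ≠ s(z,v) := by
      intro x y x' y' h h' hG hG' z hz heq
      have hMz : ∃ w, M.Adj z w := by
        rcases h'.2 with h' | h'
        · rw [Sym2.mem_iff] at hz
          rcases hz with rfl | rfl
          · exact ⟨_, h'.1⟩
          · exact ⟨_, h'.1.symm⟩
        · exact absurd h'.2.1 hG'
      obtain ⟨w, hw⟩ := hMz
      have h3 : (split G v M).Adj z v := by
        have : s(x,y) ∈ (split G v M).edgeSet := h
        rw [heq] at this
        exact this
      rcases h3.2 with h | h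
      · exact hv _ h.1.symm
      · exact h.2.2.2 rfl w hw
    rw [Set.disjoint_left]
    intro f hf hf'
    by_cases hG : s(x,y) ∈ G.edgeSet <;> by_cases hG' : s(x',y') ∈ G.edgeSet
    · simp only [hG, hG', if_true, Set.mem_singleton_iff] at hf hf'
      exact hne (hf.symm.trans hf')
    · simp only [hG, hG', if_true, if_false, Set.mem_singleton_iff, Set.mem_setOf_eq] at hf hf'
      obtain ⟨z, hz, h⟩ := hf'
      exact main x y x' y' he he' hG hG' z hz (hf.symm.trans h)
    · simp only [hG, hG', if_true, if_false, Set.mem_singleton_iff, Set.mem_setOf_eq] at hf hf'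
      obtain ⟨z, hz, h⟩ := hf
      exact main x' y' x y he' he hG' hG z hz (hf'.symm.trans h)
    · simp only [hG, hG', if_false, Set.mem_setOf_eq] at hf hf'
      obtain ⟨z, hz, h⟩ := hf
      obtain ⟨z', hz', h'⟩ := hf'
      have h1 : M.Adj x y := by
        rcases he.2 with h | h
        · exact h.1
        · exact absurd h.2.1 hG
      have h2 : M.Adj x' y' := by
        rcases he'.2 with h | h
        · exact h.1
        · exact absurd h.2.1 hG'
      have h3 : z = z' := by
        have := h.symm.trans h'
        rw [Sym2.eq_iff] at this
        rcases this with h | h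
        · exact h.1
        · exact h.1.trans h.2
      subst h3
      apply hne
      rw [Sym2.mem_iff] at hz hz'
      rw [Sym2.eq_iff]
      rcases hz with rfl | rfl <;> rcases hz' with rfl | rfl
      · exact Or.inl ⟨rfl, hM.uniq _ _ _ h1 h2⟩
      · exact Or.inr ⟨rfl, hM.uniq _ _ _ h1 h2.symm⟩
      · exact Or.inr ⟨hM.uniq _ _ _ h1.symm h2, rfl⟩
      · exact Or.inl ⟨hM.uniq _ _ _ h1.symm h2.symm, rfl⟩
  · intro x y hxy
    by_cases hG : s(x,y) ∈ G.edgeSet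
    · simp only [hG, if_true]
      apply Adj.reachable
      simp [hxy.ne]
    · simp only [hG, if_false]
      have h1 : M.Adj x y := by
        rcases hxy.2 with h | h
        · exact h.1
        · exact absurd h.2.1 hG
      have hxv : x ≠ v := by rintro rfl; exact hv _ h1
      have hyv : y ≠ v := by rintro rfl; exact hv _ h1.symm
      refine Reachable.trans (v := v) (Adj.reachable ?_) (Adj.reachable ?_)
      · rw [fromEdgeSet_adj]
        exact ⟨⟨x, by simp, rfl⟩, hxv⟩
      · rw [fromEdgeSet_adj]
        exact ⟨⟨y, by simp, Sym2.eq_swap⟩, hyv.symm⟩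

/-- The detour operation. -/
def detour (G : SimpleGraph V) (u v a y : V) : SimpleGraph V :=
  fromEdgeSet ((G.edgeSet \ {s(u,v), s(v,a), s(a,y)}) ∪ {s(u,y)})

lemma detour_imm {G : SimpleGraph V} {u v a y : V} (h1 : G.Adj u v) (h2 : G.Adj v a)
    (h3 : G.Adj a y) (h4 : ¬ G.Adj u y) : Imm (detour G u v a y) G := by
  have hG : ∀ e ∈ (detour G u v a y).edgeSet, e ≠ s(u,y) →
      e ∈ G.edgeSet ∧ e ∉ ({s(u,v), s(v,a), s(a,y)} : Set (Sym2 V)) := by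
    intro e he hne
    rw [detour, edgeSet_fromEdgeSet] at he
    rcases he.1 with h | h
    · exact h
    · exact absurd h hne
  refine ⟨fun e => if e = s(u,y) then {s(u,v), s(v,a), s(a,y)} else {e}, ?_, ?_, ?_⟩
  · intro e he f hf
    by_cases h : e = s(u,y)
    · simp only [h, if_true] at hf
      rcases hf with rfl | rfl | rfl
      · exact h1
      · exact h2
      · exact h3
    · simp only [h, if_false, Set.mem_singleton_iff] at hf
      subst hf
      exact (hG _ he h).1
  · intro e he e' he' hne
    rw [Set.disjoint_left]
    intro f hf hf'
    by_cases h : e = s(u,y) <;> by_cases h' : e' = s(u,y)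
    · exact hne (h.trans h'.symm)
    · simp only [h, h', if_true, if_false] at hf hf'
      rw [Set.mem_singleton_iff] at hf'
      subst hf'
      exact (hG _ he' h').2 hf
    · simp only [h, h', if_true, if_false] at hf hf'
      rw [Set.mem_singleton_iff] at hf
      subst hf
      exact (hG _ he h).2 hf'
    · simp only [h, h', if_false, Set.mem_singleton_iff] at hf hf'
      exact hne (hf.symm.trans hf')
  · intro x z hxz
    by_cases h : s(x,z) = s(u,y)
    · simp only [h, if_true]
      have : (fromEdgeSet ({s(u,v), s(v,a), s(a,y)} : Set (Sym2 V))).Reachable u y := by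
        refine Reachable.trans (v := v) (Adj.reachable ?_)
          (Reachable.trans (v := a) (Adj.reachable ?_) (Adj.reachable ?_))
        · rw [fromEdgeSet_adj]; exact ⟨by simp, h1.ne⟩
        · rw [fromEdgeSet_adj]; exact ⟨by simp, h2.ne⟩
        · rw [fromEdgeSet_adj]; exact ⟨by simp, h3.ne⟩
      rw [Sym2.eq_iff] at h
      rcases h with ⟨rfl, rfl⟩ | ⟨rfl, rfl⟩
      · exact this
      · exact this.symm
    · simp only [h, if_false]
      apply Adj.reachable
      simp [hxz.ne]

end TE

open SimpleGraph

namespace TE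
set_option linter.unusedSectionVars false
open Classical
variable {V : Type*} [Fintype V]

lemma greedy {G : SimpleGraph V} (Z B : Finset V) (hd : Disjoint Z B)
    (hc : ∀ x ∈ Z, ∀ y ∈ Z, x ≠ y →
      2 * Z.card ≤ (B.filter (fun b => G.Adj x b ∧ G.Adj y b)).card) : Imm (KZ Z) G := by
  have key : ∀ E : Finset (Sym2 V), (∀ e ∈ E, e ∈ (KZ Z).edgeSet) → ∃ c : Sym2 V → V,
      (∀ e ∈ E, c e ∈ B ∧ ∀ x ∈ e, G.Adj x (c e)) ∧
      ∀ e ∈ E, ∀ e' ∈ E, ∀ x, x ∈ e → x ∈ e' → c e = c e' → e = e' := by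
    intro E
    induction E using Finset.induction_on with
    | empty =>
      intro _
      exact ⟨fun e => e.out.1, by simp, by simp⟩
    | insert e E he ih =>
      intro hE
      obtain ⟨c, h1, h2⟩ := ih (fun e' he' => hE e' (Finset.mem_insert_of_mem he'))
      have heK := hE e (Finset.mem_insert_self _ _)
      induction e with | _ x y
      obtain ⟨hxy, hx, hy⟩ : x ≠ y ∧ x ∈ Z ∧ y ∈ Z := heK
      let Fb := (Z.erase x).image (fun z => c s(x,z)) ∪ (Z.erase y).image (fun z => c s(y,z))
      have hF : Fb.card < 2 * Z.card := by
        have a1 := Finset.card_union_le ((Z.erase x).image (fun z => c s(x,z)))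
          ((Z.erase y).image (fun z => c s(y,z)))
        have a2 := Finset.card_image_le (s := Z.erase x) (f := fun z => c s(x,z))
        have a3 := Finset.card_image_le (s := Z.erase y) (f := fun z => c s(y,z))
        rw [Finset.card_erase_of_mem hx] at a2
        rw [Finset.card_erase_of_mem hy] at a3
        have := Finset.card_pos.2 ⟨x, hx⟩
        show (_ ∪ _ : Finset V).card < _
        omega
      obtain ⟨b, hb, hbF⟩ := Finset.exists_mem_notMem_of_card_lt_card
        (lt_of_lt_of_le hF (hc x hx y hy hxy))
      rw [Finset.mem_filter] at hb
      have hbad : ∀ e' ∈ E, ∀ z, z ∈ s(x,y) → z ∈ e' → b ≠ c e' := by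
        intro e' he' z hz hz' hbe
        apply hbF
        obtain ⟨w, rfl⟩ := hz'
        obtain ⟨hw, hz1, hw1⟩ : z ≠ w ∧ z ∈ Z ∧ w ∈ Z := hE _ (Finset.mem_insert_of_mem he')
        rw [Finset.mem_union, Finset.mem_image, Finset.mem_image]
        rw [Sym2.mem_iff] at hz
        rcases hz with rfl | rfl
        · exact Or.inl ⟨w, Finset.mem_erase.2 ⟨hw.symm, hw1⟩, hbe.symm⟩
        · exact Or.inr ⟨w, Finset.mem_erase.2 ⟨hw.symm, hw1⟩, hbe.symm⟩
      have hne : ∀ e' ∈ E, e' ≠ s(x,y) := by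
        rintro e' he' rfl
        exact he he'
      refine ⟨Function.update c s(x,y) b, ?_, ?_⟩
      · intro e' he'
        rw [Finset.mem_insert] at he'
        rcases he' with rfl | he'
        · rw [Function.update_self]
          refine ⟨hb.1, ?_⟩
          intro z hz
          rw [Sym2.mem_iff] at hz
          rcases hz with rfl | rfl
          · exact hb.2.1
          · exact hb.2.2
        · rw [Function.update_of_ne (hne e' he')]
          exact h1 e' he'
      · intro e1 he1 e2 he2 z hz1 hz2 heq
        rw [Finset.mem_insert] at he1 he2
        rcases he1 with rfl | he1 <;> rcases he2 with rfl | he2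
        · rfl
        · rw [Function.update_self, Function.update_of_ne (hne _ he2)] at heq
          exact absurd heq (hbad _ he2 z hz1 hz2)
        · rw [Function.update_self, Function.update_of_ne (hne _ he1)] at heq
          exact absurd heq.symm (hbad _ he1 z hz2 hz1)
        · rw [Function.update_of_ne (hne _ he1), Function.update_of_ne (hne _ he2)] at heq
          exact h2 e1 he1 e2 he2 z hz1 hz2 heq
  obtain ⟨c, h1, h2⟩ := key (KZ Z).edgeFinset (fun e he => by simpa using he)
  simp only [mem_edgeFinset] at h1 h2
  have hZ : ∀ e ∈ (KZ Z).edgeSet, ∀ x ∈ e, x ∈ Z := by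
    intro e he x hx
    obtain ⟨w, rfl⟩ := hx
    exact he.2.1
  refine ⟨fun e => {f | ∃ x ∈ e, f = s(x, c e)}, ?_, ?_, ?_⟩
  · rintro e he f ⟨x, hx, rfl⟩
    exact (h1 e he).2 x hx
  · intro e he e' he' hne
    rw [Set.disjoint_left]
    rintro f ⟨x, hx, rfl⟩ ⟨x', hx', h⟩
    rw [Sym2.eq_iff] at h
    rcases h with ⟨rfl, h⟩ | ⟨h, _⟩
    · exact hne (h2 e he e' he' x hx hx' h)
    · exact Finset.disjoint_left.1 hd (hZ e he x hx) (h ▸ (h1 e' he').1)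
  · intro x y hxy
    have hx := (h1 s(x,y) hxy).2 x (by simp)
    have hy := (h1 s(x,y) hxy).2 y (by simp)
    refine Reachable.trans (v := c s(x,y)) (Adj.reachable ?_) (Adj.reachable ?_)
    · rw [fromEdgeSet_adj]; exact ⟨⟨x, by simp, rfl⟩, hx.ne⟩
    · rw [fromEdgeSet_adj]; exact ⟨⟨y, by simp, Sym2.eq_swap⟩, hy.ne.symm⟩

lemma HasK.greedy {t : ℕ} {G : SimpleGraph V} (Z B : Finset V) (hZ : t ≤ Z.card)
    (hd : Disjoint Z B)
    (hc : ∀ x ∈ Z, ∀ y ∈ Z, x ≠ y →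
      2 * t ≤ (B.filter (fun b => G.Adj x b ∧ G.Adj y b)).card) : HasK t G := by
  obtain ⟨W, hW, hc'⟩ := Finset.exists_subset_card_eq hZ
  refine ⟨W, hc', TE.greedy W B (Finset.disjoint_of_subset_left hW hd) ?_⟩
  intro x hx y hy hxy
  rw [hc']
  exact hc x (hW hx) y (hW hy) hxy

lemma IsM.not_v {G M : SimpleGraph V} {v : V} (hM : IsM G v M) (x : V) : ¬ M.Adj v x :=
  fun h => (hM.nbr _ _ h).ne rfl

lemma nb_split_v {G M : SimpleGraph V} {v : V} (hM : IsM G v M) :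
    nb (split G v M) v = (nb G v).filter (fun x => ∀ z, ¬ M.Adj x z) := by
  ext y
  simp only [mem_nb, Finset.mem_filter, split]
  constructor
  · rintro ⟨_, h | h⟩
    · exact absurd h.1 (hM.not_v _)
    · exact ⟨h.2.1, h.2.2.1 trivial⟩
  · rintro ⟨h1, h2⟩
    exact ⟨h1.ne, Or.inr ⟨hM.not_v _, h1, fun _ => h2, fun h => absurd h h1.ne.symm⟩⟩

lemma nb_split_other {G M : SimpleGraph V} {v x : V} (hx : x ≠ v)
    (h : ∀ z, ¬ M.Adj x z) : nb (split G v M) x = nb G x := by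
  ext y
  simp only [mem_nb, split]
  constructor
  · rintro ⟨_, h1 | h1⟩
    · exact absurd h1.1 (h _)
    · exact h1.2.1
  · intro h1
    exact ⟨h1.ne, Or.inr ⟨h _, h1, fun h => absurd h hx, fun _ => h⟩⟩

lemma nb_split_nonadj {G M : SimpleGraph V} {v x y : V} (hM : IsM G v M) (h : M.Adj x y)
    (hG : ¬ G.Adj x y) : nb (split G v M) x = insert y ((nb G x).erase v) := by
  have hxv : x ≠ v := fun e => hM.not_v y (e ▸ h)
  ext z
  simp only [mem_nb, split, Finset.mem_insert, Finset.mem_erase]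
  constructor
  · rintro ⟨_, h1 | h1⟩
    · exact Or.inl (hM.uniq _ _ _ h1.1 h)
    · exact Or.inr ⟨fun e => h1.2.2.2 e _ h, h1.2.1⟩
  · rintro (rfl | ⟨h1, h2⟩)
    · exact ⟨h.ne, Or.inl ⟨h, hG⟩⟩
    · refine ⟨h2.ne, Or.inr ⟨?_, h2, fun h => absurd h hxv, fun h => absurd h h1⟩⟩
      intro h3
      rw [hM.uniq _ _ _ h3 h] at h2
      exact hG h2

lemma nb_split_adj {G M : SimpleGraph V} {v x y : V} (hM : IsM G v M) (h : M.Adj x y)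
    (hG : G.Adj x y) : nb (split G v M) x = ((nb G x).erase v).erase y := by
  have hxv : x ≠ v := fun e => hM.not_v y (e ▸ h)
  ext z
  simp only [mem_nb, split, Finset.mem_erase]
  constructor
  · rintro ⟨_, h1 | h1⟩
    · rw [hM.uniq _ _ _ h1.1 h] at h1
      exact absurd hG h1.2
    · exact ⟨fun e => h1.1 (e ▸ h), fun e => h1.2.2.2 e _ h, h1.2.1⟩
  · rintro ⟨h0, h1, h2⟩
    refine ⟨h2.ne, Or.inr ⟨?_, h2, fun h => absurd h hxv, fun h => absurd h h1⟩⟩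
    intro h3
    exact h0 (hM.uniq _ _ _ h3 h)

lemma card_split_nonadj {G M : SimpleGraph V} {v x y : V} (hM : IsM G v M) (h : M.Adj x y)
    (hG : ¬ G.Adj x y) : (nb (split G v M) x).card = (nb G x).card := by
  rw [nb_split_nonadj hM h hG, Finset.card_insert_of_notMem (by simp [hG]),
    Finset.card_erase_of_mem (by simpa using (hM.nbr _ _ h).symm)]
  have : 0 < (nb G x).card := Finset.card_pos.2 ⟨v, by simpa using (hM.nbr _ _ h).symm⟩
  omega

lemma card_split_adj {G M : SimpleGraph V} {v x y : V} (hM : IsM G v M) (h : M.Adj x y)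
    (hG : G.Adj x y) : (nb (split G v M) x).card + 2 = (nb G x).card := by
  have hy : y ≠ v := fun e => hM.not_v x (e ▸ h.symm)
  have h1 : v ∈ nb G x := by simpa using (hM.nbr _ _ h).symm
  have h2 : y ∈ (nb G x).erase v := by simp [hG, hy]
  rw [nb_split_adj hM h hG]
  rw [← Finset.card_erase_add_one h1, ← Finset.card_erase_add_one h2]

/-- the single pair graph -/
def pr (x y : V) : SimpleGraph V := fromEdgeSet {s(x,y)}

lemma pr_adj {x y a b : V} (h : x ≠ y) : (pr x y).Adj a b ↔ (a = x ∧ b = y) ∨ (a = y ∧ b = x) := by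
  rw [pr, fromEdgeSet_adj, Set.mem_singleton_iff, Sym2.eq_iff]
  constructor
  · exact fun h => h.1
  · intro h1
    refine ⟨h1, ?_⟩
    rcases h1 with ⟨rfl, rfl⟩ | ⟨rfl, rfl⟩
    · exact h
    · exact h.symm

lemma pr_isM {G : SimpleGraph V} {v x y : V} (h : x ≠ y) (hx : G.Adj v x) (hy : G.Adj v y) :
    IsM G v (pr x y) := by
  constructor
  · intro a b c h1 h2
    rw [pr_adj h] at h1 h2
    rcases h1 with ⟨rfl, rfl⟩ | ⟨rfl, rfl⟩ <;> rcases h2 with ⟨h3, rfl⟩ | ⟨h3, rfl⟩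
    · rfl
    · exact absurd h3 h
    · exact absurd h3.symm h
    · rfl
  · intro a b h1
    rw [pr_adj h] at h1
    rcases h1 with ⟨rfl, rfl⟩ | ⟨rfl, rfl⟩
    · exact hx
    · exact hy

/-- degree sum -/
noncomputable def ds (G : SimpleGraph V) : ℕ := ∑ x, (nb G x).card

lemma pr_card_v {G : SimpleGraph V} {v x y : V} (h : x ≠ y) (hx : G.Adj v x) (hy : G.Adj v y) :
    (nb (split G v (pr x y)) v).card + 2 = (nb G v).card := by
  rw [nb_split_v (pr_isM h hx hy)]
  have : (nb G v).filter (fun a => ∀ z, ¬ (pr x y).Adj a z) = ((nb G v).erase x).erase y := by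
    ext a
    simp only [Finset.mem_filter, Finset.mem_erase, mem_nb, pr_adj h]
    constructor
    · rintro ⟨h1, h2⟩
      exact ⟨fun e => h2 x (Or.inr ⟨e, rfl⟩), fun e => h2 y (Or.inl ⟨e, rfl⟩), h1⟩
    · rintro ⟨h1, h2, h3⟩
      refine ⟨h3, ?_⟩
      rintro z (⟨h4, _⟩ | ⟨h4, _⟩)
      · exact h2 h4
      · exact h1 h4
  rw [this]
  have h1 : x ∈ nb G v := by simpa using hx
  have h2 : y ∈ (nb G v).erase x := by simp [hy, h.symm]
  rw [← Finset.card_erase_add_one h1, ← Finset.card_erase_add_one h2]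

lemma pr_card_other {G : SimpleGraph V} {v x y z : V} (h : x ≠ y) 
    (hzv : z ≠ v) (hzx : z ≠ x) (hzy : z ≠ y) :
    (nb (split G v (pr x y)) z) = (nb G z) := by
  apply nb_split_other hzv
  intro w hw
  rw [pr_adj h] at hw
  rcases hw with ⟨h, _⟩ | ⟨h, _⟩
  · exact hzx h
  · exact hzy h

lemma pr_card_nonadj {G : SimpleGraph V} {v x y z : V} (h : x ≠ y) (hx : G.Adj v x)
    (hy : G.Adj v y) (hxy : ¬ G.Adj x y) (hz : z ≠ v) :
    (nb (split G v (pr x y)) z).card = (nb G z).card := by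
  by_cases h1 : z = x
  · subst h1
    exact card_split_nonadj (pr_isM h hx hy) ((pr_adj h).2 (Or.inl ⟨rfl, rfl⟩)) hxy
  by_cases h2 : z = y
  · subst h2
    exact card_split_nonadj (pr_isM h hx hy) ((pr_adj h).2 (Or.inr ⟨rfl, rfl⟩))
      (fun h => hxy h.symm)
  rw [pr_card_other h hz h1 h2]

lemma pr_card_adj {G : SimpleGraph V} {v x y z : V} (h : x ≠ y) (hx : G.Adj v x)
    (hy : G.Adj v y) (hxy : G.Adj x y) (hz : z = x ∨ z = y) :
    (nb (split G v (pr x y)) z).card + 2 = (nb G z).card := by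
  rcases hz with rfl | rfl
  · exact card_split_adj (pr_isM h hx hy) ((pr_adj h).2 (Or.inl ⟨rfl, rfl⟩)) hxy
  · exact card_split_adj (pr_isM h hx hy) ((pr_adj h).2 (Or.inr ⟨rfl, rfl⟩)) hxy.symm

lemma pr_ds_nonadj {G : SimpleGraph V} {v x y : V} (h : x ≠ y) (hx : G.Adj v x)
    (hy : G.Adj v y) (hxy : ¬ G.Adj x y) : ds G = ds (split G v (pr x y)) + 2 := by
  have : ∀ z, (nb G z).card = (nb (split G v (pr x y)) z).card + if z = v then 2 else 0 := by
    intro z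
    split_ifs with hz
    · subst hz
      rw [pr_card_v h hx hy]
    · rw [pr_card_nonadj h hx hy hxy hz]; rfl
  unfold ds
  simp only [this, Finset.sum_add_distrib, Finset.sum_ite_eq', Finset.mem_univ, if_true]

lemma pr_ds_adj {G : SimpleGraph V} {v x y : V} (h : x ≠ y) (hx : G.Adj v x)
    (hy : G.Adj v y) (hxy : G.Adj x y) : ds G = ds (split G v (pr x y)) + 6 := by
  have : ∀ z, (nb G z).card = (nb (split G v (pr x y)) z).card +
      ((if z = v then 2 else 0) + (if z = x then 2 else 0) + (if z = y then 2 else 0)) := by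
    intro z
    by_cases hz : z = v
    · subst hz
      rw [← pr_card_v h hx hy]
      simp [hx.ne, hy.ne]
    by_cases hz1 : z = x
    · subst hz1
      rw [← pr_card_adj h hx hy hxy (Or.inl rfl)]
      simp [hx.ne.symm, h]
    by_cases hz2 : z = y
    · subst hz2
      rw [← pr_card_adj h hx hy hxy (Or.inr rfl)]
      simp [hy.ne.symm, h.symm]
    simp [hz, hz1, hz2, pr_card_other h hz hz1 hz2]
  unfold ds
  simp only [this, Finset.sum_add_distrib, Finset.sum_ite_eq', Finset.mem_univ, if_true]

end TE

open SimpleGraph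

namespace TE
set_option linter.unusedSectionVars false
open Classical
variable {V : Type*} [Fintype V]

/-- delete all edges at v -/
def del (G : SimpleGraph V) (v : V) : SimpleGraph V where
  Adj a b := G.Adj a b ∧ a ≠ v ∧ b ≠ v
  symm := ⟨fun _ _ h => ⟨h.1.symm, h.2.2, h.2.1⟩⟩
  loopless := ⟨fun _ h => h.1.ne rfl⟩

lemma del_le (G : SimpleGraph V) (v : V) : del G v ≤ G := fun _ _ h => h.1

lemma del_nb_v (G : SimpleGraph V) (v : V) : nb (del G v) v = ∅ := by
  ext y; simp [del]

lemma del_nb (G : SimpleGraph V) {v x : V} (hx : x ≠ v) : nb (del G v) x = (nb G x).erase v := by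
  ext y; simp [del, hx, and_comm]

lemma del_ds (G : SimpleGraph V) (v : V) : ds G = ds (del G v) + 2 * (nb G v).card := by
  have : ∀ z, (nb G z).card = (nb (del G v) z).card +
      ((if z = v then (nb G v).card else 0) + (if z ∈ nb G v then 1 else 0)) := by
    intro z
    by_cases hz : z = v
    · subst hz
      simp [del_nb_v]
    · rw [del_nb G hz]
      by_cases h : v ∈ nb G z
      · have h' : z ∈ nb G v := by rw [mem_nb] at *; exact h.symm
        rw [if_neg hz, if_pos h', ← Finset.card_erase_add_one h]
      · have h' : z ∉ nb G v := by rw [mem_nb] at *; exact fun e => h e.symm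
        rw [Finset.erase_eq_of_notMem h, if_neg hz, if_neg h']; rfl
  unfold ds
  rw [Finset.sum_congr rfl (fun z _ => this z)]
  simp only [Finset.sum_add_distrib, Finset.sum_ite_eq', Finset.mem_univ, if_true,
    Finset.sum_ite_mem, Finset.univ_inter, Finset.sum_const, smul_eq_mul, mul_one]
  omega

lemma split_sub_v {G : SimpleGraph V} {v x y a : V} (h : x ≠ y) (hx : G.Adj v x) (hy : G.Adj v y)
    (ha : (split G v (pr x y)).Adj v a) : G.Adj v a := by
  have : a ∈ nb (split G v (pr x y)) v := by simpa using ha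
  rw [nb_split_v (pr_isM h hx hy)] at this
  simpa using (Finset.mem_filter.1 this).1

/-- clique immersion with branch vertices inside `Y` -/
def HasKY (Y : Finset V) (t : ℕ) (G : SimpleGraph V) : Prop :=
  ∃ Z ⊆ Y, Z.card = t ∧ Imm (KZ Z) G

lemma HasKY.mono {Y : Finset V} {t : ℕ} {H G : SimpleGraph V} (h : HasKY Y t H) (hi : Imm H G) :
    HasKY Y t G := by
  obtain ⟨Z, hY, hZ, h⟩ := h
  exact ⟨Z, hY, hZ, h.trans hi⟩

lemma removeA {t : ℕ} (Y : Finset V) (ht : 1 ≤ t) (v : V) : ∀ (n : ℕ) (G : SimpleGraph V), ¬ HasKY Y t G →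
    nb G v ⊆ Y →
    (nb G v).card = n → ∃ G', Imm G' G ∧ nb G' v = ∅ ∧ ds G ≤ ds G' + (n + (t - 1)) ∧
      (∀ a b, G'.Adj a b → G.Adj a b ∨ (G.Adj v a ∧ G.Adj v b)) ∧
      (∀ x, x ≠ v → ¬ G.Adj v x → nb G' x = nb G x) := by
  intro n
  induction n using Nat.strong_induction_on with
  | _ n ih =>
  intro G hK hnY hn
  by_cases hcl : ∃ x y, x ≠ y ∧ G.Adj v x ∧ G.Adj v y ∧ ¬ G.Adj x y
  · obtain ⟨x, y, h, hx, hy, hxy⟩ := hcl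
    have hI := split_imm (pr_isM h hx hy)
    have hc := pr_card_v h hx hy
    obtain ⟨G', h1, h2, h3, h4, h5⟩ := ih (n-2) (by omega) (split G v (pr x y))
      (fun hk => hK (hk.mono hI))
      (fun a ha => hnY (by rw [mem_nb] at *; exact split_sub_v h hx hy ha)) (by omega)
    refine ⟨G', h1.trans hI, h2, ?_, ?_, ?_⟩
    · rw [pr_ds_nonadj h hx hy hxy]; omega
    · intro a b hab
      rcases h4 a b hab with h6 | h6
      · rcases h6.2 with h7 | h7
        · right
          have := (pr_adj h).1 h7.1
          rcases this with ⟨rfl, rfl⟩ | ⟨rfl, rfl⟩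
          · exact ⟨hx, hy⟩
          · exact ⟨hy, hx⟩
        · exact Or.inl h7.2.1
      · exact Or.inr ⟨split_sub_v h hx hy h6.1, split_sub_v h hx hy h6.2⟩
    · intro z hz hzv
      rw [h5 z hz (fun h' => hzv (split_sub_v h hx hy h'))]
      apply pr_card_other h hz
      · rintro rfl; exact hzv hx
      · rintro rfl; exact hzv hy
  · push Not at hcl
    have hlt : (nb G v).card < t := by
      by_contra hge
      apply hK
      obtain ⟨W, hW, hc⟩ := Finset.exists_subset_card_eq (not_lt.1 hge)
      refine ⟨W, hW.trans hnY, hc, Imm.of_le ?_⟩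
      intro x y hxy
      exact hcl x y hxy.1 (by simpa using hW hxy.2.1) (by simpa using hW hxy.2.2)
    refine ⟨del G v, Imm.of_le (del_le G v), del_nb_v G v, ?_, ?_, ?_⟩
    · rw [del_ds G v]; omega
    · intro a b hab; exact Or.inl hab.1
    · intro x hx hxv
      rw [del_nb G hx, Finset.erase_eq_of_notMem]
      simpa using fun h => hxv h.symm

lemma removeB {t : ℕ} (ht : 1 ≤ t) (v : V) : ∀ (n : ℕ) (G : SimpleGraph V), ¬ HasK t G →
    (∀ z, Even (nb G z).card) →
    (nb G v).card = n → ∃ G', Imm G' G ∧ nb G' v = ∅ ∧ ds G ≤ ds G' + (n + 2 * min n (t - 1)) ∧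
      (∀ z, (nb G' z).card ≤ (nb G z).card) ∧ (∀ z, Even (nb G' z).card) := by
  intro n
  induction n using Nat.strong_induction_on with
  | _ n ih =>
  intro G hK hev hn
  by_cases hcl : ∃ x y, x ≠ y ∧ G.Adj v x ∧ G.Adj v y ∧ ¬ G.Adj x y
  · obtain ⟨x, y, h, hx, hy, hxy⟩ := hcl
    have hI := split_imm (pr_isM h hx hy)
    have hc := pr_card_v h hx hy
    have hz : ∀ z, (nb (split G v (pr x y)) z).card + (if z = v then 2 else 0) = (nb G z).card := by
      intro z
      split_ifs with hz
      · subst hz; exact hc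
      · exact pr_card_nonadj h hx hy hxy hz
    obtain ⟨G', h1, h2, h3, h4, h5⟩ := ih (n-2) (by omega) (split G v (pr x y))
      (fun hk => hK (hk.mono hI)) (by
        intro z
        have := hev z
        rw [← hz z] at this
        split_ifs at this
        · simpa [Nat.even_add] using this
        · simpa using this) (by omega)
    refine ⟨G', h1.trans hI, h2, ?_, ?_, h5⟩
    · rw [pr_ds_nonadj h hx hy hxy]; omega
    · intro z
      have := hz z
      exact (h4 z).trans (by omega)
  · push Not at hcl
    have hlt : (nb G v).card < t := by
      by_contra hge
      apply hK
      apply HasK.of_clique (nb G v) (not_lt.1 hge)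
      intro x hx y hy hxy
      exact hcl x y hxy (by simpa using hx) (by simpa using hy)
    by_cases h0 : n = 0
    · refine ⟨G, Imm.refl G, ?_, by omega, fun _ => le_rfl, hev⟩
      rw [← Finset.card_eq_zero]; omega
    have h2 : 1 < (nb G v).card := by
      have := hev v
      rcases this with ⟨k, hk⟩
      omega
    obtain ⟨x, hx, y, hy, h⟩ := Finset.one_lt_card.1 h2
    rw [mem_nb] at hx hy
    have hxy := hcl x y h hx hy
    have hI := split_imm (pr_isM h hx hy)
    have hc := pr_card_v h hx hy
    have hz : ∀ z, (nb (split G v (pr x y)) z).card + (if z = v ∨ z = x ∨ z = y then 2 else 0)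
        = (nb G z).card := by
      intro z
      split_ifs with hz
      · rcases hz with rfl | hz
        · exact hc
        · exact pr_card_adj h hx hy hxy hz
      · push Not at hz
        rw [pr_card_other h hz.1 hz.2.1 hz.2.2]; rfl
    obtain ⟨G', h1, h2, h3, h4, h5⟩ := ih (n-2) (by omega) (split G v (pr x y))
      (fun hk => hK (hk.mono hI)) (by
        intro z
        have := hev z
        rw [← hz z] at this
        split_ifs at this
        · simpa [Nat.even_add] using this
        · simpa using this) (by omega)
    refine ⟨G', h1.trans hI, h2, ?_, ?_, h5⟩
    · rw [pr_ds_adj h hx hy hxy]; omega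
    · intro z
      have := hz z
      exact (h4 z).trans (by omega)

lemma phaseX {t : ℕ} (ht : 1 ≤ t) {G : SimpleGraph V} (X Y : Finset V) (hK : ¬ HasKY Y t G)
    (hXY : ∀ x ∈ X, nb G x ⊆ Y) (hX : ∀ x ∈ X, ∀ y ∈ X, ¬ G.Adj x y) : ∀ S : Finset V, S ⊆ X → ∃ Γ, Imm Γ G ∧
      (∀ x ∈ S, nb Γ x = ∅) ∧ (∀ x ∈ X, x ∉ S → nb Γ x = nb G x) ∧
      ds G ≤ ds Γ + ∑ x ∈ S, ((nb G x).card + (t - 1)) ∧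
      ∀ a b, Γ.Adj a b → G.Adj a b ∨ (a ∉ X ∧ b ∉ X) := by
  intro S
  induction S using Finset.induction_on with
  | empty =>
    intro _
    exact ⟨G, Imm.refl G, by simp, by simp, by simp, fun a b h => Or.inl h⟩
  | insert v S hv ih =>
    intro hS
    obtain ⟨Γ, h1, h2, h3, h4, h5⟩ := ih ((Finset.subset_insert _ _).trans hS)
    have hvX : v ∈ X := hS (Finset.mem_insert_self _ _)
    have hnv := h3 v hvX hv
    have hadj : ∀ a, Γ.Adj v a ↔ G.Adj v a := by
      intro a
      rw [← mem_nb, hnv, mem_nb]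
    obtain ⟨Γ', g1, g2, g3, g4, g5⟩ := removeA Y ht v _ Γ (fun hk => hK (hk.mono h1))
      (by rw [hnv]; exact hXY v hvX) rfl
    refine ⟨Γ', g1.trans h1, ?_, ?_, ?_, ?_⟩
    · intro x hx
      rw [Finset.mem_insert] at hx
      by_cases hxv : x = v
      · rw [hxv]; exact g2
      · have hxS := hx.resolve_left hxv
        rw [g5 x hxv, h2 x hxS]
        intro h
        have : v ∈ nb Γ x := by simpa using h.symm
        rw [h2 x hxS] at this
        simp at this
    · intro x hx hxS
      rw [Finset.mem_insert] at hxS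
      push Not at hxS
      rw [g5 x hxS.1, h3 x hx hxS.2]
      rw [hadj]
      exact hX v hvX x hx
    · rw [Finset.sum_insert hv]
      rw [hnv] at g3
      omega
    · intro a b hab
      rcases g4 a b hab with h | h
      · exact h5 a b h
      · right
        rw [hadj, hadj] at h
        exact ⟨fun ha => hX v hvX a ha h.1, fun hb => hX v hvX b hb h.2⟩

lemma nb_eq (G : SimpleGraph V) (x : V) : nb G x = G.neighborFinset x := by
  ext y; simp

lemma ds_mono {H G : SimpleGraph V} (h : H ≤ G) : ds H ≤ ds G := by
  apply Finset.sum_le_sum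
  intro x _
  apply Finset.card_le_card
  intro y hy
  rw [mem_nb] at *
  exact h hy

lemma ds_acyclic {K : SimpleGraph V} (h : K.IsAcyclic) : ds K ≤ 2 * Fintype.card V := by
  by_cases hV : Nonempty V
  · obtain ⟨T, hT, _, h2⟩ := (connected_top (V := V)).exists_isTree_le_of_le_of_isAcyclic
      (H := K) le_top h
    have h3 := h2.card_edgeFinset
    have h4 := T.sum_degrees_eq_twice_card_edges
    have h5 : ds T = ∑ v, T.degree v := by
      unfold ds
      apply Finset.sum_congr rfl
      intro x _
      rw [nb_eq]; rfl
    have := ds_mono hT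
    omega
  · rw [not_nonempty_iff] at hV
    simp [ds]

lemma evenize (Γ : SimpleGraph V) : ∃ H ≤ Γ, (∀ z, Even (nb H z).card) ∧
    ds Γ ≤ ds H + 2 * Fintype.card V := by
  have hfin : (Set.univ : Set (SimpleGraph V)).Finite := Set.toFinite _
  obtain ⟨H, ⟨hH, hev⟩, hmax⟩ := Set.exists_max_image {H : SimpleGraph V | H ≤ Γ ∧
    ∀ z, Even (nb H z).card} ds (hfin.subset (Set.subset_univ _))
    ⟨⊥, bot_le, by intro z; simp [nb]⟩
  refine ⟨H, hH, hev, ?_⟩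
  have hac : (Γ \ H).IsAcyclic := by
    intro u c hc
    let C : SimpleGraph V := c.toSubgraph.spanningCoe
    have hCle : C ≤ Γ \ H := c.toSubgraph.spanningCoe_le
    have hcard : ∀ z, (nb C z).card = 0 ∨ (nb C z).card = 2 := by
      intro z
      have : (nb C z : Set V) = c.toSubgraph.neighborSet z := by
        ext y; simp [C]
      rw [← Set.ncard_coe_finset, this]
      by_cases hz : z ∈ c.support
      · right
        exact hc.ncard_neighborSet_toSubgraph_eq_two hz
      · left
        rw [Set.ncard_eq_zero, Set.eq_empty_iff_forall_notMem]
        intro y hy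
        apply hz
        rw [← Walk.mem_verts_toSubgraph]
        exact c.toSubgraph.edge_vert hy
    have hnb : ∀ z, (nb (H ⊔ C) z).card = (nb H z).card + (nb C z).card := by
      intro z
      rw [← Finset.card_union_of_disjoint]
      · congr 1
        ext y; simp
      · rw [Finset.disjoint_left]
        intro y hy hy'
        rw [mem_nb] at hy hy'
        exact (hCle hy').2 hy
    have h1 := hmax (H ⊔ C) ⟨sup_le hH (hCle.trans sdiff_le), by
      intro z
      rw [hnb]
      rcases hcard z with h | h
      · rw [h]; exact hev z
      · rw [h]; exact (hev z).add even_two⟩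
    have h2 : ds (H ⊔ C) = ds H + ds C := by
      unfold ds
      rw [← Finset.sum_add_distrib]
      exact Finset.sum_congr rfl fun z _ => hnb z
    have h3 : ds C = 0 := by omega
    have h4 : (nb C u).card = 0 := by
      have := Finset.sum_eq_zero_iff.1 h3 u (Finset.mem_univ _)
      exact this
    have : (nb C u : Set V) = c.toSubgraph.neighborSet u := by
      ext y; simp [C]
    have h5 := hc.ncard_neighborSet_toSubgraph_eq_two c.start_mem_support
    rw [← this, Set.ncard_coe_finset] at h5
    omega
  have h1 := ds_acyclic hac
  have h2 : ds Γ ≤ ds H + ds (Γ \ H) := by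
    unfold ds
    rw [← Finset.sum_add_distrib]
    apply Finset.sum_le_sum
    intro z _
    refine le_trans (Finset.card_le_card ?_) (Finset.card_union_le _ _)
    intro y hy
    simp only [Finset.mem_union, mem_nb, sdiff_adj] at *
    tauto
  omega

end TE

open SimpleGraph

namespace TE
set_option linter.unusedSectionVars false
open Classical
variable {V : Type*} [Fintype V]

lemma tutte_fin (J : SimpleGraph V) (N : Finset V) (hN : Even N.card) :
    (∃ M ≤ J, (∀ x y z, M.Adj x y → M.Adj x z → y = z) ∧ (∀ x y, M.Adj x y → x ∈ N) ∧
      ∀ x ∈ N, ∃ y, M.Adj x y) ∨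
    (∃ S ⊆ N, ∃ κ : V → V, (∀ x ∈ N \ S, ∀ y ∈ N \ S, J.Adj x y → κ x = κ y) ∧
      S.card + 2 ≤ ((N \ S).image κ).card) := by
  let W := {x // x ∈ N}
  let JW : SimpleGraph W := J.comap Subtype.val
  by_cases hpm : ∃ M : Subgraph JW, M.IsPerfectMatching
  · left
    obtain ⟨M, hM⟩ := hpm
    rw [Subgraph.isPerfectMatching_iff] at hM
    let M' : SimpleGraph V :=
      { Adj := fun x y => ∃ (hx : x ∈ N) (hy : y ∈ N), M.Adj ⟨x, hx⟩ ⟨y, hy⟩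
        symm := ⟨fun x y ⟨hx, hy, h⟩ => ⟨hy, hx, h.symm⟩⟩
        loopless := ⟨fun x ⟨_, _, h⟩ => h.ne rfl⟩ }
    refine ⟨M', ?_, ?_, ?_, ?_⟩
    · rintro x y ⟨hx, hy, h⟩
      exact h.adj_sub
    · rintro x y z ⟨hx, hy, h⟩ ⟨_, hz, h'⟩
      have := (hM ⟨x, hx⟩).unique h h'
      exact congrArg Subtype.val this
    · rintro x y ⟨hx, _⟩
      exact hx
    · intro x hx
      obtain ⟨y, hy, _⟩ := hM ⟨x, hx⟩
      exact ⟨y.1, hx, y.2, hy⟩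
  · right
    rw [SimpleGraph.tutte] at hpm
    push Not at hpm
    obtain ⟨u, hu⟩ := hpm
    unfold IsTutteViolator at hu
    let U : JW.Subgraph := (⊤ : JW.Subgraph).deleteVerts u
    let K := U.coe
    let S : Finset V := (u.toFinset).image Subtype.val
    have hSc : S.card = u.ncard := by
      rw [Finset.card_image_of_injective _ Subtype.val_injective, Set.ncard_eq_toFinset_card']
    have hSN : S ⊆ N := by
      intro x hx
      obtain ⟨y, _, rfl⟩ := Finset.mem_image.1 hx
      exact y.2
    have hverts : ∀ y : W, y ∈ U.verts ↔ y.1 ∉ S := by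
      intro y
      simp [U, S]
    have hvcard : Nat.card U.verts = (N \ S).card := by
      rw [← Nat.card_eq_finsetCard]
      refine Nat.card_congr ⟨fun y => ⟨y.1.1, Finset.mem_sdiff.2 ⟨y.1.2, (hverts _).1 y.2⟩⟩,
        fun x => ⟨⟨x.1, (Finset.mem_sdiff.1 x.2).1⟩, (hverts _).2 (Finset.mem_sdiff.1 x.2).2⟩,
        fun _ => rfl, fun _ => rfl⟩
    have hpar : Odd (K.oddComponents.ncard) ↔ Odd (N \ S).card := by
      rw [← hvcard]
      exact odd_ncard_oddComponents K
    have hcs := Finset.card_sdiff_add_card_eq_card hSN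
    have hge : S.card + 2 ≤ K.oddComponents.ncard := by
      have h1 : S.card < K.oddComponents.ncard := by rw [hSc]; exact hu
      rw [Nat.odd_iff, Nat.odd_iff] at hpar
      rw [Nat.even_iff] at hN
      omega
    have mk : ∀ x, x ∈ N \ S → ∃ y : U.verts, y.1.1 = x := by
      intro x hx
      rw [Finset.mem_sdiff] at hx
      exact ⟨⟨⟨x, hx.1⟩, (hverts _).2 hx.2⟩, rfl⟩
    let κ : V → V := fun x => if h : x ∈ N \ S then
      (K.connectedComponentMk (mk x h).choose).out.1.1 else x
    have hκ : ∀ y : U.verts, κ y.1.1 = (K.connectedComponentMk y).out.1.1 := by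
      intro y
      have hy : y.1.1 ∈ N \ S := Finset.mem_sdiff.2 ⟨y.1.2, (hverts _).1 y.2⟩
      have h1 : (mk _ hy).choose = y := Subtype.ext (Subtype.ext (mk _ hy).choose_spec)
      simp only [κ, hy, dif_pos, h1]
    refine ⟨S, hSN, κ, ?_, ?_⟩
    · intro x hx y hy hxy
      obtain ⟨x, rfl⟩ := mk x hx
      obtain ⟨y, rfl⟩ := mk y hy
      rw [hκ, hκ]
      have : K.connectedComponentMk x = K.connectedComponentMk y := by
        apply ConnectedComponent.sound
        apply Adj.reachable
        have hx2 := x.2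
        have hy2 := y.2
        simp only [U, Subgraph.deleteVerts_verts] at hx2 hy2
        show U.Adj x.1 y.1
        simp only [U, Subgraph.deleteVerts_adj]
        exact ⟨hx2.1, hx2.2, hy2.1, hy2.2, hxy⟩
      rw [this]
    · refine hge.trans ?_
      rw [← Set.ncard_coe_finset]
      apply Set.ncard_le_ncard_of_injOn (fun c : K.ConnectedComponent => c.out.1.1)
      · intro c _
        rw [Finset.mem_coe, Finset.mem_image]
        refine ⟨c.out.1.1, Finset.mem_sdiff.2 ⟨c.out.1.2, (hverts _).1 c.out.2⟩, ?_⟩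
        rw [hκ]
        rw [show K.connectedComponentMk c.out = c from Quot.out_eq c]
      · intro c _ c' _ h
        have : c.out = c'.out := Subtype.ext (Subtype.ext h)
        rw [← Quot.out_eq c, ← Quot.out_eq c']
        exact congrArg _ this

end TE

open SimpleGraph

namespace TE
set_option linter.unusedSectionVars false
open Classical
variable {V : Type*} [Fintype V]

lemma labels_lt {t : ℕ} {G : SimpleGraph V} (hK : ¬ HasK t G) (U : Finset V) (κ : V → V)
    (h : ∀ x ∈ U, ∀ y ∈ U, κ x ≠ κ y → G.Adj x y) : (U.image κ).card < t := by
  by_contra hge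
  push Not at hge
  have hex : ∀ l, ∃ x, l ∈ U.image κ → x ∈ U ∧ κ x = l := by
    intro l
    by_cases hl : l ∈ U.image κ
    · obtain ⟨x, hx⟩ := Finset.mem_image.1 hl
      exact ⟨x, fun _ => hx⟩
    · exact ⟨l, fun h => absurd h hl⟩
  choose r hr using hex
  apply hK
  apply HasK.of_clique ((U.image κ).image r)
  · rw [Finset.card_image_of_injOn]
    · exact hge
    · intro a ha b hb hab
      rw [← (hr a ha).2, ← (hr b hb).2, hab]
  · intro x hx y hy hxy
    obtain ⟨a, ha, rfl⟩ := Finset.mem_image.1 hx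
    obtain ⟨b, hb, rfl⟩ := Finset.mem_image.1 hy
    apply h _ (hr a ha).1 _ (hr b hb).1
    rw [(hr a ha).2, (hr b hb).2]
    rintro rfl
    exact hxy rfl

lemma obs {t : ℕ} (ht : 1 ≤ t) {G : SimpleGraph V} (hK : ¬ HasK t G) (U : Finset V) (κ : V → V)
    (h : ∀ x ∈ U, ∀ y ∈ U, κ x ≠ κ y → G.Adj x y) (hU : 8 * t ≤ U.card) :
    ∃ l ∈ U.image κ, (U.filter (fun x => κ x ≠ l)).card < t := by
  have hsplit : ∀ L : Finset V, 2 * t ≤ (U.filter (fun x => κ x ∈ L)).card →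
      (U.filter (fun x => κ x ∉ L)).card < t := by
    intro L hL
    by_contra hge
    push Not at hge
    apply hK
    apply HasK.greedy _ (U.filter (fun x => κ x ∈ L)) hge
    · rw [Finset.disjoint_left]
      intro x hx hx'
      exact (Finset.mem_filter.1 hx).2 (Finset.mem_filter.1 hx').2
    · intro x hx y hy _
      rw [Finset.filter_true_of_mem]
      · exact hL
      · intro b hb
        rw [Finset.mem_filter] at hx hy hb
        exact ⟨h x hx.1 b hb.1 (fun e => hx.2 (e ▸ hb.2)), h y hy.1 b hb.1 (fun e => hy.2 (e ▸ hb.2))⟩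
  by_contra hcon
  push Not at hcon
  have hsmall : ∀ l ∈ U.image κ, (U.filter (fun x => κ x = l)).card < 2 * t := by
    intro l hl
    by_contra hge
    push Not at hge
    have := hsplit {l} (by simpa using hge)
    have h2 := hcon l hl
    simp only [Finset.mem_singleton] at this
    exact absurd this (not_lt.2 h2)
  obtain ⟨L, hL, hmin⟩ := Finset.exists_min_image
    ((U.image κ).powerset.filter (fun L => 2 * t ≤ (U.filter (fun x => κ x ∈ L)).card)) Finset.card
    ⟨U.image κ, by
      rw [Finset.mem_filter]
      refine ⟨by simp, ?_⟩
      rw [Finset.filter_true_of_mem (fun x hx => Finset.mem_image_of_mem _ hx)]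
      omega⟩
  rw [Finset.mem_filter, Finset.mem_powerset] at hL
  have hne : L.Nonempty := by
    rw [Finset.nonempty_iff_ne_empty]
    rintro rfl
    have := hL.2
    simp at this
    omega
  obtain ⟨l, hl⟩ := hne
  have h1 : (U.filter (fun x => κ x ∈ L.erase l)).card < 2 * t := by
    by_contra hge
    push Not at hge
    have := hmin (L.erase l) (by
      rw [Finset.mem_filter, Finset.mem_powerset]
      exact ⟨(Finset.erase_subset _ _).trans hL.1, hge⟩)
    rw [Finset.card_erase_of_mem hl] at this
    have := Finset.card_pos.2 ⟨l, hl⟩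
    omega
  have h2 := hsmall l (hL.1 hl)
  have h3 : (U.filter (fun x => κ x ∈ L)).card ≤
      (U.filter (fun x => κ x ∈ L.erase l)).card + (U.filter (fun x => κ x = l)).card := by
    refine le_trans (Finset.card_le_card ?_) (Finset.card_union_le _ _)
    intro x hx
    simp only [Finset.mem_union, Finset.mem_filter, Finset.mem_erase] at *
    tauto
  have h4 := hsplit L hL.2
  have h5 := Finset.card_filter_add_card_filter_not (s := U) (fun x => κ x ∈ L)
  omega

structure St (t : ℕ) (G0 G : SimpleGraph V) (T R B : Finset V) : Prop where
  imm : Imm G G0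
  even : ∀ z, Even (nb G z).card
  RT : R ⊆ T
  iso : ∀ x ∈ R, nb G x = ∅
  out : ∀ x, x ∉ T → (nb G x).card = (nb G0 x).card
  degA : ∀ a ∈ T, a ∉ R → 11 * t + 12 ≤ (nb G a).card + 2 * R.card
  new : ∀ x, (nb G x \ nb G0 x).card ≤ 2 * R.card
  BT : Disjoint B T
  BA : ∀ a ∈ T, a ∉ R → B ⊆ nb G a
  Bm : ∀ w ∈ T, (B \ nb G0 w).card ≤ 2 * t
  Bc : 11 * t + 12 ≤ B.card + 2 * T.card + R.card
  Tt : T.card < t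

lemma St.Rt {t : ℕ} {G0 G : SimpleGraph V} {T R B : Finset V} (h : St t G0 G T R B) :
    R.card < t := lt_of_le_of_lt (Finset.card_le_card h.RT) h.Tt

lemma enlarge {t : ℕ} {G0 G : SimpleGraph V} {T R B : Finset V} (h : St t G0 G T R B)
    (hK : ¬ HasK t G0) (hdeg : ∀ x, (nb G0 x).card = 0 ∨ 11 * t + 12 ≤ (nb G0 x).card)
    (Q S : Finset V) (hQT : Disjoint Q T) (hQt : Q.card < t) (hS : S.card ≤ Q.card)
    (hB : ∀ q ∈ Q, B \ (S ∪ Q) ⊆ nb G q) (hQ : ∀ q ∈ Q, (nb G q).Nonempty) :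
    St t G0 G (T ∪ Q) R (B \ (S ∪ Q)) := by
  have hR := h.Rt
  have hTQ : (T ∪ Q).card = T.card + Q.card := Finset.card_union_of_disjoint hQT.symm
  have hBc : B.card ≤ (B \ (S ∪ Q)).card + 2 * Q.card := by
    have h1 := Finset.le_card_sdiff (S ∪ Q) B
    have h2 := Finset.card_union_le S Q
    omega
  have hBm : ∀ w ∈ T ∪ Q, ((B \ (S ∪ Q)) \ nb G0 w).card ≤ 2 * t := by
    intro w hw
    rw [Finset.mem_union] at hw
    rcases hw with hw | hw
    · exact le_trans (Finset.card_le_card (Finset.sdiff_subset_sdiff Finset.sdiff_subset le_rfl))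
        (h.Bm w hw)
    · refine le_trans (Finset.card_le_card (Finset.sdiff_subset_sdiff (hB w hw) le_rfl)) ?_
      have := h.new w
      omega
  have hBT : Disjoint (B \ (S ∪ Q)) (T ∪ Q) := by
    rw [Finset.disjoint_left]
    intro x hx hx'
    rw [Finset.mem_sdiff, Finset.mem_union] at hx
    rw [Finset.mem_union] at hx'
    rcases hx' with h1 | h1
    · exact Finset.disjoint_left.1 h.BT hx.1 h1
    · exact hx.2 (Or.inr h1)
  have hBc2 := h.Bc
  have hTt := h.Tt
  refine ⟨h.imm, h.even, h.RT.trans Finset.subset_union_left, h.iso, ?_, ?_, h.new, hBT, ?_, hBm,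
    ?_, ?_⟩
  · intro x hx
    rw [Finset.mem_union] at hx
    exact h.out x (fun h => hx (Or.inl h))
  · intro a ha haR
    rw [Finset.mem_union] at ha
    rcases ha with ha | ha
    · exact h.degA a ha haR
    · have h1 := h.out a (Finset.disjoint_left.1 hQT ha)
      have h2 := Finset.card_pos.2 (hQ a ha)
      rcases hdeg a with h3 | h3 <;> omega
  · intro a ha haR
    rw [Finset.mem_union] at ha
    rcases ha with ha | ha
    · exact Finset.sdiff_subset.trans (h.BA a ha haR)
    · exact hB a ha
  · omega
  · by_contra hge
    push Not at hge
    apply hK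
    apply HasK.greedy (T ∪ Q) (B \ (S ∪ Q)) hge hBT.symm
    intro x hx y hy _
    have h1 := hBm x hx
    have h2 := hBm y hy
    set B' := B \ (S ∪ Q)
    have h3 : B'.card ≤ (B'.filter (fun b => G0.Adj x b ∧ G0.Adj y b)).card +
        ((B' \ nb G0 x).card + (B' \ nb G0 y).card) := by
      refine le_trans (Finset.card_le_card (t := B'.filter (fun b => G0.Adj x b ∧ G0.Adj y b) ∪
        ((B' \ nb G0 x) ∪ (B' \ nb G0 y))) ?_) (le_trans (Finset.card_union_le _ _)
          (Nat.add_le_add_left (Finset.card_union_le _ _) _))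
      intro b hb
      simp only [Finset.mem_union, Finset.mem_filter, Finset.mem_sdiff, mem_nb, hb, true_and]
      tauto
    omega

lemma finish {t : ℕ} {G0 G : SimpleGraph V} {T R B : Finset V} (h : St t G0 G T R B)
    {v : V} (hvT : v ∈ T) (hvR : v ∉ R) (G1 M : SimpleGraph V) (B' : Finset V)
    (imm : Imm G1 G) (even : ∀ z, Even (nb G1 z).card) (iso : ∀ x ∈ R, nb G1 x = ∅)
    (out : ∀ x, x ∉ T → (nb G1 x).card = (nb G x).card)
    (hM : IsM G1 v M) (cov : ∀ x, G1.Adj v x → ∃ y, M.Adj x y)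
    (hMT : ∀ x y, M.Adj x y → G1.Adj x y → x ∈ T)
    (deg1 : ∀ a ∈ T, a ∉ R → a ≠ v → (nb G a).card ≤ (nb G1 a).card + 2)
    (deg2 : ∀ a ∈ T, a ∉ R → a ≠ v → ∀ y, M.Adj a y → (nb G a).card ≤ (nb G1 a).card)
    (new : ∀ x, x ≠ v → (nb G1 x \ nb G x).card ≤ 1)
    (hB : B' ⊆ B) (hBc : B.card ≤ B'.card + 1)
    (hBA : ∀ a ∈ T, a ∉ R → a ≠ v → B' ⊆ nb G1 a) :
    St t G0 (split G1 v M) T (insert v R) B' := by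
  have hRc : (insert v R).card = R.card + 1 := Finset.card_insert_of_notMem hvR
  have hv0 : nb (split G1 v M) v = ∅ := by
    rw [nb_split_v hM, Finset.filter_eq_empty_iff]
    intro x hx hx'
    obtain ⟨y, hy⟩ := cov x (by simpa using hx)
    exact hx' y hy
  have hsp := fun x (hx : x ≠ v) (hx' : ∀ z, ¬ M.Adj x z) => nb_split_other (G := G1) hx hx'
  have hBT : Disjoint B' T := Finset.disjoint_of_subset_left hB h.BT
  refine ⟨(split_imm hM).trans (imm.trans h.imm), ?_, ?_, ?_, ?_, ?_, ?_, hBT, ?_, ?_, ?_, h.Tt⟩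
  · intro z
    by_cases hz : z = v
    · rw [hz, hv0]; simp
    by_cases hs : ∃ y, M.Adj z y
    · obtain ⟨y, hy⟩ := hs
      by_cases hg : G1.Adj z y
      · have h1 := card_split_adj hM hy hg
        have h2 := even z
        rw [← h1] at h2
        simpa [Nat.even_add] using h2
      · rw [card_split_nonadj hM hy hg]; exact even z
    · push Not at hs
      rw [hsp z hz hs]; exact even z
  · exact Finset.insert_subset hvT h.RT
  · intro x hx
    by_cases hz : x = v
    · rw [hz, hv0]
    have hxR := (Finset.mem_insert.1 hx).resolve_left hz
    rw [hsp x hz, iso x hxR]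
    intro y hy
    have : v ∈ nb G1 x := by simpa using (hM.nbr _ _ hy).symm
    rw [iso x hxR] at this
    simp at this
  · intro x hx
    have hz : x ≠ v := by rintro rfl; exact hx hvT
    rw [← h.out x hx, ← out x hx]
    by_cases hs : ∃ y, M.Adj x y
    · obtain ⟨y, hy⟩ := hs
      exact card_split_nonadj hM hy (fun hg => hx (hMT x y hy hg))
    · push Not at hs
      rw [hsp x hz hs]
  · intro a ha haR
    rw [Finset.mem_insert] at haR
    push Not at haR
    have h0 := h.degA a ha haR.2
    by_cases hs : ∃ y, M.Adj a y
    · obtain ⟨y, hy⟩ := hs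
      have h1 := deg2 a ha haR.2 haR.1 y hy
      by_cases hg : G1.Adj a y
      · have := card_split_adj hM hy hg
        omega
      · have := card_split_nonadj hM hy hg
        omega
    · push Not at hs
      rw [hsp a haR.1 hs]
      have := deg1 a ha haR.2 haR.1
      omega
  · intro x
    by_cases hz : x = v
    · rw [hz, hv0]; simp
    have h1 : (nb (split G1 v M) x \ nb G1 x).card ≤ 1 := by
      by_cases hs : ∃ y, M.Adj x y
      · obtain ⟨y, hy⟩ := hs
        have : Nonempty V := ⟨x⟩
        rw [Finset.card_le_one_iff_subset_singleton]
        refine ⟨y, ?_⟩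
        by_cases hg : G1.Adj x y
        · rw [nb_split_adj hM hy hg]
          intro z hz
          simp only [Finset.mem_sdiff, Finset.mem_erase] at hz
          tauto
        · rw [nb_split_nonadj hM hy hg]
          intro z hz
          simp only [Finset.mem_sdiff, Finset.mem_erase, Finset.mem_insert, Finset.mem_singleton] at *
          tauto
      · push Not at hs
        rw [hsp x hz hs]; simp
    have h2 := new x hz
    have h3 := h.new x
    have h4 : (nb (split G1 v M) x \ nb G0 x).card ≤ (nb (split G1 v M) x \ nb G1 x).card +
        ((nb G1 x \ nb G x).card + (nb G x \ nb G0 x).card) := by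
      refine le_trans (Finset.card_le_card (t := (nb (split G1 v M) x \ nb G1 x) ∪
        ((nb G1 x \ nb G x) ∪ (nb G x \ nb G0 x))) ?_) (le_trans (Finset.card_union_le _ _)
          (Nat.add_le_add_left (Finset.card_union_le _ _) _))
      intro z hz
      simp only [Finset.mem_sdiff, Finset.mem_union] at *
      tauto
    omega
  · intro a ha haR b hb
    rw [Finset.mem_insert] at haR
    push Not at haR
    have h1 := hBA a ha haR.2 haR.1 hb
    have hbT : b ∉ T := Finset.disjoint_left.1 hBT hb
    have hbv : b ≠ v := by rintro rfl; exact hbT hvT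
    by_cases hs : ∃ y, M.Adj a y
    · obtain ⟨y, hy⟩ := hs
      by_cases hg : G1.Adj a y
      · rw [nb_split_adj hM hy hg]
        have : b ≠ y := by rintro rfl; exact hbT (hMT _ _ hy.symm hg.symm)
        simp [this, hbv] at *
        exact h1
      · rw [nb_split_nonadj hM hy hg]
        simp [hbv] at *
        exact Or.inr h1
    · push Not at hs
      rw [hsp a haR.1 hs]; exact h1
  · intro w hw
    exact le_trans (Finset.card_le_card (Finset.sdiff_subset_sdiff hB le_rfl)) (h.Bm w hw)
  · have := h.Bc
    omega

end TE

open SimpleGraph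

namespace TE
set_option linter.unusedSectionVars false
open Classical
variable {V : Type*} [Fintype V]

lemma detour_adj {G : SimpleGraph V} {u v a y x z : V} (huy : u ≠ y) :
    (detour G u v a y).Adj x z ↔
    (G.Adj x z ∧ ¬ (x = u ∧ z = v) ∧ ¬ (x = v ∧ z = u) ∧ ¬ (x = v ∧ z = a) ∧ ¬ (x = a ∧ z = v) ∧
      ¬ (x = a ∧ z = y) ∧ ¬ (x = y ∧ z = a)) ∨ (x = u ∧ z = y) ∨ (x = y ∧ z = u) := by
  rw [detour, fromEdgeSet_adj]
  simp only [Set.mem_union, Set.mem_sdiff, Set.mem_insert_iff, Set.mem_singleton_iff, Sym2.eq_iff,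
    mem_edgeSet]
  have := fun h : G.Adj x z => h.ne
  simp only [not_or]
  grind

lemma detour_nb_v {G : SimpleGraph V} {u v a y : V} (h1 : G.Adj u v) (h2 : G.Adj v a)
    (h3 : G.Adj a y) (h4 : ¬ G.Adj u y) (huy : u ≠ y) (hyv : y ≠ v) (hua : u ≠ a) : nb (detour G u v a y) v = ((nb G v).erase u).erase a := by
  ext z
  have := h1.ne; have := h2.ne; have := h3.ne
  simp only [mem_nb, detour_adj huy, Finset.mem_erase]
  grind

lemma detour_nb_u {G : SimpleGraph V} {u v a y : V} (h1 : G.Adj u v) (h2 : G.Adj v a)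
    (h3 : G.Adj a y) (h4 : ¬ G.Adj u y) (huy : u ≠ y) (hyv : y ≠ v) (hua : u ≠ a) : nb (detour G u v a y) u = insert y ((nb G u).erase v) := by
  ext z
  have := h1.ne; have := h2.ne; have := h3.ne
  simp only [mem_nb, detour_adj huy, Finset.mem_erase, Finset.mem_insert]
  grind

lemma detour_nb_a {G : SimpleGraph V} {u v a y : V} (h1 : G.Adj u v) (h2 : G.Adj v a)
    (h3 : G.Adj a y) (h4 : ¬ G.Adj u y) (huy : u ≠ y) (hyv : y ≠ v) (hua : u ≠ a) : nb (detour G u v a y) a = ((nb G a).erase v).erase y := by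
  ext z
  have := h1.ne; have := h2.ne; have := h3.ne
  simp only [mem_nb, detour_adj huy, Finset.mem_erase]
  grind

lemma detour_nb_y {G : SimpleGraph V} {u v a y : V} (h1 : G.Adj u v) (h2 : G.Adj v a)
    (h3 : G.Adj a y) (h4 : ¬ G.Adj u y) (huy : u ≠ y) (hyv : y ≠ v) (hua : u ≠ a) : nb (detour G u v a y) y = insert u ((nb G y).erase a) := by
  ext z
  have := h1.ne; have := h2.ne; have := h3.ne
  simp only [mem_nb, detour_adj huy, Finset.mem_erase, Finset.mem_insert]
  grind

lemma detour_nb_other {G : SimpleGraph V} {u v a y : V} (h1 : G.Adj u v) (h2 : G.Adj v a)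
    (h3 : G.Adj a y) (h4 : ¬ G.Adj u y) (huy : u ≠ y) (hyv : y ≠ v) (hua : u ≠ a) {x : V} (hxv : x ≠ v) (hxu : x ≠ u) (hxa : x ≠ a) (hxy : x ≠ y) :
    nb (detour G u v a y) x = nb G x := by
  ext z
  have := h1.ne; have := h2.ne; have := h3.ne
  simp only [mem_nb, detour_adj huy]
  grind

lemma detour_card_v {G : SimpleGraph V} {u v a y : V} (h1 : G.Adj u v) (h2 : G.Adj v a)
    (h3 : G.Adj a y) (h4 : ¬ G.Adj u y) (huy : u ≠ y) (hyv : y ≠ v) (hua : u ≠ a) : (nb (detour G u v a y) v).card + 2 = (nb G v).card := by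
  rw [detour_nb_v h1 h2 h3 h4 huy hyv hua]
  have e1 : u ∈ nb G v := by simpa using h1.symm
  have e2 : a ∈ (nb G v).erase u := by simp [h2, hua.symm]
  rw [← Finset.card_erase_add_one e1, ← Finset.card_erase_add_one e2]

lemma detour_card_a {G : SimpleGraph V} {u v a y : V} (h1 : G.Adj u v) (h2 : G.Adj v a)
    (h3 : G.Adj a y) (h4 : ¬ G.Adj u y) (huy : u ≠ y) (hyv : y ≠ v) (hua : u ≠ a) : (nb (detour G u v a y) a).card + 2 = (nb G a).card := by
  rw [detour_nb_a h1 h2 h3 h4 huy hyv hua]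
  have e1 : v ∈ nb G a := by simpa using h2.symm
  have e2 : y ∈ (nb G a).erase v := by simp [h3, hyv]
  rw [← Finset.card_erase_add_one e1, ← Finset.card_erase_add_one e2]

lemma detour_card_u {G : SimpleGraph V} {u v a y : V} (h1 : G.Adj u v) (h2 : G.Adj v a)
    (h3 : G.Adj a y) (h4 : ¬ G.Adj u y) (huy : u ≠ y) (hyv : y ≠ v) (hua : u ≠ a) : (nb (detour G u v a y) u).card = (nb G u).card := by
  rw [detour_nb_u h1 h2 h3 h4 huy hyv hua, Finset.card_insert_of_notMem (by simp [h4])]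
  have e1 : v ∈ nb G u := by simpa using h1
  rw [← Finset.card_erase_add_one e1]

lemma detour_card_y {G : SimpleGraph V} {u v a y : V} (h1 : G.Adj u v) (h2 : G.Adj v a)
    (h3 : G.Adj a y) (h4 : ¬ G.Adj u y) (huy : u ≠ y) (hyv : y ≠ v) (hua : u ≠ a) : (nb (detour G u v a y) y).card = (nb G y).card := by
  rw [detour_nb_y h1 h2 h3 h4 huy hyv hua,
    Finset.card_insert_of_notMem (by simpa using fun _ h => h4 (G.adj_symm h))]
  have e1 : a ∈ nb G y := by simpa using h3.symm
  rw [← Finset.card_erase_add_one e1]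

lemma detour_card_ge {G : SimpleGraph V} {u v a y : V} (h1 : G.Adj u v) (h2 : G.Adj v a)
    (h3 : G.Adj a y) (h4 : ¬ G.Adj u y) (huy : u ≠ y) (hyv : y ≠ v) (hua : u ≠ a) {x : V} (hxv : x ≠ v) (hxa : x ≠ a) :
    (nb (detour G u v a y) x).card = (nb G x).card := by
  by_cases hxu : x = u
  · subst hxu; exact detour_card_u h1 h2 h3 h4 huy hyv hua
  by_cases hxy : x = y
  · subst hxy; exact detour_card_y h1 h2 h3 h4 huy hyv hua
  rw [detour_nb_other h1 h2 h3 h4 huy hyv hua hxv hxu hxa hxy]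



lemma step {t : ℕ} {G0 G : SimpleGraph V} {T R B : Finset V} (h : St t G0 G T R B)
    (hK : ¬ HasK t G0) (hdeg : ∀ x, (nb G0 x).card = 0 ∨ 11 * t + 12 ≤ (nb G0 x).card)
    {v : V} (hvT : v ∈ T) (hvR : v ∉ R) : ∃ G' T' R' B', St t G0 G' T' R' B' ∧ T ⊆ T' ∧
      T.card + R.card < T'.card + R'.card := by
  have hRt := h.Rt
  have hTt := h.Tt
  have ht2 : 2 ≤ t := by
    have := Finset.card_pos.2 ⟨v, hvT⟩
    omega
  have hKG : ¬ HasK t G := fun hk => hK (hk.mono h.imm)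
  have hNR : ∀ x, G.Adj v x → x ∉ R := by
    intro x hx hxR
    have : v ∈ nb G x := by simpa using hx.symm
    rw [h.iso x hxR] at this
    simp at this
  obtain ⟨a0, ha0⟩ : ∃ a0, (a0 ∈ T ∧ G.Adj v a0) ∨ (a0 = v ∧ ∀ x ∈ T, ¬ G.Adj v x) := by
    by_cases hex : ∃ x ∈ T, G.Adj v x
    · obtain ⟨x, hx⟩ := hex
      exact ⟨x, Or.inl hx⟩
    · push Not at hex
      exact ⟨v, Or.inr ⟨rfl, hex⟩⟩
  let J : SimpleGraph V :=
    { Adj := fun x y => x ≠ y ∧ (¬ G.Adj x y ∨ (x ∈ T ∧ y ∈ T) ∨ x = a0 ∨ y = a0)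
      symm := ⟨fun x y h => ⟨h.1.symm, by
        rcases h.2 with h | h | h | h
        · exact Or.inl fun e => h e.symm
        · exact Or.inr (Or.inl ⟨h.2, h.1⟩)
        · exact Or.inr (Or.inr (Or.inr h))
        · exact Or.inr (Or.inr (Or.inl h))⟩⟩
      loopless := ⟨fun _ h => h.1 rfl⟩ }
  rcases tutte_fin J (nb G v) (h.even v) with ⟨M, hMJ, huniq, hMN, hcov⟩ | ⟨S, hSN, κ, hκ, hcard⟩
  · -- perfect matching
    have hMN' : ∀ x y, M.Adj x y → G.Adj v x := fun x y hxy => by simpa using hMN x y hxy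
    have hIM : IsM G v M := ⟨huniq, hMN'⟩
    have hcov' : ∀ x, G.Adj v x → ∃ y, M.Adj x y := fun x hx => hcov x (by simpa using hx)
    by_cases hbad : ∃ u, M.Adj a0 u ∧ G.Adj a0 u ∧ u ∉ T
    · obtain ⟨u, hMu, hGu, huT⟩ := hbad
      have hva : G.Adj v a0 := hMN' _ _ hMu
      have haT : a0 ∈ T := by
        rcases ha0 with h1 | h1
        · exact h1.1
        · exact absurd h1.1 hva.ne.symm
      have haR := hNR a0 hva
      have hvu : G.Adj v u := hMN' _ _ hMu.symm
      by_cases hy : ∃ y, G.Adj a0 y ∧ y ≠ u ∧ y ≠ v ∧ ¬ G.Adj u y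
      · obtain ⟨y, h3, hyu, hyv, h4⟩ := hy
        have h1 := hvu.symm
        have h2 := hva
        have huy := hyu.symm
        have hua := hGu.ne.symm
        let M' : SimpleGraph V :=
          { Adj := fun x z => M.Adj x z ∧ x ≠ a0 ∧ x ≠ u ∧ z ≠ a0 ∧ z ≠ u
            symm := ⟨fun x z h => ⟨h.1.symm, h.2.2.2.1, h.2.2.2.2, h.2.1, h.2.2.1⟩⟩
            loopless := ⟨fun _ h => h.1.ne rfl⟩ }
        have cge := fun x (hxv : x ≠ v) (hxa : x ≠ a0) =>
          detour_card_ge h1 h2 h3 h4 huy hyv hua hxv hxa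
        have hv1 := detour_nb_v h1 h2 h3 h4 huy hyv hua
        have adjv : ∀ x, (detour G u v a0 y).Adj v x ↔ x ≠ a0 ∧ x ≠ u ∧ G.Adj v x := by
          intro x
          rw [← mem_nb, hv1]
          simp
        refine ⟨_, T, insert v R, B.erase y, finish h hvT hvR (detour G u v a0 y) M' (B.erase y)
          (detour_imm h1 h2 h3 h4) ?_ ?_ ?_ ⟨?_, ?_⟩ ?_ ?_ ?_ ?_ ?_ (Finset.erase_subset _ _) ?_ ?_,
          le_rfl, ?_⟩
        · intro z
          by_cases hz : z = v
          · subst hz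
            have e1 := h.even z
            rw [← detour_card_v h1 h2 h3 h4 huy hyv hua] at e1
            simpa [Nat.even_add] using e1
          by_cases hz' : z = a0
          · subst hz'
            have e1 := h.even z
            rw [← detour_card_a h1 h2 h3 h4 huy hyv hua] at e1
            simpa [Nat.even_add] using e1
          rw [cge z hz hz']
          exact h.even z
        · intro x hx
          rw [← Finset.card_eq_zero, cge x ?_ ?_, h.iso x hx]
          · simp
          · rintro rfl; exact hvR hx
          · rintro rfl; exact haR hx
        · intro x hx
          apply cge
          · rintro rfl; exact hx hvT
          · rintro rfl; exact hx haT
        · intro x y z hy hz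
          exact huniq x y z hy.1 hz.1
        · intro x z hxz
          rw [adjv]
          exact ⟨hxz.2.1, hxz.2.2.1, hMN' _ _ hxz.1⟩
        · intro x hx
          rw [adjv] at hx
          obtain ⟨z, hz⟩ := hcov' x hx.2.2
          refine ⟨z, hz, hx.1, hx.2.1, ?_, ?_⟩
          · rintro rfl
            exact hx.2.1 (huniq _ _ _ hz.symm hMu)
          · rintro rfl
            exact hx.1 (huniq _ _ _ hz.symm hMu.symm)
        · intro x z hM hG
          rw [detour_adj huy] at hG
          rcases hG with hG | hG | hG
          · rcases (hMJ hM.1).2 with e | e | e | e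
            · exact absurd hG.1 e
            · exact e.1
            · exact absurd e hM.2.1
            · exact absurd e hM.2.2.2.1
          · exact absurd hG.1 hM.2.2.1
          · exact absurd hG.2 hM.2.2.2.2
        · intro a ha haR hav
          by_cases e : a = a0
          · rw [e, detour_card_a h1 h2 h3 h4 huy hyv hua]
          · rw [cge a hav e]; omega
        · intro a ha haR hav z hz
          rw [cge a hav hz.2.1]
        · intro x hxv
          have : Nonempty V := ⟨x⟩
          rw [Finset.card_le_one_iff_subset_singleton]
          by_cases hxu : x = u
          · subst hxu
            rw [detour_nb_u h1 h2 h3 h4 huy hyv hua]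
            refine ⟨y, ?_⟩
            intro z hz
            simp only [Finset.mem_sdiff, Finset.mem_erase, Finset.mem_insert,
              Finset.mem_singleton] at *
            tauto
          by_cases hxy : x = y
          · subst hxy
            rw [detour_nb_y h1 h2 h3 h4 huy hyv hua]
            refine ⟨u, ?_⟩
            intro z hz
            simp only [Finset.mem_sdiff, Finset.mem_erase, Finset.mem_insert,
              Finset.mem_singleton] at *
            tauto
          by_cases hxa : x = a0
          · subst hxa
            rw [detour_nb_a h1 h2 h3 h4 huy hyv hua]
            refine ⟨u, ?_⟩
            intro z hz
            simp only [Finset.mem_sdiff, Finset.mem_erase, Finset.mem_insert,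
              Finset.mem_singleton] at *
            tauto
          rw [detour_nb_other h1 h2 h3 h4 huy hyv hua hxv hxu hxa hxy]
          exact ⟨u, by simp⟩
        · have := Finset.pred_card_le_card_erase (s := B) (a := y)
          omega
        · intro a ha haR hav b hb
          rw [Finset.mem_erase] at hb
          have hbT : b ∉ T := Finset.disjoint_left.1 h.BT hb.2
          have hbG := h.BA a ha haR hb.2
          have hbv : b ≠ v := by rintro rfl; exact hbT hvT
          have hba : b ≠ a0 := by rintro rfl; exact hbT haT
          by_cases hxu : a = u
          · subst hxu; exact absurd ha huT
          by_cases hxy : a = y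
          · subst hxy
            rw [detour_nb_y h1 h2 h3 h4 huy hyv hua]
            exact Finset.mem_insert_of_mem (Finset.mem_erase.2 ⟨hba, hbG⟩)
          by_cases hxa : a = a0
          · subst hxa
            rw [detour_nb_a h1 h2 h3 h4 huy hyv hua]
            exact Finset.mem_erase.2 ⟨hb.1, Finset.mem_erase.2 ⟨hbv, hbG⟩⟩
          rw [detour_nb_other h1 h2 h3 h4 huy hyv hua hav hxu hxa hxy]
          exact hbG
        · rw [Finset.card_insert_of_notMem hvR]; omega
      · push Not at hy
        have hdis : Disjoint ({u} : Finset V) T := by simpa using huT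
        refine ⟨G, T ∪ {u}, R, B \ (∅ ∪ {u}), enlarge h hK hdeg {u} ∅ hdis ?_ (by simp) ?_ ?_,
          Finset.subset_union_left, ?_⟩
        · simp; omega
        · intro q hq b hb
          rw [Finset.mem_singleton] at hq
          subst hq
          simp only [Finset.empty_union, Finset.mem_sdiff, Finset.mem_singleton] at hb
          have hbT : b ∉ T := Finset.disjoint_left.1 h.BT hb.1
          have := h.BA a0 haT haR hb.1
          rw [mem_nb] at *
          exact hy b this hb.2 (by rintro rfl; exact hbT hvT)
        · intro q hq
          rw [Finset.mem_singleton] at hq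
          subst hq
          exact ⟨v, by simpa using hvu.symm⟩
        · rw [Finset.card_union_of_disjoint hdis.symm]; simp
    · push Not at hbad
      have a0T : ∀ x, M.Adj a0 x → a0 ∈ T := by
        intro x hx
        rcases ha0 with e | e
        · exact e.1
        · exact absurd e.1 (hMN' _ _ hx).ne.symm
      refine ⟨_, T, insert v R, B, finish h hvT hvR G M B (Imm.refl G) h.even h.iso
        (fun _ _ => rfl) hIM hcov' ?_ (fun _ _ _ _ => by omega) (fun _ _ _ _ _ _ => le_rfl)
        (by simp) le_rfl (by omega) (fun a ha haR _ => h.BA a ha haR), le_rfl, ?_⟩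
      · intro x y hM hG
        rcases (hMJ hM).2 with e | e | e | e
        · exact absurd hG e
        · exact e.1
        · subst e; exact a0T y hM
        · subst e; exact hbad x hM.symm hG.symm
      · rw [Finset.card_insert_of_notMem hvR]; omega
  · -- obstruction
    have hadj : ∀ x ∈ nb G v \ S, ∀ y ∈ nb G v \ S, κ x ≠ κ y → G.Adj x y := by
      intro x hx y hy hxy
      by_contra hn
      exact hxy (hκ x hx y hy ⟨fun e => hxy (e ▸ rfl), Or.inl hn⟩)
    have hl := labels_lt hKG _ κ hadj
    have hNc := h.degA v hvT hvR
    have hcs := Finset.card_sdiff_add_card_eq_card hSN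
    obtain ⟨l, hlm, hrest⟩ := obs (by omega) hKG _ κ hadj (by omega)
    set U := nb G v \ S with hU
    let Q := (U.filter (fun x => κ x ≠ l)) \ T
    have hTU : ∀ x ∈ T, ∀ y ∈ T, x ∈ U → y ∈ U → κ x = κ y := by
      intro x hx y hy hxU hyU
      by_cases e : x = y
      · rw [e]
      · exact hκ x hxU y hyU ⟨e, Or.inr (Or.inl ⟨hx, hy⟩)⟩
    have hQim : Q.card ≥ (Q.image κ).card := Finset.card_image_le
    have hlcard := Finset.card_erase_of_mem hlm
    have hQS : S.card ≤ Q.card ∧ 0 < Q.card := by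
      by_cases hex : ∃ a1 ∈ T, a1 ∈ U
      · obtain ⟨a1, h1, h2⟩ := hex
        have hsub : ((U.image κ).erase l).erase (κ a1) ⊆ Q.image κ := by
          intro m hm
          rw [Finset.mem_erase, Finset.mem_erase, Finset.mem_image] at hm
          obtain ⟨hm1, hm2, x, hx, rfl⟩ := hm
          refine Finset.mem_image_of_mem _ (Finset.mem_sdiff.2 ⟨Finset.mem_filter.2 ⟨hx, hm2⟩, ?_⟩)
          intro hxT
          exact hm1 (hTU x hxT a1 h1 hx h2)
        have h3 := Finset.card_le_card hsub
        have h4 := Finset.pred_card_le_card_erase (s := (U.image κ).erase l) (a := κ a1)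
        have h5 : S.card ≤ Q.card := by omega
        refine ⟨h5, ?_⟩
        by_contra h6
        have hS0 : S = ∅ := by rw [← Finset.card_eq_zero]; omega
        have hva1 : G.Adj v a1 := by
          have := (Finset.mem_sdiff.1 h2).1
          simpa using this
        have ha0U : a0 ∈ U := by
          rcases ha0 with e | e
          · rw [hU, hS0]; simpa using e.2
          · exact absurd hva1 (e.2 a1 h1)
        have : U.image κ ⊆ {κ a0} := by
          intro m hm
          obtain ⟨x, hx, rfl⟩ := Finset.mem_image.1 hm
          rw [Finset.mem_singleton]
          by_cases e : x = a0
          · rw [e]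
          · exact hκ x hx a0 ha0U ⟨e, Or.inr (Or.inr (Or.inr rfl))⟩
        have := Finset.card_le_card this
        rw [Finset.card_singleton] at this
        omega
      · push Not at hex
        have hsub : ((U.image κ).erase l) ⊆ Q.image κ := by
          intro m hm
          rw [Finset.mem_erase, Finset.mem_image] at hm
          obtain ⟨hm2, x, hx, rfl⟩ := hm
          refine Finset.mem_image_of_mem _ (Finset.mem_sdiff.2 ⟨Finset.mem_filter.2 ⟨hx, hm2⟩, ?_⟩)
          intro hxT
          exact hex x hxT hx
        have h3 := Finset.card_le_card hsub
        omega
    have hQT : Disjoint Q T := Finset.sdiff_disjoint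
    refine ⟨G, T ∪ Q, R, B \ (S ∪ Q), enlarge h hK hdeg Q S hQT ?_ hQS.1 ?_ ?_,
      Finset.subset_union_left, ?_⟩
    · exact lt_of_le_of_lt (Finset.card_le_card Finset.sdiff_subset) hrest
    · intro q hq b hb
      rw [Finset.mem_sdiff, Finset.mem_union] at hb
      have hbT : b ∉ T := Finset.disjoint_left.1 h.BT hb.1
      have hbU : b ∈ U := Finset.mem_sdiff.2 ⟨h.BA v hvT hvR hb.1, fun e => hb.2 (Or.inl e)⟩
      have hbl : κ b = l := by
        by_contra hne
        exact hb.2 (Or.inr (Finset.mem_sdiff.2 ⟨Finset.mem_filter.2 ⟨hbU, hne⟩, hbT⟩))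
      have hq' := Finset.mem_filter.1 (Finset.mem_sdiff.1 hq).1
      rw [mem_nb]
      exact hadj q hq'.1 b hbU (by rw [hbl]; exact hq'.2)
    · intro q hq
      have hq' := Finset.mem_filter.1 (Finset.mem_sdiff.1 hq).1
      have := (Finset.mem_sdiff.1 hq'.1).1
      rw [mem_nb] at this
      exact ⟨v, by simpa using this.symm⟩
    · rw [Finset.card_union_of_disjoint hQT.symm]; omega

end TE

open SimpleGraph

namespace TE
set_option linter.unusedSectionVars false
open Classical
variable {V : Type*} [Fintype V]

noncomputable def supp (G : SimpleGraph V) : Finset V :=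
  Finset.univ.filter (fun x => (nb G x).card ≠ 0)

lemma phase2 {t : ℕ} (ht : 2 ≤ t) : ∀ (n : ℕ) (G0 : SimpleGraph V), (supp G0).card = n →
    (∀ z, Even (nb G0 z).card) →
    (∀ x, (nb G0 x).card = 0 ∨ 11 * t + 12 ≤ (nb G0 x).card) →
    (∃ x, (nb G0 x).card ≠ 0) → HasK t G0 := by
  intro n
  induction n using Nat.strong_induction_on with
  | _ n ih =>
  intro G0 hn hev hdeg ⟨v0, hv0⟩
  by_contra hK
  have inner : ∀ (k : ℕ) (G : SimpleGraph V) (T R B : Finset V), St t G0 G T R B → v0 ∈ T →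
      2 * Fintype.card V - (T.card + R.card) = k → False := by
    intro k
    induction k using Nat.strong_induction_on with
    | _ k ihk =>
    intro G T R B hSt hvT hk
    by_cases hTR : ∃ v ∈ T, v ∉ R
    · obtain ⟨v, hv, hvR⟩ := hTR
      obtain ⟨G', T', R', B', h', hsub, hlt⟩ := step hSt hK hdeg hv hvR
      have h1 := Finset.card_le_univ T'
      have h2 := Finset.card_le_univ R'
      exact ihk _ (by omega) G' T' R' B' h' (hsub hvT) rfl
    · push Not at hTR
      have hiso : ∀ x ∈ T, (nb G x).card = 0 := by
        intro x hx
        rw [hSt.iso x (hTR x hx)]; rfl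
      apply hK
      refine HasK.mono (ih (supp G).card ?_ G rfl hSt.even ?_ ?_) hSt.imm
      · rw [← hn]
        apply Finset.card_lt_card
        rw [Finset.ssubset_iff_of_subset]
        · refine ⟨v0, by simpa [supp] using hv0, ?_⟩
          rw [supp, Finset.mem_filter]
          exact fun h => h.2 (hiso v0 hvT)
        · intro x hx
          rw [supp, Finset.mem_filter] at *
          by_cases hxT : x ∈ T
          · exact absurd (hiso x hxT) hx.2
          · rw [← hSt.out x hxT]; exact hx
      · intro x
        by_cases hxT : x ∈ T
        · exact Or.inl (hiso x hxT)
        · rw [hSt.out x hxT]; exact hdeg x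
      · have h1 := hSt.Tt
        have h2 := (hdeg v0).resolve_left hv0
        obtain ⟨x, hx, hxT⟩ := Finset.exists_mem_notMem_of_card_lt_card
          (show T.card < (nb G0 v0).card by omega)
        refine ⟨x, ?_⟩
        rw [hSt.out x hxT]
        rw [mem_nb] at hx
        exact (Finset.card_pos.2 ⟨v0, by simpa using hx.symm⟩).ne'
  have hd := (hdeg v0).resolve_left hv0
  refine inner _ G0 {v0} ∅ (nb G0 v0) ⟨Imm.refl _, hev, by simp, by simp, fun _ _ => rfl, ?_, by simp,
    by simp, ?_, ?_, ?_, ?_⟩ (by simp) rfl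
  · intro a ha _
    rw [Finset.mem_singleton] at ha
    subst ha
    simpa using hd
  · intro a ha _
    rw [Finset.mem_singleton] at ha
    subst ha
    exact le_rfl
  · intro a ha
    rw [Finset.mem_singleton] at ha
    subst ha
    simp
  · simp; omega
  · simp; omega

lemma phase1 {t : ℕ} (ht : 2 ≤ t) : ∀ (n : ℕ) (H : SimpleGraph V), (supp H).card = n →
    (∀ z, Even (nb H z).card) → (∃ x, (nb H x).card ≠ 0) →
    (13 * t + 11) * n ≤ ds H → HasK t H := by
  intro n
  induction n using Nat.strong_induction_on with
  | _ n ih =>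
  intro H hn hev hne hds
  by_contra hK
  by_cases hbad : ∃ v, (nb H v).card ≠ 0 ∧ (nb H v).card < 11 * t + 12
  · obtain ⟨v, hv0, hv⟩ := hbad
    obtain ⟨G', h1, h2, h3, h4, h5⟩ := removeB (by omega) v _ H hK hev rfl
    have hsub : insert v (supp G') ⊆ supp H := by
      intro x hx
      rw [Finset.mem_insert] at hx
      rw [supp, Finset.mem_filter]
      refine ⟨Finset.mem_univ _, ?_⟩
      rcases hx with rfl | hx
      · exact hv0
      · rw [supp, Finset.mem_filter] at hx
        have := h4 x
        omega
    have hc := Finset.card_le_card hsub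
    rw [Finset.card_insert_of_notMem (by simp [supp, h2]), hn] at hc
    have h2n : 2 ≤ n := by
      obtain ⟨w, hw⟩ := Finset.card_pos.1 (Nat.pos_of_ne_zero hv0)
      rw [mem_nb] at hw
      have : ({v, w} : Finset V) ⊆ supp H := by
        intro x hx
        rw [Finset.mem_insert, Finset.mem_singleton] at hx
        rw [supp, Finset.mem_filter]
        refine ⟨Finset.mem_univ _, ?_⟩
        rcases hx with rfl | rfl
        · exact hv0
        · exact (Finset.card_pos.2 ⟨v, by simpa using hw.symm⟩).ne'
      have := Finset.card_le_card this
      rw [Finset.card_pair hw.ne, hn] at this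
      exact this
    have hmul1 : (13 * t + 11) * ((supp G').card + 1) ≤ (13 * t + 11) * n :=
      Nat.mul_le_mul_left _ hc
    have hmul2 : (13 * t + 11) * 2 ≤ (13 * t + 11) * n := Nat.mul_le_mul_left _ h2n
    have hmin : min (nb H v).card (t - 1) ≤ t - 1 := min_le_right _ _
    rw [Nat.mul_add] at hmul1
    apply hK
    refine HasK.mono (ih (supp G').card (by omega) G' rfl h5 ?_ (by omega)) h1
    by_contra hcon
    push Not at hcon
    have : ds G' = 0 := Finset.sum_eq_zero (fun x _ => hcon x)
    omega
  · push Not at hbad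
    apply hK
    apply phase2 ht _ H rfl hev _ hne
    intro x
    by_cases hx : (nb H x).card = 0
    · exact Or.inl hx
    · exact Or.inr (hbad x hx)

lemma Imm.nbr {H G : SimpleGraph V} (h : Imm H G) {x y : V} (hxy : H.Adj x y) : ∃ w, G.Adj x w := by
  obtain ⟨F, h1, _, h3⟩ := h
  obtain ⟨w⟩ := h3 x y hxy
  cases w with
  | nil => exact absurd rfl hxy.ne
  | cons h _ =>
    rw [fromEdgeSet_adj] at h
    exact ⟨_, h1 _ hxy h.1⟩

lemma main_comb {t : ℕ} (ht : 2 ≤ t) {G : SimpleGraph V} (Y : Finset V)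
    (hY : ∀ x y, G.Adj x y → (x ∈ Y ↔ y ∉ Y)) (hYc : Fintype.card V ≤ 2 * Y.card)
    (hYne : 0 < Y.card)
    (hdeg : ∀ x, 14 * t + 14 ≤ (nb G x).card) : HasKY Y t G := by
  by_contra hK
  let X := Yᶜ
  have hXc : X.card + Y.card = Fintype.card V := Finset.card_compl_add_card Y
  have hXY : ∀ x ∈ X, nb G x ⊆ Y := by
    intro x hx y hy
    rw [Finset.mem_compl] at hx
    rw [mem_nb] at hy
    by_contra h
    exact hx ((hY x y hy).2 h)
  have hXind : ∀ x ∈ X, ∀ y ∈ X, ¬ G.Adj x y := by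
    intro x hx y hy h
    rw [Finset.mem_compl] at hx hy
    exact hx ((hY x y h).2 hy)
  obtain ⟨Γ, g1, g2, -, g4, g5⟩ := phaseX (by omega) X Y hK hXY hXind X le_rfl
  have hΓY : ∀ a b, Γ.Adj a b → a ∈ Y := by
    intro a b hab
    by_contra ha
    have : b ∈ nb Γ a := by simpa using hab
    rw [g2 a (Finset.mem_compl.2 ha)] at this
    simp at this
  have hdc : ∑ x ∈ X, (nb G x).card = ∑ y ∈ Y, (nb G y).card := by
    have := Finset.sum_card_bipartiteAbove_eq_sum_card_bipartiteBelow (s := X) (t := Y) G.Adj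
    have e1 : ∀ x ∈ X, nb G x = Y.bipartiteAbove G.Adj x := by
      intro x hx
      ext y
      simp only [mem_nb, Finset.mem_bipartiteAbove]
      constructor
      · intro h; exact ⟨hXY x hx (by simpa using h), h⟩
      · exact fun h => h.2
    have e2 : ∀ y ∈ Y, nb G y = X.bipartiteBelow G.Adj y := by
      intro y hy
      ext x
      simp only [mem_nb, Finset.mem_bipartiteBelow]
      constructor
      · intro h; exact ⟨Finset.mem_compl.2 ((hY y x h).1 hy), h.symm⟩
      · exact fun h => h.2.symm
    rw [Finset.sum_congr rfl (fun x hx => by rw [e1 x hx]), this]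
    exact Finset.sum_congr rfl (fun y hy => by rw [e2 y hy])
  have hds : ds G = ∑ x ∈ X, (nb G x).card + ∑ y ∈ Y, (nb G y).card :=
    (Finset.sum_compl_add_sum Y _).symm
  have hYs : Y.card * (14 * t + 14) ≤ ∑ y ∈ Y, (nb G y).card := by
    rw [← smul_eq_mul]
    exact Finset.card_nsmul_le_sum _ _ _ (fun y _ => hdeg y)
  rw [Finset.sum_add_distrib, Finset.sum_const, smul_eq_mul] at g4
  have hXm : X.card * (t - 1) ≤ Y.card * (t - 1) := Nat.mul_le_mul_right _ (by omega)
  have hdsΓ : Y.card * (13 * t + 15) ≤ ds Γ := by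
    have : Y.card * (14 * t + 14) = Y.card * (13 * t + 15) + Y.card * (t - 1) := by
      rw [← Nat.mul_add]; congr 1; omega
    omega
  obtain ⟨H, hH, hev, hHds⟩ := evenize Γ
  have hdsH : Y.card * (13 * t + 11) ≤ ds H := by
    have : Y.card * (13 * t + 15) = Y.card * (13 * t + 11) + Y.card * 4 := by
      rw [← Nat.mul_add]
    omega
  have hsupp : (supp H).card ≤ Y.card := by
    apply Finset.card_le_card
    intro x hx
    rw [supp, Finset.mem_filter] at hx
    obtain ⟨y, hy⟩ := Finset.card_pos.1 (Nat.pos_of_ne_zero hx.2)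
    rw [mem_nb] at hy
    exact hΓY x y (hH hy)
  have hHK : HasK t H := by
    apply phase1 ht _ H rfl hev
    · by_contra hcon
      push Not at hcon
      have h0 : ds H = 0 := Finset.sum_eq_zero (fun x _ => hcon x)
      have : 0 < Y.card * (13 * t + 11) := Nat.mul_pos hYne (by omega)
      omega
    · rw [Nat.mul_comm]
      exact (Nat.mul_le_mul_right _ hsupp).trans hdsH
  obtain ⟨Z, hZ, hI⟩ := hHK.mono (Imm.of_le hH)
  apply hK
  refine ⟨Z, ?_, hZ, hI.trans g1⟩
  intro z hz
  obtain ⟨z', hz', hne⟩ := Finset.exists_mem_ne (show 1 < Z.card by omega) z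
  obtain ⟨w, hw⟩ := hI.nbr (x := z) (y := z') ⟨hne.symm, hz, hz'⟩
  exact hΓY z w hw

lemma to_immersion {t : ℕ} {G : SimpleGraph V} (Y : Finset V)
    (hY : ∀ x y, G.Adj x y → (x ∈ Y ↔ y ∉ Y)) (h : HasKY Y t G) :
    HasTotallyEvenImmersion G (⊤ : SimpleGraph (Fin t)) := by
  obtain ⟨Z, hZY, hZ, F, h1, h2, h3⟩ := h
  let e := Z.equivFinOfCardEq hZ
  let φ : Fin t ↪ V := ⟨fun i => (e.symm i).1, fun i j hij => e.symm.injective (Subtype.ext hij)⟩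
  have hφ : ∀ i, φ i ∈ Z := fun i => (e.symm i).2
  have hadj : ∀ i j, i ≠ j → (KZ Z).Adj (φ i) (φ j) :=
    fun i j hij => ⟨fun h => hij (φ.injective h), hφ i, hφ j⟩
  have hex : ∀ i j, ∃ w : G.Walk (φ i) (φ j), i ≠ j →
      (w.IsTrail ∧ ∀ f ∈ w.edges, f ∈ F s(φ i, φ j)) := by
    intro i j
    by_cases hij : i = j
    · subst hij
      exact ⟨Walk.nil, fun h => absurd rfl h⟩
    · obtain ⟨p, hp⟩ := (h3 _ _ (hadj i j hij)).exists_isPath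
      have hle : fromEdgeSet (F s(φ i, φ j)) ≤ G := by
        intro x y hxy
        rw [fromEdgeSet_adj] at hxy
        exact h1 _ (hadj i j hij) hxy.1
      refine ⟨p.mapLe hle, fun _ => ⟨?_, ?_⟩⟩
      · exact hp.isTrail.mapLe hle
      · intro f hf
        rw [Walk.edges_mapLe_eq_edges] at hf
        have := p.edges_subset_edgeSet hf
        rw [edgeSet_fromEdgeSet] at this
        exact this.1
  choose w hw using hex
  let tr : ∀ ⦃i j : Fin t⦄, (⊤ : SimpleGraph (Fin t)).Adj i j → G.Walk (φ i) (φ j) :=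
    fun i j _ => if i < j then w i j else (w j i).reverse
  have hne : ∀ {i j : Fin t}, (⊤ : SimpleGraph (Fin t)).Adj i j → i ≠ j := fun h => h.ne
  have htr : ∀ ⦃i j : Fin t⦄ (h : (⊤ : SimpleGraph (Fin t)).Adj i j),
      (tr h).IsTrail ∧ ∀ f ∈ (tr h).edges, f ∈ F s(φ i, φ j) := by
    intro i j h
    by_cases hij : i < j
    · simp only [tr, hij, if_true]
      exact hw i j (hne h)
    · simp only [tr, hij, if_false]
      obtain ⟨a, b⟩ := hw j i (hne h).symm
      refine ⟨a.reverse, ?_⟩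
      intro f hf
      rw [Walk.edges_reverse, List.mem_reverse] at hf
      rw [Sym2.eq_swap]
      exact b f hf
  refine ⟨⟨φ, tr, fun i j h => (htr h).1, ?_, ?_⟩, ?_⟩
  · intro i j h
    by_cases hij : i < j
    · have : ¬ j < i := not_lt.2 hij.le
      simp only [tr, hij, this, if_true, if_false]
    · have : j < i := lt_of_le_of_ne (not_lt.1 hij) (hne h).symm
      simp only [tr, hij, this, if_true, if_false, Walk.reverse_reverse]
  · intro u v a b hh1 hh2 hs f hf hf'
    have e1 := (htr hh1).2 f hf
    have e2 := (htr hh2).2 f hf'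
    refine Set.disjoint_left.1 (h2 _ (hadj u v (hne hh1)) _ (hadj a b (hne hh2)) ?_) e1 e2
    intro heq
    apply hs
    rw [Sym2.eq_iff] at *
    simpa only [φ.injective.eq_iff] using heq
  · intro u v hh
    let C : G.Coloring Bool := Coloring.mk (fun x => decide (x ∈ Y)) (by
      intro x y hxy heq
      have := hY x y hxy
      rw [decide_eq_decide] at heq
      tauto)
    rw [C.even_length_iff_congr]
    have e1 : φ u ∈ Y := hZY (hφ u)
    have e2 : φ v ∈ Y := hZY (hφ v)
    have cu : C (φ u) = true := by
      show decide (φ u ∈ Y) = true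
      exact decide_eq_true e1
    have cv : C (φ v) = true := by
      show decide (φ v ∈ Y) = true
      exact decide_eq_true e2
    rw [cu, cv]

end TE

/-- A bipartite graph with minimum degree at least 14t + 14 admits a totally
even immersion of K_t. -/
theorem bipartite_min_degree_totally_even_immersion {V : Type*} [Fintype V] (t : ℕ)
    (ht : 1 ≤ t) (G : SimpleGraph V) [DecidableRel G.Adj] (hbip : G.Colorable 2)
    (hdeg : 14 * t + 14 ≤ G.minDegree) :
    HasTotallyEvenImmersion G (⊤ : SimpleGraph (Fin t)) := by
  classical
  have hd : ∀ x, 14 * t + 14 ≤ (TE.nb G x).card := by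
    intro x
    refine hdeg.trans ((G.minDegree_le_degree x).trans (le_of_eq ?_))
    rw [← card_neighborFinset_eq_degree]
    congr 1
    ext y
    rw [mem_neighborFinset, TE.mem_nb]
  have hV : Nonempty V := by
    by_contra hV
    rw [not_nonempty_iff] at hV
    have : G.minDegree = 0 := by simp
    omega
  obtain ⟨c⟩ := hbip
  have hcol : ∀ i : Fin 2, ∀ x y, G.Adj x y →
      (x ∈ Finset.univ.filter (fun z => c z = i) ↔ y ∉ Finset.univ.filter (fun z => c z = i)) := by
    intro i x y hxy
    have := c.valid hxy
    simp only [Finset.mem_filter, Finset.mem_univ, true_and]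
    omega
  have hsum : (Finset.univ.filter (fun z => c z = 0)).card +
      (Finset.univ.filter (fun z => c z = 1)).card = Fintype.card V := by
    have h01 : Finset.univ.filter (fun z => c z = 1) =
        Finset.univ.filter (fun z => ¬ c z = 0) := by
      ext z
      simp only [Finset.mem_filter, Finset.mem_univ, true_and]
      omega
    rw [h01, Finset.card_filter_add_card_filter_not, Finset.card_univ]
  have hpos := Fintype.card_pos (α := V)
  obtain ⟨i, hi⟩ : ∃ i : Fin 2,
      Fintype.card V ≤ 2 * (Finset.univ.filter (fun z => c z = i)).card := by
    by_cases h : Fintype.card V ≤ 2 * (Finset.univ.filter (fun z => c z = 0)).card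
    · exact ⟨0, h⟩
    · exact ⟨1, by omega⟩
  apply TE.to_immersion _ (hcol i)
  by_cases h2 : 2 ≤ t
  · exact TE.main_comb h2 _ (hcol i) hi (by omega) hd
  · have h1 : t = 1 := by omega
    obtain ⟨v, hv⟩ := Finset.card_pos.1 (show 0 < (Finset.univ.filter (fun z => c z = i)).card by omega)
    refine ⟨{v}, by simpa using hv, by simp [h1], TE.Imm.of_le ?_⟩
    intro x y hxy
    have a := hxy.2.1
    have b := hxy.2.2
    rw [Finset.mem_singleton] at a b
    exact absurd (a.trans b.symm) hxy.1
end

section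
/- Let t ≥ 1 be an integer and let H be a simple graph whose average degree is at least 56t + 56. If a finite simple graph G admits a totally odd immersion of H, then G admits a totally even immersion of K_t. -/
open SimpleGraph

section Helpers
open Classical

/-- Neighbourhood of a vertex as a finset. -/
noncomputable def nbF {V : Type*} [Fintype V] (G : SimpleGraph V) (u : V) : Finset V :=
  Finset.univ.filter (fun w => G.Adj u w)

theorem mem_nbF {V : Type*} [Fintype V] {G : SimpleGraph V} {u w : V} :
    w ∈ nbF G u ↔ G.Adj u w := by simp [nbF]

/-- `G` has a weak immersion of `K_t` whose branch vertices all have the same colour,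
expressed by edge-disjoint connecting edge sets. -/
def MonoImm {V : Type*} (t : ℕ) (c : V → Bool) (G : SimpleGraph V) : Prop :=
  ∃ (f : Fin t → V) (D : Sym2 (Fin t) → Set (Sym2 V)), Function.Injective f ∧
    (∀ i j, c (f i) = c (f j)) ∧ (∀ e, D e ⊆ G.edgeSet) ∧
    (∀ i j, i ≠ j → (SimpleGraph.fromEdgeSet (D s(i, j))).Reachable (f i) (f j)) ∧
    (∀ e e', e ≠ e' → Disjoint (D e) (D e'))

theorem MonoImm.transfer {V : Type*} {t : ℕ} {c : V → Bool} {G G' : SimpleGraph V}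
    (h : MonoImm t c G') (θ : Sym2 V → Set (Sym2 V))
    (h1 : ∀ e ∈ G'.edgeSet, θ e ⊆ G.edgeSet)
    (h2 : ∀ e ∈ G'.edgeSet, ∀ e' ∈ G'.edgeSet, e ≠ e' → Disjoint (θ e) (θ e'))
    (h3 : ∀ a b, G'.Adj a b → (SimpleGraph.fromEdgeSet (θ s(a, b))).Reachable a b) :
    MonoImm t c G := by
  obtain ⟨f, D, hf, hc, hD, hr, hd⟩ := h
  refine ⟨f, fun e => ⋃ x ∈ D e, θ x, hf, hc, ?_, ?_, ?_⟩
  · intro e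
    simp only [Set.iUnion_subset_iff]
    intro x hx
    exact h1 x (hD e hx)
  · intro i j hij
    obtain ⟨p⟩ := hr i j hij
    have key : ∀ a b, (SimpleGraph.fromEdgeSet (D s(i, j))).Walk a b →
        (SimpleGraph.fromEdgeSet (⋃ x ∈ D s(i, j), θ x)).Reachable a b := by
      intro a b p
      induction p with
      | nil => exact SimpleGraph.Reachable.refl _
      | cons hadj p ih =>
        refine SimpleGraph.Reachable.trans ?_ ih
        rw [SimpleGraph.fromEdgeSet_adj] at hadj
        have := h3 _ _ (hD _ hadj.1)
        refine this.mono (SimpleGraph.fromEdgeSet_mono ?_)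
        exact Set.subset_biUnion_of_mem hadj.1
    exact key _ _ p
  · intro e e' hne
    simp only [Set.disjoint_iUnion_left, Set.disjoint_iUnion_right]
    intro x hx y hy
    apply h2 _ (hD _ hy) _ (hD _ hx)
    rintro rfl
    exact Set.disjoint_left.1 (hd _ _ hne) hy hx

theorem reach_edge {V : Type*} {S : Set (Sym2 V)} {a b : V} (h : s(a, b) ∈ S) (hab : a ≠ b) :
    (SimpleGraph.fromEdgeSet S).Reachable a b :=
  SimpleGraph.Adj.reachable (by rw [SimpleGraph.fromEdgeSet_adj]; exact ⟨h, hab⟩)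

theorem exists_mono_subset {V : Type*} (t : ℕ) (c : V → Bool) (S : Finset V)
    (hS : 2 * t ≤ S.card + 1) : ∃ T ⊆ S, T.card = t ∧ ∀ a ∈ T, ∀ b ∈ T, c a = c b := by
  have h := Finset.card_filter_add_card_filter_not (s := S) (fun a => c a = true)
  by_cases h1 : t ≤ (S.filter (fun a => c a = true)).card
  · obtain ⟨T, hT, hc⟩ := Finset.exists_subset_card_eq h1
    refine ⟨T, hT.trans (Finset.filter_subset _ _), hc, ?_⟩
    intro a ha b hb
    rw [(Finset.mem_filter.1 (hT ha)).2, (Finset.mem_filter.1 (hT hb)).2]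
  · have h2 : t ≤ (S.filter (fun a => ¬ c a = true)).card := by omega
    obtain ⟨T, hT, hc⟩ := Finset.exists_subset_card_eq h2
    refine ⟨T, hT.trans (Finset.filter_subset _ _), hc, ?_⟩
    intro a ha b hb
    have := (Finset.mem_filter.1 (hT ha)).2
    have := (Finset.mem_filter.1 (hT hb)).2
    simp_all

theorem list_colour {E V : Type*} [Nonempty V] (s : Finset E) (adj : E → E → Prop)
    (hs : ∀ a b, adj a b → adj b a)
    (hirr : ∀ a, ¬ adj a a) (C : E → Finset V)
    (h : ∀ e ∈ s, (s.filter (fun e' => adj e e')).card < (C e).card) :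
    ∃ m : E → V, (∀ e ∈ s, m e ∈ C e) ∧ ∀ e ∈ s, ∀ e' ∈ s, adj e e' → m e ≠ m e' := by
  induction s using Finset.induction_on with
  | empty => exact ⟨fun _ => Classical.arbitrary V, by simp, by simp⟩
  | insert a s ha ih =>
    obtain ⟨m, h1, h2⟩ := ih (fun e he => lt_of_le_of_lt (Finset.card_le_card
      (Finset.filter_subset_filter _ (Finset.subset_insert _ _)))
      (h e (Finset.mem_insert_of_mem he)))
    have hlt : ((s.filter (fun e' => adj a e')).image m).card < (C a).card := by
      refine lt_of_le_of_lt Finset.card_image_le (lt_of_le_of_lt (Finset.card_le_card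
        (Finset.filter_subset_filter _ (Finset.subset_insert a s)))
        (h a (Finset.mem_insert_self _ _)))
    obtain ⟨x, hx, hxn⟩ := Finset.exists_mem_notMem_of_card_lt_card hlt
    have hx' : ∀ e ∈ s, adj a e → x ≠ m e := by
      rintro e he hadj rfl
      exact hxn (Finset.mem_image_of_mem _ (Finset.mem_filter.2 ⟨he, hadj⟩))
    have hne : ∀ e ∈ s, e ≠ a := by rintro e he rfl; exact ha he
    refine ⟨Function.update m a x, ?_, ?_⟩
    · intro e he
      rcases Finset.mem_insert.1 he with rfl | he
      · simpa using hx
      · rw [Function.update_of_ne (hne e he)]; exact h1 e he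
    · intro e he e' he' hadj
      rcases Finset.mem_insert.1 he with rfl | hes <;>
        rcases Finset.mem_insert.1 he' with rfl | hes'
      · exact absurd hadj (hirr _)
      · rw [Function.update_self, Function.update_of_ne (hne e' hes')]
        exact hx' _ hes' hadj
      · rw [Function.update_self, Function.update_of_ne (hne e hes)]
        exact (hx' _ hes (hs _ _ hadj)).symm
      · rw [Function.update_of_ne (hne e hes), Function.update_of_ne (hne e' hes')]
        exact h2 e hes e' hes' hadj

end Helpers

section HelpersB
open Classical

theorem greedy {V : Type*} [Fintype V] {t : ℕ} {c : V → Bool} {G : SimpleGraph V}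
    (T : Finset V) (hT : T.card = t) (hc : ∀ a ∈ T, ∀ b ∈ T, c a = c b)
    (h : ∀ u ∈ T, ∀ u' ∈ T, u ≠ u' → ¬ G.Adj u u' →
      2 * t ≤ ((nbF G u ∩ nbF G u') \ T).card) : MonoImm t c G := by
  rcases Nat.eq_zero_or_pos t with ht | ht
  · subst ht
    exact ⟨fun i => i.elim0, fun _ => ∅, fun i => i.elim0, fun i => i.elim0, by simp,
      fun i => i.elim0, by simp⟩
  have hne : T.Nonempty := by rw [← Finset.card_pos]; omega
  obtain ⟨v0, _⟩ := hne
  have : Nonempty V := ⟨v0⟩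
  obtain ⟨φ, hφ, hφT⟩ : ∃ φ : Fin t → V, Function.Injective φ ∧ ∀ i, φ i ∈ T := by
    let e := (Finset.equivFinOfCardEq hT).symm
    exact ⟨fun i => (e i : V), fun i j hij => e.injective (Subtype.ext hij), fun i => (e i).2⟩
  let adj : Sym2 (Fin t) → Sym2 (Fin t) → Prop := fun e e' => e ≠ e' ∧ ∃ i, i ∈ e ∧ i ∈ e'
  let C : Sym2 (Fin t) → Finset V := fun e =>
    Finset.univ.filter (fun w => w ∉ T ∧ ∀ i ∈ e, G.Adj (φ i) w)
  let s : Finset (Sym2 (Fin t)) := Finset.univ.filter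
    (fun e => ∃ i j, e = s(i, j) ∧ i ≠ j ∧ ¬ G.Adj (φ i) (φ j))
  obtain ⟨m, hm1, hm2⟩ := list_colour s adj
    (fun a b hab => ⟨hab.1.symm, by obtain ⟨_, i, hi, hj⟩ := hab; exact ⟨i, hj, hi⟩⟩)
    (fun a ha => ha.1 rfl) C (by
      intro e he
      obtain ⟨i, j, rfl, hij, hn⟩ := (Finset.mem_filter.1 he).2
      have h1 : 2 * t ≤ (C s(i, j)).card := by
        refine (h _ (hφT i) _ (hφT j) (fun h => hij (hφ h)) hn).trans (Finset.card_le_card ?_)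
        intro w hw
        simp only [Finset.mem_sdiff, Finset.mem_inter, mem_nbF] at hw
        simp only [C, Finset.mem_filter, Finset.mem_univ, true_and, Sym2.mem_iff]
        refine ⟨hw.2, ?_⟩
        rintro k (rfl | rfl)
        · exact hw.1.1
        · exact hw.1.2
      have h2 : (s.filter (fun e' => adj s(i, j) e')).card <
          ((Finset.univ.image (fun k => s(i, k))) ∪ (Finset.univ.image (fun k => s(j, k)))).card := by
        apply Finset.card_lt_card
        rw [Finset.ssubset_iff_of_subset]
        · refine ⟨s(i, j), ?_, ?_⟩
          · exact Finset.mem_union_left _ (Finset.mem_image_of_mem _ (Finset.mem_univ _))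
          · intro h
            exact (Finset.mem_filter.1 h).2.1 rfl
        · intro e' he'
          obtain ⟨_, k, hk, hk'⟩ := (Finset.mem_filter.1 he').2
          obtain ⟨l, rfl⟩ := Sym2.mem_iff_exists.1 hk'
          rcases Sym2.mem_iff.1 hk with rfl | rfl
          · exact Finset.mem_union_left _ (Finset.mem_image_of_mem _ (Finset.mem_univ _))
          · exact Finset.mem_union_right _ (Finset.mem_image_of_mem _ (Finset.mem_univ _))
      have h3 := Finset.card_union_le (Finset.univ.image (fun k => s(i, k)))
        (Finset.univ.image (fun k => s(j, k)))
      have h4 : (Finset.univ.image (fun k => s(i, k))).card ≤ t :=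
        Finset.card_image_le.trans (by simp)
      have h5 : (Finset.univ.image (fun k => s(j, k))).card ≤ t :=
        Finset.card_image_le.trans (by simp)
      have h6 := lt_of_lt_of_le h2 ((by omega : _ ≤ 2 * t).trans h1)
      refine lt_of_eq_of_lt ?_ h6
      congr)
  have hm3 : ∀ i j, i ≠ j → ¬ G.Adj (φ i) (φ j) → s(i, j) ∈ s := fun i j hij hn =>
    Finset.mem_filter.2 ⟨Finset.mem_univ _, i, j, rfl, hij, hn⟩
  have hm4 : ∀ i j, i ≠ j → ¬ G.Adj (φ i) (φ j) → m s(i, j) ∉ T ∧ G.Adj (φ i) (m s(i, j)) := by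
    intro i j hij hn
    have := (Finset.mem_filter.1 (hm1 _ (hm3 i j hij hn))).2
    exact ⟨this.1, this.2 i (Sym2.mem_mk_left _ _)⟩
  let D : Sym2 (Fin t) → Set (Sym2 V) := fun e => {f | ∃ i j, e = s(i, j) ∧ i ≠ j ∧
    ((G.Adj (φ i) (φ j) ∧ f = s(φ i, φ j)) ∨ (¬ G.Adj (φ i) (φ j) ∧ f = s(φ i, m e)))}
  refine ⟨φ, D, hφ, fun i j => hc _ (hφT i) _ (hφT j), ?_, ?_, ?_⟩
  · rintro e f ⟨i, j, rfl, hij, ⟨h1, rfl⟩ | ⟨h1, rfl⟩⟩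
    · exact h1
    · exact (hm4 i j hij h1).2
  · intro i j hij
    by_cases hA : G.Adj (φ i) (φ j)
    · exact reach_edge ⟨i, j, rfl, hij, Or.inl ⟨hA, rfl⟩⟩ hA.ne
    · have hA' : ¬ G.Adj (φ j) (φ i) := fun h => hA h.symm
      refine (reach_edge (S := D s(i, j)) (b := m s(i, j)) ⟨i, j, rfl, hij, Or.inr ⟨hA, rfl⟩⟩
        (hm4 i j hij hA).2.ne).trans ?_
      refine (reach_edge (S := D s(i, j)) (b := m s(i, j)) ⟨j, i, Sym2.eq_swap, hij.symm, Or.inr ⟨hA', rfl⟩⟩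
        ?_).symm
      have := (hm4 j i hij.symm hA').2.ne
      rwa [Sym2.eq_swap] at this
  · intro e e' hne
    rw [Set.disjoint_left]
    rintro f ⟨i, j, rfl, hij, h1⟩ ⟨i', j', rfl, hij', h2⟩
    rcases h1 with ⟨h1, rfl⟩ | ⟨h1, rfl⟩ <;> rcases h2 with ⟨h2, h3⟩ | ⟨h2, h3⟩
    · apply hne
      rcases Sym2.eq_iff.1 h3 with ⟨a, b⟩ | ⟨a, b⟩
      · rw [hφ a, hφ b]
      · rw [hφ a, hφ b, Sym2.eq_swap]
    · have := (hm4 _ _ hij' h2).1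
      rcases Sym2.eq_iff.1 h3 with ⟨a, b⟩ | ⟨a, b⟩
      · exact this (b ▸ hφT _)
      · exact this (a ▸ hφT _)
    · have := (hm4 _ _ hij h1).1
      rcases Sym2.eq_iff.1 h3 with ⟨a, b⟩ | ⟨a, b⟩
      · exact this (b ▸ hφT _)
      · exact this (b ▸ hφT _)
    · have h4 := (hm4 _ _ hij h1).1
      rcases Sym2.eq_iff.1 h3 with ⟨a, b⟩ | ⟨a, b⟩
      · have := hφ a
        subst this
        exact hm2 _ (hm3 _ _ hij h1) _ (hm3 _ _ hij' h2)
          ⟨hne, i, Sym2.mem_mk_left _ _, Sym2.mem_mk_left _ _⟩ b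
      · exact h4 (b ▸ hφT _)

theorem clique_imm {V : Type*} [Fintype V] {t : ℕ} {c : V → Bool} {G : SimpleGraph V}
    (S : Finset V) (hS : 2 * t ≤ S.card + 1)
    (h : ∀ a ∈ S, ∀ b ∈ S, a ≠ b → G.Adj a b) : MonoImm t c G := by
  obtain ⟨T, hT, hc, hm⟩ := exists_mono_subset t c S hS
  exact greedy T hc hm (fun u hu u' hu' hne hn => absurd (h _ (hT hu) _ (hT hu') hne) hn)

end HelpersB

section HelpersC
open Classical

/-- A matching, as an involution, of the relation `R` inside `S`. -/
def IsM {V : Type*} (R : V → V → Prop) (S : Finset V) (μ : V → V) : Prop :=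
  (∀ a, μ (μ a) = a) ∧ ∀ a, μ a ≠ a → a ∈ S ∧ R a (μ a)

theorem inv_even {V : Type*} {σ : V → V} (h : ∀ a, σ (σ a) = a) (S : Finset V)
    (hS : ∀ a ∈ S, σ a ∈ S) (hf : ∀ a ∈ S, σ a ≠ a) : Even S.card := by
  have h1 : ∑ a ∈ S, (1 : ZMod 2) = 0 :=
    Finset.sum_involution (fun a _ => σ a) (fun _ _ => by decide) (fun a ha _ => hf a ha)
      (fun a ha => hS a ha) (fun a _ => h a)
  rw [Finset.sum_const, nsmul_eq_mul, mul_one] at h1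
  exact (ZMod.natCast_eq_zero_iff_even).1 h1

theorem even_pair {V : Type*} (U : Finset V) (hU : Even U.card) :
    ∃ σ : V → V, (∀ a, σ (σ a) = a) ∧ (∀ a, σ a ≠ a ↔ a ∈ U) := by
  obtain ⟨n, hn⟩ := hU
  induction n generalizing U with
  | zero =>
    have : U = ∅ := by rw [← Finset.card_eq_zero]; omega
    subst this
    exact ⟨id, by simp, by simp⟩
  | succ n ih =>
    obtain ⟨a, b, ha, hb, hab⟩ := Finset.one_lt_card_iff.1 (by omega : 1 < U.card)
    obtain ⟨σ, h1, h2⟩ := ih ((U.erase a).erase b) (by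
      rw [Finset.card_erase_of_mem (by simp [hb, hab.symm]), Finset.card_erase_of_mem ha]; omega)
    have ha' : σ a = a := by have := h2 a; simp at this; tauto
    have hb' : σ b = b := by have := h2 b; simp at this; tauto
    have h3 : ∀ x y, σ x = y → x = σ y := by rintro x y rfl; exact (h1 x).symm
    refine ⟨fun x => if x = a then b else if x = b then a else σ x, ?_, ?_⟩
    · intro x
      grind
    · intro x
      have := h2 x
      grind

theorem isM_add {V : Type*} {R : V → V → Prop} {S : Finset V} {μ : V → V} (hμ : IsM R S μ)
    {a b : V} (ha : a ∈ S) (hb : b ∈ S) (hab : a ≠ b) (h1 : R a b) (h2 : R b a)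
    (ha' : μ a = a) (hb' : μ b = b) :
    IsM R S (fun x => if x = a then b else if x = b then a else μ x) := by
  obtain ⟨hi, hR⟩ := hμ
  have h3 : ∀ x y, μ x = y → x = μ y := by rintro x y rfl; exact (hi x).symm
  refine ⟨fun x => by grind, fun x => ?_⟩
  have := hR x
  dsimp only
  grind

theorem isM_cover {V : Type*} {R : V → V → Prop} (hs : ∀ a b, R a b → R b a) (W : Finset V)
    (Z : Finset V) (hZ : Z ⊆ W)
    (h : ∀ S ⊆ Z, S.Nonempty → ∃ x ∈ S, S.card ≤ (W.filter (fun w => w ≠ x ∧ R x w)).card) :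
    ∃ μ, IsM R W μ ∧ ∀ z ∈ Z, μ z ≠ z := by
  suffices ∃ μ, IsM R W μ ∧ (∀ z ∈ Z, μ z ≠ z) by exact this
  induction Z using Finset.strongInduction with
  | H Z ih =>
    rcases Z.eq_empty_or_nonempty with rfl | hne
    · exact ⟨id, ⟨by simp, by simp⟩, by simp⟩
    obtain ⟨z, hz, hcard⟩ := h Z subset_rfl hne
    have hss := Finset.erase_ssubset hz
    obtain ⟨μ, hμ, hc⟩ := ih _ hss (hss.1.trans hZ) (fun S hS => h S (hS.trans hss.1))
    by_cases hzz : μ z = z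
    swap
    · refine ⟨μ, hμ, fun x hx => ?_⟩
      by_cases hxz : x = z
      · rw [hxz]; exact hzz
      · exact hc x (Finset.mem_erase.2 ⟨hxz, hx⟩)
    by_cases h1 : ∃ a ∈ W.filter (fun w => w ≠ z ∧ R z w), μ a = a
    · obtain ⟨a, ha, haa⟩ := h1
      simp only [Finset.mem_filter] at ha
      refine ⟨_, isM_add hμ (hZ hz) ha.1 ha.2.1.symm ha.2.2 (hs _ _ ha.2.2) hzz haa, ?_⟩
      intro x hx
      have := hc x
      simp only [Finset.mem_erase] at this
      grind
    by_cases h2 : ∃ a ∈ W.filter (fun w => w ≠ z ∧ R z w), μ a ∉ Z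
    · obtain ⟨a, ha, haZ⟩ := h2
      push Not at h1
      have hna := h1 a ha
      simp only [Finset.mem_filter] at ha
      obtain ⟨hi, hR⟩ := hμ
      have h3 : ∀ x y, μ x = y → x = μ y := by rintro x y rfl; exact (hi x).symm
      have hR' : R a z := hs _ _ ha.2.2
      refine ⟨fun x => if x = z then a else if x = a then z else if x = μ a then x else μ x,
        ⟨?_, ?_⟩, ?_⟩
      · intro x
        have := h3 x a
        grind
      · intro x
        have := hR x
        have := hZ hz
        dsimp only
        grind
      · intro x hx
        have := hc x
        simp only [Finset.mem_erase] at this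
        grind
    · exfalso
      push Not at h1 h2
      have : (W.filter (fun w => w ≠ z ∧ R z w)).card ≤ (Z.erase z).card := by
        apply Finset.card_le_card_of_injOn μ
        · intro a ha
          have h3 := h2 a ha
          rw [Finset.mem_coe, Finset.mem_erase]
          refine ⟨fun h4 => ?_, h3⟩
          have h5 := hμ.1 a
          rw [h4, hzz] at h5
          exact (Finset.mem_filter.1 ha).2.1 h5.symm
        · intro a _ b _ hab
          rw [← hμ.1 a, ← hμ.1 b, hab]
      rw [Finset.card_erase_of_mem hz] at this
      have := hne.card_pos
      omega

theorem swap3_inv {V : Type*} [DecidableEq V] {μ : V → V} (hi : ∀ v, μ (μ v) = v) (u1 u2 x y : V)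
    (hne : u1 ≠ u2) (h1 : μ u1 = u1) (h2 : μ u2 = u2) (hxx : μ x ≠ x) (hyy : μ y ≠ y)
    (hab : μ x ≠ μ y) (v : V) (f : V → V)
    (hf : ∀ v, f v = if v = u1 then x else if v = x then u1 else if v = u2 then y else
      if v = y then u2 else if v = μ x then μ y else if v = μ y then μ x else μ v) :
    f (f v) = v := by
  have hx := hi x
  have hy := hi y
  have hv := hi v
  by_cases c1 : v = u1
  · have : f v = x := by simp [hf, c1]
    rw [this, hf]; grind
  by_cases c2 : v = x
  · have : f v = u1 := by rw [hf]; grind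
    rw [this, hf]; grind
  by_cases c3 : v = u2
  · have : f v = y := by rw [hf]; grind
    rw [this, hf]; grind
  by_cases c4 : v = y
  · have : f v = u2 := by rw [hf]; grind
    rw [this, hf]; grind
  by_cases c5 : v = μ x
  · have : f v = μ y := by rw [hf]; grind
    rw [this, hf]; grind
  by_cases c6 : v = μ y
  · have : f v = μ x := by rw [hf]; grind
    rw [this, hf]; grind
  have : f v = μ v := by rw [hf]; grind
  rw [this, hf]; grind

theorem near_perfect {V : Type*} [Fintype V] {t : ℕ} {c : V → Bool} {G : SimpleGraph V}
    (hMI : ¬ MonoImm t c G) (W Z : Finset V) (μ0 : V → V)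
    (h0 : IsM (fun a b => ¬ G.Adj a b) W μ0) (h0Z : ∀ z ∈ Z, μ0 z ≠ z)
    (hdeg : ∀ u ∈ W, u ∉ Z → 3 * t ≤ (W.filter (fun w => w ≠ u ∧ ¬ G.Adj u w)).card) :
    ∃ μ, IsM (fun a b => ¬ G.Adj a b) W μ ∧ (∀ z ∈ Z, μ z ≠ z) ∧
      ∀ u1 ∈ W, ∀ u2 ∈ W, μ u1 = u1 → μ u2 = u2 → u1 = u2 := by
  obtain ⟨μ, hμ, hmax⟩ := Finset.exists_max_image
    (Finset.univ.filter (fun μ : V → V => IsM (fun a b => ¬ G.Adj a b) W μ ∧ ∀ z ∈ Z, μ z ≠ z))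
    (fun μ => (Finset.univ.filter (fun x => μ x ≠ x)).card)
    ⟨μ0, Finset.mem_filter.2 ⟨Finset.mem_univ _, h0, h0Z⟩⟩
  simp only [Finset.mem_filter, Finset.mem_univ, true_and] at hμ hmax
  have hmax' : ∀ ν : V → V, IsM (fun a b => ¬ G.Adj a b) W ν → (∀ x, μ x ≠ x → ν x ≠ x) →
      (∀ x, ν x ≠ x → μ x ≠ x) := by
    intro ν h1 h2 x hx hxx
    have h3 := hmax ν ⟨h1, fun z hz => h2 z (hμ.2 z hz)⟩
    refine absurd h3 (not_le.2 (Finset.card_lt_card ?_))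
    rw [Finset.ssubset_iff_of_subset]
    · exact ⟨x, by simpa using hx, by simpa using hxx⟩
    · intro y hy
      simp only [Finset.mem_filter, Finset.mem_univ, true_and] at hy ⊢
      exact h2 y hy
  refine ⟨μ, hμ.1, hμ.2, ?_⟩
  intro u1 hu1 u2 hu2 h1 h2
  by_contra hne
  apply hMI
  have cov : ∀ u ∈ W, μ u = u → ∀ x ∈ W, x ≠ u → ¬ G.Adj u x → μ x ≠ x := by
    intro u hu huu x hx hxu hn hxx
    refine hmax' _ (isM_add hμ.1 hu hx hxu.symm hn (fun h => hn h.symm) huu hxx) ?_ u ?_ huu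
    · intro y hy
      grind
    · grind
  let N1 := W.filter (fun w => w ≠ u1 ∧ ¬ G.Adj u1 w)
  let N2 := W.filter (fun w => w ≠ u2 ∧ ¬ G.Adj u2 w)
  have hinj : Function.Injective μ := fun a b hab => by rw [← hμ.1.1 a, ← hμ.1.1 b, hab]
  have hN1 : 3 * t ≤ (N1.image μ).card := by
    rw [Finset.card_image_of_injective _ hinj]
    exact hdeg u1 hu1 (fun h => hμ.2 _ h h1)
  have hN2 : 3 * t ≤ (N2.image μ).card := by
    rw [Finset.card_image_of_injective _ hinj]
    exact hdeg u2 hu2 (fun h => hμ.2 _ h h2)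
  have key : ∀ a ∈ N1.image μ, ∀ b ∈ N2.image μ, a ≠ b → G.Adj a b := by
    intro a ha b hb hab
    obtain ⟨x, hx, rfl⟩ := Finset.mem_image.1 ha
    obtain ⟨y, hy, rfl⟩ := Finset.mem_image.1 hb
    by_contra hn
    simp only [N1, N2, Finset.mem_filter] at hx hy
    have hxx := cov u1 hu1 h1 x hx.1 hx.2.1 hx.2.2
    have hyy := cov u2 hu2 h2 y hy.1 hy.2.1 hy.2.2
    have hi := hμ.1.1
    have hR := hμ.1.2
    have h3 : ∀ v w, μ v = w → v = μ w := by rintro v w rfl; exact (hi v).symm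
    have hxy : x ≠ y := by rintro rfl; exact hab rfl
    have hn' : ¬ G.Adj (μ y) (μ x) := fun h => hn h.symm
    have e1 : ¬ G.Adj x u1 := fun h => hx.2.2 h.symm
    have e2 : ¬ G.Adj y u2 := fun h => hy.2.2 h.symm
    have d1 : μ x ≠ u1 := fun h => by have := h3 _ _ h; rw [h1] at this; exact hx.2.1 this
    have d2 : μ x ≠ u2 := fun h => by have := h3 _ _ h; rw [h2] at this; rw [this, h2] at hxx; exact hxx rfl
    have d3 : μ y ≠ u1 := fun h => by have := h3 _ _ h; rw [h1] at this; rw [this, h1] at hyy; exact hyy rfl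
    have d4 : μ y ≠ u2 := fun h => by have := h3 _ _ h; rw [h2] at this; exact hy.2.1 this
    have d5 : x ≠ u2 := by rintro rfl; exact hxx h2
    have d6 : y ≠ u1 := by rintro rfl; exact hyy h1
    have w1 : μ x ∈ W := (hR (μ x) (by rw [hi]; exact hxx.symm)).1
    have w2 : μ y ∈ W := (hR (μ y) (by rw [hi]; exact hyy.symm)).1
    refine hmax' (fun v => if v = u1 then x else if v = x then u1 else if v = u2 then y else
      if v = y then u2 else if v = μ x then μ y else if v = μ y then μ x else μ v) ⟨?_, ?_⟩ ?_ u1 ?_ h1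
    · intro v
      exact swap3_inv hi u1 u2 x y hne h1 h2 hxx hyy hab v _ (fun _ => rfl)
    · intro v
      clear hmax hmax' cov hdeg hN1 hN2 ha hb h0 h0Z
      have := hR v
      have q5 := @hinj v x
      have q6 := @hinj v y
      have q7 := h3 x y
      have q8 := h3 y x
      grind
    · intro v hv
      clear hmax hmax' cov hdeg hN1 hN2 ha hb h0 h0Z
      have q7 := h3 x y
      have q8 := h3 y x
      have q5 := @hinj v x
      have q6 := @hinj v y
      grind
    · simp only [if_true]
      exact hx.2.1
  obtain ⟨T, hT, hTc, hTm⟩ := exists_mono_subset t c (N1.image μ) (by omega)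
  refine greedy T hTc hTm (fun u hu u' hu' _ _ => ?_)
  have h4 : (N2.image μ) \ T ⊆ (nbF G u ∩ nbF G u') \ T := by
    intro b hb
    simp only [Finset.mem_sdiff, Finset.mem_inter, mem_nbF] at hb ⊢
    exact ⟨⟨key u (hT hu) b hb.1 (by rintro rfl; exact hb.2 hu),
      key u' (hT hu') b hb.1 (by rintro rfl; exact hb.2 hu')⟩, hb.2⟩
  have h5 := Finset.card_le_card h4
  have h6 := Finset.le_card_sdiff T (N2.image μ)
  omega

end HelpersC

section HelpersD
open Classical

/-- Split off all edges at `r`, in pairs given by `σ`; a pair that is already adjacent is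
removed altogether. -/
def tog {V : Type*} (G : SimpleGraph V) (r : V) (σ : V → V) : SimpleGraph V where
  Adj a b := a ≠ r ∧ b ≠ r ∧ a ≠ b ∧
    ¬ (G.Adj a b ↔ (G.Adj r a ∧ G.Adj r b ∧ b = σ a ∧ a = σ b))
  symm := ⟨by
    intro a b h
    have := G.adj_comm a b
    grind⟩
  loopless := ⟨by intro a h; exact h.2.2.1 rfl⟩

theorem tog_adj {V : Type*} {G : SimpleGraph V} {r : V} {σ : V → V} (hi : ∀ a, σ (σ a) = a)
    (hs : ∀ a, σ a ≠ a ↔ G.Adj r a) (a b : V) :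
    (tog G r σ).Adj a b ↔ a ≠ r ∧ b ≠ r ∧ a ≠ b ∧ ¬ (G.Adj a b ↔ (G.Adj r a ∧ b = σ a)) := by
  have h1 := hs a
  have h2 := hs b
  have h3 := hi a
  have h4 : (G.Adj r a ∧ G.Adj r b ∧ b = σ a ∧ a = σ b) ↔ (G.Adj r a ∧ b = σ a) := by
    grind
  show a ≠ r ∧ b ≠ r ∧ a ≠ b ∧ ¬ (G.Adj a b ↔ (G.Adj r a ∧ G.Adj r b ∧ b = σ a ∧ a = σ b)) ↔ _
  rw [h4]

theorem tog_imm {V : Type*} {G : SimpleGraph V} {r : V} {σ : V → V} (hi : ∀ a, σ (σ a) = a)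
    (hs : ∀ a, σ a ≠ a ↔ G.Adj r a) {t : ℕ} {c : V → Bool} (h : MonoImm t c (tog G r σ)) :
    MonoImm t c G := by
  have key : ∀ a b, (tog G r σ).Adj a b → ¬ G.Adj a b → G.Adj r a ∧ b = σ a := by
    intro a b h1 h2
    have := (tog_adj hi hs a b).1 h1
    tauto
  have hadj' : ∀ a b, (tog G r σ).Adj a b → a ≠ r ∧ b ≠ r := fun a b h => ⟨h.1, h.2.1⟩
  refine h.transfer (fun e => if e ∈ G.edgeSet then {e} else {f | ∃ a ∈ e, f = s(r, a)}) ?_ ?_ ?_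
  · intro e he
    split_ifs with h1
    · simpa using h1
    · rintro f ⟨a, ha, rfl⟩
      obtain ⟨b, rfl⟩ := Sym2.mem_iff_exists.1 ha
      exact (key a b he h1).1
  · have hr : ∀ e ∈ (tog G r σ).edgeSet, ∀ a ∈ e, a ≠ r := by
      intro e he a ha
      obtain ⟨b, rfl⟩ := Sym2.mem_iff_exists.1 ha
      exact (hadj' a b he).1
    intro e he e' he' hne
    split_ifs with h1 h2 h2
    · simpa using hne
    · rw [Set.disjoint_left]
      rintro f hf ⟨a, ha, hfa⟩
      rw [Set.mem_singleton_iff] at hf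
      exact hr e he r (by rw [← hf, hfa]; exact Sym2.mem_mk_left _ _) rfl
    · rw [Set.disjoint_left]
      rintro f ⟨a, ha, hfa⟩ hf
      rw [Set.mem_singleton_iff] at hf
      exact hr e' he' r (by rw [← hf, hfa]; exact Sym2.mem_mk_left _ _) rfl
    · rw [Set.disjoint_left]
      rintro f ⟨a, ha, hfa⟩ ⟨a', ha', hfa'⟩
      have : a = a' := by
        rw [hfa, Sym2.eq_iff] at hfa'
        rcases hfa' with h | h
        · exact h.2
        · exact absurd h.2 (hr e he a ha)
      subst this
      obtain ⟨b, rfl⟩ := Sym2.mem_iff_exists.1 ha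
      obtain ⟨b', rfl⟩ := Sym2.mem_iff_exists.1 ha'
      exact hne (by rw [(key a b he h1).2, (key a b' he' h2).2])
  · intro a b hab
    split_ifs with h1
    · exact reach_edge rfl hab.ne
    · refine (reach_edge (a := r) (b := a) ?_ (hadj' a b hab).1.symm).symm.trans
        (reach_edge (a := r) (b := b) ?_ (hadj' a b hab).2.symm)
      · exact ⟨a, Sym2.mem_mk_left _ _, rfl⟩
      · exact ⟨b, Sym2.mem_mk_right _ _, rfl⟩

theorem tog_spec {V : Type*} [Fintype V] {G : SimpleGraph V} {r : V} {σ : V → V}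
    (hi : ∀ a, σ (σ a) = a) (hs : ∀ a, σ a ≠ a ↔ G.Adj r a) (U : Finset V)
    (hL : ∀ a, a ∉ U → G.Adj r a → ¬ G.Adj a (σ a))
    (hev : ∀ u, Even (nbF G u).card) :
    (∀ u, Even (nbF (tog G r σ) u).card) ∧ nbF (tog G r σ) r = ∅ ∧
    (∀ u, u ∉ U → u ≠ r → (nbF (tog G r σ) u).card = (nbF G u).card ∧
      (nbF (tog G r σ) u \ nbF G u).card ≤ 1 ∧ nbF G u ⊆ insert r (nbF (tog G r σ) u)) ∧
    (∀ u, u ≠ r → ¬ G.Adj r u → nbF (tog G r σ) u = nbF G u) ∧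
    (∀ u, (nbF G u) \ nbF (tog G r σ) u ⊆ insert r {σ u} ∨ u = r) ∧
    (∀ u, u ≠ r → (nbF G u).card ≤ (nbF (tog G r σ) u).card + 2) := by
  have hr : nbF (tog G r σ) r = ∅ := by
    ext x; simp [mem_nbF, tog_adj hi hs]
  have hN : ∀ u, u ≠ r → ¬ G.Adj r u → nbF (tog G r σ) u = nbF G u := by
    intro u hu hn
    ext x
    have := fun h : G.Adj u x => h.ne
    have := G.adj_comm r u
    simp only [mem_nbF, tog_adj hi hs]
    grind
  have hA : ∀ u, G.Adj r u → ¬ G.Adj u (σ u) →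
      nbF (tog G r σ) u = insert (σ u) ((nbF G u).erase r) := by
    intro u hu hn
    have h1 := hs u
    have h2 := hs r
    have h3 := hi u
    have h4 := hu.ne
    have := G.irrefl (v := r)
    ext x
    have := fun h : G.Adj u x => h.ne
    simp only [mem_nbF, tog_adj hi hs, Finset.mem_insert, Finset.mem_erase]
    grind
  have hB : ∀ u, G.Adj r u → G.Adj u (σ u) →
      nbF (tog G r σ) u = ((nbF G u).erase r).erase (σ u) := by
    intro u hu hn
    ext x
    have := fun h : G.Adj u x => h.ne
    have := hu.ne
    simp only [mem_nbF, tog_adj hi hs, Finset.mem_erase]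
    grind
  have hσr : ∀ u, G.Adj r u → σ u ≠ r := by
    intro u hu h
    have h1 := hs r
    have h3 := hi u
    have := G.irrefl (v := r)
    have := hu.ne
    grind
  have hA' : ∀ u, G.Adj r u → ¬ G.Adj u (σ u) →
      (nbF (tog G r σ) u).card = (nbF G u).card := by
    intro u hu hn
    rw [hA u hu hn, Finset.card_insert_of_notMem (by simp [mem_nbF, hn]),
      Finset.card_erase_of_mem (by rw [mem_nbF]; exact hu.symm)]
    have : 0 < (nbF G u).card := Finset.card_pos.2 ⟨r, by rw [mem_nbF]; exact hu.symm⟩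
    omega
  have hB' : ∀ u, G.Adj r u → G.Adj u (σ u) →
      (nbF (tog G r σ) u).card + 2 = (nbF G u).card := by
    intro u hu hn
    have h1 : r ∈ nbF G u := by rw [mem_nbF]; exact hu.symm
    have h2 : σ u ∈ (nbF G u).erase r := by
      rw [Finset.mem_erase, mem_nbF]; exact ⟨hσr u hu, hn⟩
    rw [hB u hu hn, Finset.card_erase_of_mem h2]
    have := Finset.card_erase_of_mem h1
    have := Finset.card_pos.2 ⟨_, h2⟩
    omega
  refine ⟨?_, hr, ?_, hN, ?_, ?_⟩
  · intro u
    by_cases hu : u = r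
    · rw [hu, hr]; simp
    by_cases h1 : G.Adj r u
    · by_cases h2 : G.Adj u (σ u)
      · have := hev u
        rw [← hB' u h1 h2] at this
        exact (Nat.even_add.1 this).2 (by decide)
      · rw [hA' u h1 h2]; exact hev u
    · rw [hN u hu h1]; exact hev u
  · intro u hu hur
    by_cases h1 : G.Adj r u
    · have h2 := hL u hu h1
      refine ⟨hA' u h1 h2, ?_, ?_⟩
      · rw [hA u h1 h2]
        refine (Finset.card_le_card (t := {σ u}) ?_).trans (by simp)
        intro x hx
        simp only [Finset.mem_sdiff, Finset.mem_insert, Finset.mem_erase, Finset.mem_singleton] at hx ⊢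
        tauto
      · rw [hA u h1 h2]
        intro x hx
        simp only [Finset.mem_insert, Finset.mem_erase]
        tauto
    · rw [hN u hur h1]
      refine ⟨rfl, by simp, Finset.subset_insert _ _⟩
  · intro u
    by_cases hur : u = r
    · exact Or.inr hur
    left
    intro x hx
    by_cases h1 : G.Adj r u
    · by_cases h2 : G.Adj u (σ u)
      · rw [hB u h1 h2] at hx
        simp only [Finset.mem_sdiff, Finset.mem_insert, Finset.mem_erase, Finset.mem_singleton] at hx ⊢
        tauto
      · rw [hA u h1 h2] at hx
        simp only [Finset.mem_sdiff, Finset.mem_insert, Finset.mem_erase, Finset.mem_singleton] at hx ⊢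
        tauto
    · rw [hN u hur h1] at hx
      simp at hx
  · intro u hur
    by_cases h1 : G.Adj r u
    · by_cases h2 : G.Adj u (σ u)
      · rw [hB' u h1 h2]
      · rw [hA' u h1 h2]; omega
    · rw [hN u hur h1]; omega

/-- Replace the path `w r q z` by the edge `w z`. -/
def op3 {V : Type*} (G : SimpleGraph V) (w r q z : V) : SimpleGraph V where
  Adj a b := a ≠ b ∧ (s(a, b) = s(w, z) ∨
    (G.Adj a b ∧ s(a, b) ≠ s(w, r) ∧ s(a, b) ≠ s(r, q) ∧ s(a, b) ≠ s(q, z)))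
  symm := ⟨by
    intro a b h
    rw [Sym2.eq_swap (a := b), G.adj_comm b a]
    exact ⟨h.1.symm, h.2⟩⟩
  loopless := ⟨by intro a h; exact h.1 rfl⟩

theorem op3_imm {V : Type*} {G : SimpleGraph V} {w r q z : V} (h1 : G.Adj w r) (h2 : G.Adj r q)
    (h3 : G.Adj q z) {t : ℕ} {c : V → Bool} (h : MonoImm t c (op3 G w r q z))
    (hwz : ¬ G.Adj w z) : MonoImm t c G := by
  have hr : ∀ e ∈ (op3 G w r q z).edgeSet, e = s(w, z) ∨ (e ∈ G.edgeSet ∧ e ≠ s(w, r) ∧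
      e ≠ s(r, q) ∧ e ≠ s(q, z)) := by
    intro e
    induction e using Sym2.ind with
    | _ a b => intro he; exact he.2
  refine h.transfer (fun e => if e = s(w, z) then {s(w, r), s(r, q), s(q, z)} else {e}) ?_ ?_ ?_
  · intro e he
    split_ifs with h4
    · rintro f (rfl | rfl | rfl)
      · exact h1
      · exact h2
      · exact h3
    · rcases hr e he with h5 | h5
      · exact absurd h5 h4
      · simpa using h5.1
  · intro e he e' he' hne
    split_ifs with h4 h5 h5
    · exact absurd (h4.trans h5.symm) hne
    · have := (hr e' he').resolve_left h5
      rw [Set.disjoint_singleton_right]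
      simp only [Set.mem_insert_iff, Set.mem_singleton_iff]
      tauto
    · have := (hr e he).resolve_left h4
      rw [Set.disjoint_singleton_left]
      simp only [Set.mem_insert_iff, Set.mem_singleton_iff]
      tauto
    · simpa using hne
  · intro a b hab
    split_ifs with h4
    · have : (SimpleGraph.fromEdgeSet ({s(w, r), s(r, q), s(q, z)} : Set (Sym2 V))).Reachable w z :=
        ((reach_edge (by simp) h1.ne).trans (reach_edge (by simp) h2.ne)).trans
          (reach_edge (by simp) h3.ne)
      rcases Sym2.eq_iff.1 h4 with ⟨rfl, rfl⟩ | ⟨rfl, rfl⟩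
      · exact this
      · exact this.symm
    · exact reach_edge rfl hab.ne

end HelpersD

section HelpersD2
open Classical

theorem op3_adj {V : Type*} {G : SimpleGraph V} {w r q z : V} (a b : V) :
    (op3 G w r q z).Adj a b ↔ a ≠ b ∧ (((a = w ∧ b = z) ∨ (a = z ∧ b = w)) ∨
    (G.Adj a b ∧ ¬ ((a = w ∧ b = r) ∨ (a = r ∧ b = w)) ∧ ¬ ((a = r ∧ b = q) ∨ (a = q ∧ b = r))
      ∧ ¬ ((a = q ∧ b = z) ∨ (a = z ∧ b = q)))) := by
  show (a ≠ b ∧ (s(a, b) = s(w, z) ∨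
    (G.Adj a b ∧ s(a, b) ≠ s(w, r) ∧ s(a, b) ≠ s(r, q) ∧ s(a, b) ≠ s(q, z)))) ↔ _
  simp only [ne_eq, Sym2.eq_iff]

theorem op3_nb {V : Type*} [Fintype V] {G : SimpleGraph V} {w r q z : V} (h1 : G.Adj w r)
    (h2 : G.Adj r q) (h3 : G.Adj q z) (hwq : w ≠ q) (hwz : w ≠ z) (hrz : r ≠ z) :
    nbF (op3 G w r q z) r = ((nbF G r).erase w).erase q ∧
    nbF (op3 G w r q z) w = insert z ((nbF G w).erase r) ∧
    nbF (op3 G w r q z) q = ((nbF G q).erase r).erase z ∧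
    nbF (op3 G w r q z) z = insert w ((nbF G z).erase q) ∧
    ∀ u, u ≠ r → u ≠ w → u ≠ q → u ≠ z → nbF (op3 G w r q z) u = nbF G u := by
  have e1 := h1.ne
  have e2 := h2.ne
  have e3 := h3.ne
  refine ⟨?_, ?_, ?_, ?_, ?_⟩
  · ext x
    have := fun h : G.Adj r x => h.ne
    simp only [mem_nbF, op3_adj, Finset.mem_erase]
    grind
  · ext x
    have := fun h : G.Adj w x => h.ne
    simp only [mem_nbF, op3_adj, Finset.mem_erase, Finset.mem_insert]
    grind
  · ext x
    have := fun h : G.Adj q x => h.ne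
    simp only [mem_nbF, op3_adj, Finset.mem_erase]
    grind
  · ext x
    have := fun h : G.Adj z x => h.ne
    simp only [mem_nbF, op3_adj, Finset.mem_erase, Finset.mem_insert]
    grind
  · intro u _ _ _ _
    ext x
    have := fun h : G.Adj u x => h.ne
    simp only [mem_nbF, op3_adj]
    grind

theorem clear_vertex {V : Type*} [Fintype V] {G : SimpleGraph V}
    (hev : ∀ u, Even (nbF G u).card) (r : V) (U : Finset V) (hU : U ⊆ nbF G r) (μ : V → V)
    (hμ : IsM (fun a b => ¬ G.Adj a b) (nbF G r \ U) μ)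
    (huniq : ∀ u1 ∈ nbF G r \ U, ∀ u2 ∈ nbF G r \ U, μ u1 = u1 → μ u2 = u2 → u1 = u2)
    (hz : ∀ w ∈ nbF G r \ U, μ w = w → ∀ q ∈ U,
      ∃ z, z ∉ U ∧ z ≠ r ∧ z ≠ w ∧ G.Adj q z ∧ ¬ G.Adj w z) :
    ∃ (G' : SimpleGraph V) (z0 : V), (∀ t c, MonoImm t c G' → MonoImm t c G) ∧
      (∀ u, Even (nbF G' u).card) ∧ nbF G' r = ∅ ∧
      (∀ u, u ∉ U → u ≠ r → (nbF G' u).card = (nbF G u).card ∧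
        (nbF G' u \ nbF G u).card ≤ 1 + (if u = z0 then 1 else 0) ∧
        nbF G u ⊆ insert r (nbF G' u ∪ U)) ∧
      (∀ q ∈ U, ((nbF G q \ nbF G' q) \ (insert r U)).card ≤ 1) := by
  have hrU : r ∉ U := fun h => G.irrefl (mem_nbF.1 (hU h))
  have hμL : ∀ a, μ a ≠ a → μ a ∈ nbF G r \ U := fun a ha =>
    (hμ.2 (μ a) (by rw [hμ.1]; exact ha.symm)).1
  have hcard := Finset.card_sdiff_add_card_eq_card hU
  have hevr := hev r
  by_cases hex : ∃ w ∈ nbF G r \ U, μ w = w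
  · obtain ⟨w, hw, hww⟩ := hex
    have hcov : ∀ a ∈ nbF G r \ U, a ≠ w → μ a ≠ a := fun a ha haw h =>
      haw (huniq a ha w hw h hww)
    have hμw : ∀ a, a ≠ w → μ a ≠ w := by
      intro a ha h
      have := hμ.1 a
      rw [h, hww] at this
      exact ha this.symm
    have hevL : Even ((nbF G r \ U).erase w).card := by
      refine inv_even hμ.1 _ ?_ ?_
      · intro a ha
        rw [Finset.mem_erase] at ha ⊢
        exact ⟨hμw a ha.1, hμL a (hcov a ha.2 ha.1)⟩
      · intro a ha
        rw [Finset.mem_erase] at ha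
        exact hcov a ha.2 ha.1
    have hUodd : ¬ Even U.card := by
      rw [Finset.card_erase_of_mem hw] at hevL
      have : 0 < (nbF G r \ U).card := Finset.card_pos.2 ⟨w, hw⟩
      rw [Nat.even_iff] at *
      omega
    have hUne : U.Nonempty := by
      rw [Finset.nonempty_iff_ne_empty]
      rintro rfl
      exact hUodd (by simp)
    obtain ⟨q, hq⟩ := hUne
    obtain ⟨z, hzU, hzr, hzw, hqz, hwz⟩ := hz w hw hww q hq
    have hwr : G.Adj r w := mem_nbF.1 (Finset.mem_sdiff.1 hw).1
    have hwU : w ∉ U := (Finset.mem_sdiff.1 hw).2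
    have hrq : G.Adj r q := mem_nbF.1 (hU hq)
    have hwq : w ≠ q := by rintro rfl; exact hwU hq
    obtain ⟨n1, n2, n3, n4, n5⟩ := op3_nb hwr.symm hrq hqz hwq hzw.symm hzr.symm
    set G1 := op3 G w r q z with hG1
    obtain ⟨π, hπ1, hπ2⟩ := even_pair (U.erase q) (by
      rw [Finset.card_erase_of_mem hq]
      have : 0 < U.card := Finset.card_pos.2 ⟨q, hq⟩
      rw [Nat.even_iff] at *
      omega)
    have hπU : ∀ a ∈ U.erase q, π a ∈ U.erase q := by
      intro a ha
      rw [← hπ2, hπ1]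
      exact ((hπ2 a).2 ha).symm
    let σ : V → V := fun x => if x ∈ U.erase q then π x else μ x
    have hqμ : ∀ a ∈ U, μ a = a := by
      intro a ha
      by_contra h
      exact (Finset.mem_sdiff.1 (hμ.2 a h).1).2 ha
    have hμU : ∀ a, a ∉ U → μ a ∉ U := by
      intro a ha h
      have := hqμ _ h
      rw [hμ.1] at this
      exact ha (this ▸ h)
    have hσi : ∀ a, σ (σ a) = a := by
      intro a
      by_cases ha : a ∈ U.erase q
      · have h1 := hπU a ha
        simp only [σ, ha, h1, if_true, hπ1]
      · have h1 : μ a ∉ U.erase q := by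
          by_cases h2 : a ∈ U
          · rw [hqμ a h2]; exact ha
          · exact fun h3 => hμU a h2 (Finset.mem_of_mem_erase h3)
        simp only [σ, ha, h1, if_false, hμ.1]
    have hσs : ∀ a, σ a ≠ a ↔ G1.Adj r a := by
      intro a
      rw [← mem_nbF, n1]
      simp only [Finset.mem_erase, mem_nbF]
      by_cases ha : a ∈ U.erase q
      · have h1 := (hπ2 a).2 ha
        simp only [σ, ha, if_true]
        rw [Finset.mem_erase] at ha
        exact iff_of_true h1 ⟨ha.1, by rintro rfl; exact hwU ha.2, mem_nbF.1 (hU ha.2)⟩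
      · simp only [σ, ha, if_false]
        constructor
        · intro h
          have h1 := Finset.mem_sdiff.1 (hμ.2 a h).1
          refine ⟨?_, ?_, mem_nbF.1 h1.1⟩
          · rintro rfl; exact h1.2 hq
          · rintro rfl; exact h hww
        · rintro ⟨h1, h2, h3⟩
          refine hcov a ?_ h2
          rw [Finset.mem_sdiff, mem_nbF]
          exact ⟨h3, fun h4 => ha (Finset.mem_erase.2 ⟨h1, h4⟩)⟩
    have hpos : ∀ u x, x ∈ nbF G u → 0 < (nbF G u).card := fun u x h => Finset.card_pos.2 ⟨x, h⟩
    have m1 : r ∈ nbF G w := mem_nbF.2 hwr.symm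
    have m2 : r ∈ nbF G q := mem_nbF.2 hrq.symm
    have m3 : z ∈ nbF G q := mem_nbF.2 hqz
    have m4 : q ∈ nbF G z := mem_nbF.2 hqz.symm
    have m5 : w ∈ nbF G r := mem_nbF.2 hwr
    have m6 : q ∈ nbF G r := mem_nbF.2 hrq
    have cw : (nbF G1 w).card = (nbF G w).card := by
      rw [n2, Finset.card_insert_of_notMem (by simp [mem_nbF, hwz]), Finset.card_erase_of_mem m1]
      have := hpos _ _ m1
      omega
    have cz : (nbF G1 z).card = (nbF G z).card := by
      rw [n4, Finset.card_insert_of_notMem (by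
        simp only [Finset.mem_erase, mem_nbF, not_and]; intro _ h; exact hwz h.symm),
        Finset.card_erase_of_mem m4]
      have := hpos _ _ m4
      omega
    have hev1 : ∀ u, Even (nbF G1 u).card := by
      intro u
      by_cases u1 : u = r
      · have m7 : q ∈ (nbF G r).erase w := Finset.mem_erase.2 ⟨hwq.symm, m6⟩
        rw [u1, n1, Finset.card_erase_of_mem m7, Finset.card_erase_of_mem m5, Nat.sub_sub]
        rw [Nat.even_iff] at hevr ⊢
        omega
      by_cases u2 : u = w
      · rw [u2, cw]; exact hev w
      by_cases u3 : u = q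
      · have m7 : z ∈ (nbF G q).erase r := Finset.mem_erase.2 ⟨hzr, m3⟩
        rw [u3, n3, Finset.card_erase_of_mem m7, Finset.card_erase_of_mem m2, Nat.sub_sub]
        have := hev q
        rw [Nat.even_iff] at this ⊢
        omega
      by_cases u4 : u = z
      · rw [u4, cz]; exact hev z
      rw [n5 u u1 u2 u3 u4]; exact hev u
    obtain ⟨s1, s2, s3, s4, s5, -⟩ := tog_spec hσi hσs U (by
      intro a haU hra
      have ha' : a ∉ U.erase q := fun h => haU (Finset.mem_of_mem_erase h)
      have h1 := (hσs a).2 hra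
      simp only [σ, ha', if_false] at h1 ⊢
      have haw : a ≠ w := by rintro rfl; exact h1 hww
      have h2 := (hμ.2 a h1).2
      have h3 := hμw a haw
      rw [hG1, op3_adj]
      tauto) hev1
    refine ⟨tog G1 r σ, z, ?_, s1, s2, ?_, ?_⟩
    · intro t c h
      exact op3_imm hwr.symm hrq hqz (tog_imm hσi hσs h) hwz
    · intro u hu hur
      obtain ⟨t1, t2, t3⟩ := s3 u hu hur
      have huq : u ≠ q := by rintro rfl; exact hu hq
      by_cases u2 : u = w
      · subst u2
        have h1 : ¬ G1.Adj r u := by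
          rw [← mem_nbF, n1]; simp
        rw [s4 u hur h1]
        refine ⟨cw, ?_, ?_⟩
        · refine le_trans (Finset.card_le_card (t := {z}) ?_) (by simp)
          rw [n2]
          intro x hx
          simp only [Finset.mem_sdiff, Finset.mem_insert, Finset.mem_erase, Finset.mem_singleton] at hx ⊢
          tauto
        · rw [n2]
          intro x hx
          simp only [Finset.mem_insert, Finset.mem_erase, Finset.mem_union]
          tauto
      by_cases u4 : u = z
      · subst u4
        refine ⟨t1.trans cz, ?_, ?_⟩
        · simp only [if_true]
          refine le_trans (Finset.card_le_card
            (t := (nbF (tog G1 r σ) u \ nbF G1 u) ∪ {w}) ?_) ((Finset.card_union_le _ _).trans ?_)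
          · rw [n4]
            intro x hx
            simp only [Finset.mem_sdiff, Finset.mem_insert, Finset.mem_erase, Finset.mem_singleton,
              Finset.mem_union] at hx ⊢
            tauto
          · simp only [Finset.card_singleton]; omega
        · rw [n4] at t3
          intro x hx
          by_cases hxq : x = q
          · rw [hxq]; simp [hq]
          · have := t3 (Finset.mem_insert_of_mem (Finset.mem_erase.2 ⟨hxq, hx⟩))
            simp only [Finset.mem_insert, Finset.mem_union] at this ⊢
            tauto
      rw [n5 u hur u2 huq u4] at t1 t2 t3
      refine ⟨t1, by omega, fun x hx => ?_⟩
      have := t3 hx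
      simp only [Finset.mem_insert, Finset.mem_union] at this ⊢
      tauto
    · intro u hu
      have hur : u ≠ r := by rintro rfl; exact hrU hu
      have huw : u ≠ w := by rintro rfl; exact hwU hu
      have huz : u ≠ z := by rintro rfl; exact hzU hu
      by_cases huq : u = q
      · subst huq
        have h1 : ¬ G1.Adj r u := by
          rw [← mem_nbF, n1]; simp
        rw [s4 u hur h1, n3]
        refine le_trans (Finset.card_le_card (t := {z}) ?_) (by simp)
        intro x hx
        simp only [Finset.mem_sdiff, Finset.mem_insert, Finset.mem_erase, Finset.mem_singleton] at hx ⊢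
        tauto
      · refine le_trans (Finset.card_le_card (t := ∅) ?_) (by simp)
        intro x hx
        have h1 := (s5 u).resolve_right hur
        rw [n5 u hur huw huq huz] at h1
        simp only [Finset.mem_sdiff] at hx
        have h2 := h1 (Finset.mem_sdiff.2 hx.1)
        have h3 : σ u ∈ U := by
          have h4 : u ∈ U.erase q := Finset.mem_erase.2 ⟨huq, hu⟩
          simp only [σ, h4, if_true]
          exact Finset.mem_of_mem_erase (hπU u h4)
        simp only [Finset.mem_insert, Finset.mem_singleton] at h2 hx
        rcases h2 with h2 | h2
        · exact absurd (Or.inl h2) hx.2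
        · exact absurd (Or.inr (h2 ▸ h3)) hx.2
  · push Not at hex
    have hevL : Even (nbF G r \ U).card := inv_even hμ.1 _ (fun a ha => hμL a (hex a ha)) hex
    obtain ⟨π, hπ1, hπ2⟩ := even_pair U (by rw [Nat.even_iff] at *; omega)
    have hπU : ∀ a ∈ U, π a ∈ U := by
      intro a ha
      rw [← hπ2, hπ1]
      exact ((hπ2 a).2 ha).symm
    let σ : V → V := fun x => if x ∈ U then π x else μ x
    have hμU : ∀ a, a ∉ U → μ a ∉ U := by
      intro a ha h
      by_cases h1 : μ a = a
      · exact ha (h1 ▸ h)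
      · exact (Finset.mem_sdiff.1 (hμL a h1)).2 h
    have hσi : ∀ a, σ (σ a) = a := by
      intro a
      by_cases ha : a ∈ U
      · have h1 := hπU a ha
        simp only [σ, ha, h1, if_true, hπ1]
      · have h1 := hμU a ha
        simp only [σ, ha, h1, if_false, hμ.1]
    have hσs : ∀ a, σ a ≠ a ↔ G.Adj r a := by
      intro a
      by_cases ha : a ∈ U
      · simp only [σ, ha, if_true]
        exact iff_of_true ((hπ2 a).2 ha) (mem_nbF.1 (hU ha))
      · simp only [σ, ha, if_false]
        constructor
        · intro h
          exact mem_nbF.1 (Finset.mem_sdiff.1 (hμ.2 a h).1).1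
        · intro h
          exact hex a (Finset.mem_sdiff.2 ⟨mem_nbF.2 h, ha⟩)
    obtain ⟨s1, s2, s3, s4, s5, -⟩ := tog_spec hσi hσs U (by
      intro a ha hra
      have h1 := (hσs a).2 hra
      simp only [σ, ha, if_false] at h1 ⊢
      exact (hμ.2 a h1).2) hev
    refine ⟨tog G r σ, r, fun t c h => tog_imm hσi hσs h, s1, s2, ?_, ?_⟩
    · intro u hu hur
      obtain ⟨t1, t2, t3⟩ := s3 u hu hur
      refine ⟨t1, by omega, fun x hx => ?_⟩
      have := t3 hx
      simp only [Finset.mem_insert, Finset.mem_union] at this ⊢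
      tauto
    · intro u hu
      have hur : u ≠ r := by rintro rfl; exact hrU hu
      refine le_trans (Finset.card_le_card (t := ∅) ?_) (by simp)
      intro x hx
      have h1 := (s5 u).resolve_right hur
      simp only [Finset.mem_sdiff] at hx
      have h2 := h1 (Finset.mem_sdiff.2 hx.1)
      have h3 : σ u ∈ U := by
        simp only [σ, hu, if_true]
        exact hπU u hu
      simp only [Finset.mem_insert, Finset.mem_singleton] at h2 hx
      rcases h2 with h2 | h2
      · exact absurd (Or.inl h2) hx.2
      · exact absurd (Or.inr (h2 ▸ h3)) hx.2

end HelpersD2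

section HelpersE
open Classical

/-- The invariant of the second phase. -/
structure PInv {V : Type*} [Fintype V] (t : ℕ) (c : V → Bool) (G0 : SimpleGraph V) (v : V)
    (G : SimpleGraph V) (X Dl : Finset V) (g : V → ℕ) (s : ℕ) : Prop where
  imm : MonoImm t c G → MonoImm t c G0
  even : ∀ u, Even (nbF G u).card
  vX : v ∈ X
  sub : Dl ⊆ X
  card : Dl.card = s
  iso : ∀ u ∈ Dl, nbF G u = ∅
  deg : ∀ u, u ∉ X → (nbF G u).card = (nbF G0 u).card
  small : X.card ≤ 2 * t - 2
  i4 : ∀ x ∈ X, x ∉ Dl → ((nbF G0 v \ X) \ nbF G x).card + 1 ≤ X.card + s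
  i5 : ∀ u, u ∉ X → ((nbF G u ∩ (nbF G0 v \ X)) \ nbF G0 u).card ≤ s + g u
  gsum : ∑ u, g u ≤ s
  i6 : ∀ x ∈ X, ((nbF G0 v \ X) \ nbF G0 x).card + 1 ≤ X.card + 2 * s + g x

theorem card_le_add {V : Type*} {A B C : Finset V} (h : A ⊆ B ∪ C) : A.card ≤ B.card + C.card :=
  (Finset.card_le_card h).trans (Finset.card_union_le _ _)

set_option maxHeartbeats 4000000 in
theorem pinv_step {V : Type*} [Fintype V] {t : ℕ} {c : V → Bool} {G0 : SimpleGraph V} {v : V}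
    {G : SimpleGraph V} {X Dl : Finset V} {g : V → ℕ} {s : ℕ} (ht : 2 ≤ t)
    (hMI : ¬ MonoImm t c G0) (hd : 24 * t ≤ (nbF G0 v).card + 16)
    (I : PInv t c G0 v G X Dl g s) (r : V) (hrX : r ∈ X) (hrD : r ∉ Dl) :
    ∃ G' X' Dl' g', PInv t c G0 v G' X' Dl' g' (s + 1) := by
  set M := nbF G0 v with hM
  set W := nbF G r \ X with hW
  have hsX : s + 1 ≤ X.card := by
    rw [← I.card]
    exact Finset.card_lt_card ((Finset.ssubset_iff_of_subset I.sub).2 ⟨r, hrX, hrD⟩)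
  have hsmall := I.small
  let fd : V → Finset V := fun y => W.filter (fun w => w ≠ y ∧ ¬ G.Adj y w)
  obtain ⟨Y, hY, hYmax⟩ := Finset.exists_max_image
    (W.powerset.filter (fun Y => (∀ y ∈ Y, (fd y).card + 1 ≤ Y.card) ∧ X.card + Y.card ≤ 2 * t - 1))
    (fun Y => Y.card) ⟨∅, by simp; omega⟩
  simp only [Finset.mem_filter, Finset.mem_powerset] at hY hYmax
  obtain ⟨hYW, hYfd, hXY⟩ := hY
  have hXYd : Disjoint X Y := by
    rw [Finset.disjoint_left]
    intro a ha hb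
    exact (Finset.mem_sdiff.1 (hYW hb)).2 ha
  have hr4 := I.i4 r hrX hrD
  rw [← hM] at hr4
  -- missing bound for Y
  have hYmiss : ∀ y ∈ Y, ((M \ X) \ nbF G y).card + 1 ≤ X.card + Y.card + s := by
    intro y hy
    have h1 : ((M \ X) \ nbF G y) ⊆ (insert y (fd y)) ∪ ((M \ X) \ nbF G r) := by
      intro x hx
      simp only [Finset.mem_sdiff, Finset.mem_union, Finset.mem_insert, fd, hW, Finset.mem_filter,
        mem_nbF] at hx ⊢
      tauto
    have h2 := card_le_add h1
    have h3 := Finset.card_insert_le y (fd y)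
    have h4 := hYfd y hy
    omega
  let Z := (W \ Y).filter (fun z => ((M \ X) \ nbF G z).card ≤ 5 * t + s)
  have hZW : Z ⊆ W \ Y := Finset.filter_subset _ _
  have hZd : Disjoint (X ∪ Y) Z := by
    rw [Finset.disjoint_left]
    intro a ha hb
    have := hZW hb
    simp only [hW, Finset.mem_sdiff, Finset.mem_union] at this ha
    tauto
  have hG0miss : ∀ u, u ∉ X → ((M \ X) \ nbF G0 u).card ≤ ((M \ X) \ nbF G u).card + (s + g u) := by
    intro u hu
    have h1 := I.i5 u hu
    rw [← hM] at h1
    have h2 : ((M \ X) \ nbF G0 u) ⊆ ((M \ X) \ nbF G u) ∪ ((nbF G u ∩ (M \ X)) \ nbF G0 u) := by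
      intro x hx
      simp only [Finset.mem_sdiff, Finset.mem_union, Finset.mem_inter] at hx ⊢
      tauto
    have h3 := card_le_add h2
    omega
  have hsize : X.card + Y.card + Z.card ≤ 2 * t - 2 := by
    by_contra hlt
    apply hMI
    have c1 : (X ∪ Y).card = X.card + Y.card := Finset.card_union_of_disjoint hXYd
    have c2 : ((X ∪ Y) ∪ Z).card = X.card + Y.card + Z.card := by
      rw [Finset.card_union_of_disjoint hZd, c1]
    obtain ⟨S, hS1, hS2, hS3⟩ := Finset.exists_subsuperset_card_eq
      (Finset.subset_union_left (s₁ := X ∪ Y) (s₂ := Z)) (n := 2 * t - 1) (by omega) (by omega)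
    obtain ⟨T, hTS, hTc, hTm⟩ := exists_mono_subset t c S (by omega)
    have hmiss : ∀ u ∈ T, ((M \ X) \ nbF G0 u).card ≤ 5 * t + 2 * s + g u := by
      intro u hu
      have h1 := hS2 (hTS hu)
      by_cases hX : u ∈ X
      · have h2 := I.i6 u hX
        rw [← hM] at h2
        omega
      have h2 := hG0miss u hX
      by_cases hY : u ∈ Y
      · have := hYmiss u hY
        omega
      have hZ : u ∈ Z := by
        simp only [Finset.mem_union] at h1
        tauto
      have := (Finset.mem_filter.1 hZ).2
      omega
    refine greedy T hTc hTm (fun u hu u' hu' hne _ => ?_)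
    have h1 : M ⊆ ((nbF G0 u ∩ nbF G0 u') \ T) ∪ (S ∪ (((M \ X) \ nbF G0 u) ∪ ((M \ X) \ nbF G0 u'))) := by
      intro x hx
      have e1 : x ∈ X → x ∈ S := fun h => hS1 (Finset.mem_union_left _ h)
      have e2 : x ∈ T → x ∈ S := fun h => hTS h
      simp only [Finset.mem_sdiff, Finset.mem_union, Finset.mem_inter]
      tauto
    have h2 := card_le_add h1
    have h3 := Finset.card_union_le S (((M \ X) \ nbF G0 u) ∪ ((M \ X) \ nbF G0 u'))
    have h4 := Finset.card_union_le ((M \ X) \ nbF G0 u) ((M \ X) \ nbF G0 u')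
    have h5 := hmiss u hu
    have h6 := hmiss u' hu'
    have h7 : g u + g u' ≤ s := by
      refine le_trans ?_ I.gsum
      rw [← Finset.sum_pair hne]
      exact Finset.sum_le_sum_of_subset (Finset.subset_univ _)
    omega
  -- the matching
  have hcov : ∀ S ⊆ Z, S.Nonempty → ∃ x ∈ S, S.card ≤
      ((W \ Y).filter (fun w => w ≠ x ∧ ¬ G.Adj x w)).card := by
    intro S hS hSne
    by_contra hcon
    push Not at hcon
    have hYS : Disjoint Y S := by
      rw [Finset.disjoint_left]
      intro a ha hb
      exact (Finset.mem_sdiff.1 (hZW (hS hb))).2 ha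
    have c1 : (Y ∪ S).card = Y.card + S.card := Finset.card_union_of_disjoint hYS
    have c2 := Finset.card_le_card hS
    have c3 := hSne.card_pos
    have := hYmax (Y ∪ S) ⟨?_, ?_, ?_⟩
    · omega
    · exact Finset.union_subset hYW (fun x hx => (Finset.mem_sdiff.1 (hZW (hS hx))).1)
    · intro y hy
      rcases Finset.mem_union.1 hy with hy | hy
      · have := hYfd y hy
        omega
      · have h1 := hcon y hy
        have h2 : fd y ⊆ ((W \ Y).filter (fun w => w ≠ y ∧ ¬ G.Adj y w)) ∪ Y := by
          intro x hx
          simp only [fd, Finset.mem_sdiff, Finset.mem_union, Finset.mem_filter] at hx ⊢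
          tauto
        have h3 := card_le_add h2
        omega
    · omega
  obtain ⟨μ0, hμ0, hmuZero⟩ := isM_cover (R := fun a b => ¬ G.Adj a b)
    (fun a b h h' => h h'.symm) (W \ Y) Z hZW (by
      intro S hS hSne
      obtain ⟨x, hx, hle⟩ := hcov S hS hSne
      refine ⟨x, hx, hle.trans (le_of_eq ?_)⟩
      congr)
  obtain ⟨μ, hμ, hμZ, huniq⟩ := near_perfect (t := t) (c := c) (fun h => hMI (I.imm h)) (W \ Y) Z μ0 hμ0 hmuZero (by
    intro u hu huZ
    have h1 : 5 * t + s < ((M \ X) \ nbF G u).card := by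
      by_contra h
      exact huZ (Finset.mem_filter.2 ⟨hu, by omega⟩)
    have h2 : ((M \ X) \ nbF G u) ⊆ ((W \ Y).filter (fun w => w ≠ u ∧ ¬ G.Adj u w)) ∪
        (((M \ X) \ nbF G r) ∪ (insert u Y)) := by
      intro x hx
      simp only [Finset.mem_sdiff, Finset.mem_union, Finset.mem_insert, hW, Finset.mem_filter,
        mem_nbF] at hx ⊢
      tauto
    have h3 := card_le_add h2
    have h4 := Finset.card_union_le ((M \ X) \ nbF G r) (insert u Y)
    have h5 := Finset.card_insert_le u Y
    omega)
  let U := (X ∩ nbF G r) ∪ Y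
  have hUX : U ⊆ X ∪ Y := Finset.union_subset_union Finset.inter_subset_left subset_rfl
  have hUr : U ⊆ nbF G r := Finset.union_subset Finset.inter_subset_right
    (fun x hx => (Finset.mem_sdiff.1 (hYW hx)).1)
  have hL : nbF G r \ U = W \ Y := by
    ext x
    simp only [U, hW, Finset.mem_sdiff, Finset.mem_union, Finset.mem_inter]
    tauto
  have hDr : ∀ q ∈ nbF G r, q ∉ Dl := by
    intro q hq hqD
    have h1 := I.iso q hqD
    have h2 : r ∈ nbF G q := mem_nbF.2 (mem_nbF.1 hq).symm
    rw [h1] at h2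
    simp at h2
  have hUmiss : ∀ q ∈ U, ((M \ X) \ nbF G q).card + 1 ≤ X.card + Y.card + s := by
    intro q hq
    rcases Finset.mem_union.1 hq with hq | hq
    · have hq' := Finset.mem_inter.1 hq
      have := I.i4 q hq'.1 (hDr q hq'.2)
      rw [← hM] at this
      omega
    · exact hYmiss q hq
  obtain ⟨G', z0, j1, j2, j3, j4, j5⟩ := clear_vertex I.even r U hUr μ (by rw [hL]; exact hμ)
    (by rw [hL]; exact huniq) (by
    rw [hL]
    intro w hw hww q hq
    have hwZ : w ∉ Z := fun h => hμZ w h hww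
    have h1 : 5 * t + s < ((M \ X) \ nbF G w).card := by
      by_contra h
      exact hwZ (Finset.mem_filter.2 ⟨hw, by omega⟩)
    have h2 := hUmiss q hq
    by_contra hno
    have h3 : ((M \ X) \ nbF G w) ⊆ ((M \ X) \ nbF G q) ∪ insert w Y := by
      intro x hx
      by_contra hx'
      simp only [Finset.mem_sdiff, Finset.mem_union, Finset.mem_insert, mem_nbF] at hx hx'
      refine hno ⟨x, ?_, ?_, ?_, ?_, ?_⟩
      · simp only [U, Finset.mem_union, Finset.mem_inter]
        tauto
      · rintro rfl; exact hx.1.2 hrX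
      · tauto
      · tauto
      · tauto
    have h4 := card_le_add h3
    have h5 := Finset.card_insert_le w Y
    omega)
  have hrU : r ∉ U := fun h => G.irrefl (mem_nbF.1 (hUr h))
  have c1 : (X ∪ Y).card = X.card + Y.card := Finset.card_union_of_disjoint hXYd
  refine ⟨G', X ∪ Y, insert r Dl, fun u => g u + (if u = z0 then 1 else 0), ?_⟩
  constructor
  · exact fun h => I.imm (j1 t c h)
  · exact j2
  · exact Finset.mem_union_left _ I.vX
  · exact Finset.insert_subset (Finset.mem_union_left _ hrX) (I.sub.trans Finset.subset_union_left)
  · rw [Finset.card_insert_of_notMem hrD, I.card]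
  · intro u hu
    rcases Finset.mem_insert.1 hu with h0 | hu'
    · rw [h0]; exact j3
    · have h1 := (j4 u (fun h => hDr u (hUr h) hu') (fun h => hrD (h ▸ hu'))).1
      rw [I.iso u hu', Finset.card_empty, Finset.card_eq_zero] at h1
      exact h1
  · intro u hu
    have h1 := (j4 u (fun h => hu (hUX h)) (by rintro rfl; exact hu (Finset.mem_union_left _ hrX))).1
    rw [h1]
    exact I.deg u (fun h => hu (Finset.mem_union_left _ h))
  · omega
  · intro x hx hxD
    rw [← hM, c1]
    have hxr : x ≠ r := by rintro rfl; exact hxD (Finset.mem_insert_self _ _)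
    have hxD' : x ∉ Dl := fun h => hxD (Finset.mem_insert_of_mem h)
    by_cases hxU : x ∈ U
    · have h1 := hUmiss x hxU
      have h2 := j5 x hxU
      have h3 : (M \ (X ∪ Y)) \ nbF G' x ⊆ ((M \ X) \ nbF G x) ∪
          ((nbF G x \ nbF G' x) \ (insert r U)) := by
        intro y hy
        have e1 : y ∈ U → y ∈ X ∪ Y := fun h => hUX h
        have e2 : y = r → y ∈ X := by rintro rfl; exact hrX
        simp only [Finset.mem_sdiff, Finset.mem_union, Finset.mem_insert] at hy e1 ⊢
        tauto
      have h4 := card_le_add h3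
      omega
    · have hxX : x ∈ X := by
        rcases Finset.mem_union.1 hx with h | h
        · exact h
        · exact absurd (Finset.mem_union_right _ h) hxU
      have h1 := I.i4 x hxX hxD'
      rw [← hM] at h1
      have h2 := (j4 x hxU hxr).2.2
      have h3 : (M \ (X ∪ Y)) \ nbF G' x ⊆ ((M \ X) \ nbF G x) := by
        intro y hy
        have e1 : y ∈ U → y ∈ X ∪ Y := fun h => hUX h
        have e2 : y = r → y ∈ X := by rintro rfl; exact hrX
        have e3 : y ∈ nbF G x → y ∈ insert r (nbF G' x ∪ U) := fun h => h2 h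
        simp only [Finset.mem_sdiff, Finset.mem_union, Finset.mem_insert] at hy e1 e3 ⊢
        tauto
      have h4 := Finset.card_le_card h3
      omega
  · intro u hu
    rw [← hM]
    have huX : u ∉ X := fun h => hu (Finset.mem_union_left _ h)
    have h1 := (j4 u (fun h => hu (hUX h)) (by rintro rfl; exact huX hrX)).2.1
    have h2 := I.i5 u huX
    rw [← hM] at h2
    have h3 : (nbF G' u ∩ (M \ (X ∪ Y))) \ nbF G0 u ⊆ (nbF G' u \ nbF G u) ∪
        ((nbF G u ∩ (M \ X)) \ nbF G0 u) := by
      intro y hy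
      simp only [Finset.mem_sdiff, Finset.mem_union, Finset.mem_inter] at hy ⊢
      tauto
    have h4 := card_le_add h3
    omega
  · rw [Finset.sum_add_distrib, Finset.sum_ite_eq' Finset.univ z0]
    simp only [Finset.mem_univ, if_true]
    have := I.gsum
    omega
  · intro x hx
    rw [← hM, c1]
    have h0 : ((M \ (X ∪ Y)) \ nbF G0 x).card ≤ ((M \ X) \ nbF G0 x).card := by
      apply Finset.card_le_card
      intro y hy
      simp only [Finset.mem_sdiff, Finset.mem_union] at hy ⊢
      tauto
    by_cases hxX : x ∈ X
    · have := I.i6 x hxX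
      rw [← hM] at this
      omega
    · have hxY : x ∈ Y := (Finset.mem_union.1 hx).resolve_left hxX
      have h1 := hYmiss x hxY
      have h2 := hG0miss x hxX
      omega

theorem pinv_finish {V : Type*} [Fintype V] {t : ℕ} {c : V → Bool} {G0 : SimpleGraph V} {v : V}
    (ht : 2 ≤ t) (hMI : ¬ MonoImm t c G0) (hd : 24 * t ≤ (nbF G0 v).card + 16) (n : ℕ) :
    ∀ (G : SimpleGraph V) (X Dl : Finset V) (g : V → ℕ) (s : ℕ), 2 * t - 2 ≤ s + n →
    PInv t c G0 v G X Dl g s → ∃ G' X' g' s', PInv t c G0 v G' X' X' g' s' := by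
  induction n with
  | zero =>
    intro G X Dl g s hs I
    have h1 := I.small
    have h2 := I.card
    have : Dl = X := Finset.eq_of_subset_of_card_le I.sub (by omega)
    subst this
    exact ⟨_, _, _, _, I⟩
  | succ n ih =>
    intro G X Dl g s hs I
    by_cases h : ∃ r ∈ X, r ∉ Dl
    · obtain ⟨r, hr, hrD⟩ := h
      obtain ⟨G', X', Dl', g', I'⟩ := pinv_step ht hMI hd I r hr hrD
      exact ih _ _ _ _ _ (by omega) I'
    · push Not at h
      have : Dl = X := Finset.Subset.antisymm I.sub h
      subst this
      exact ⟨_, _, _, _, I⟩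

theorem phase2 {V : Type*} [Fintype V] {t : ℕ} {c : V → Bool} (n : ℕ) :
    ∀ (G0 : SimpleGraph V), (Finset.univ.filter (fun u => nbF G0 u ≠ ∅)).card ≤ n →
    (∀ u, Even (nbF G0 u).card) → (∀ u, nbF G0 u ≠ ∅ → 24 * t ≤ (nbF G0 u).card + 16) →
    (∃ u, nbF G0 u ≠ ∅) → MonoImm t c G0 := by
  induction n with
  | zero =>
    intro G0 hn _ _ ⟨u, hu⟩
    rw [Nat.le_zero, Finset.card_eq_zero] at hn
    have : u ∈ Finset.univ.filter (fun u => nbF G0 u ≠ ∅) := by simpa using hu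
    rw [hn] at this
    simp at this
  | succ n ih =>
    intro G0 hn hev hdeg ⟨v, hv⟩
    by_contra hMI
    have ht : 2 ≤ t := by
      by_contra h
      exact hMI (clique_imm {v} (by simp; omega) (by simp))
    have hd := hdeg v hv
    have I0 : PInv t c G0 v G0 {v} ∅ (fun _ => 0) 0 := by
      constructor
      · exact id
      · exact hev
      · simp
      · simp
      · simp
      · simp
      · simp
      · simp; omega
      · intro x hx _
        rw [Finset.mem_singleton] at hx
        subst hx
        have : (nbF G0 x \ {x}) \ nbF G0 x = ∅ := by
          ext y; simp only [Finset.mem_sdiff, Finset.notMem_empty, iff_false]; tauto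
        simp [this]
      · intro u _
        have : (nbF G0 u ∩ (nbF G0 v \ {v})) \ nbF G0 u = ∅ := by
          ext y; simp only [Finset.mem_sdiff, Finset.mem_inter, Finset.notMem_empty, iff_false]; tauto
        simp [this]
      · simp
      · intro x hx
        rw [Finset.mem_singleton] at hx
        subst hx
        have : (nbF G0 x \ {x}) \ nbF G0 x = ∅ := by
          ext y; simp only [Finset.mem_sdiff, Finset.notMem_empty, iff_false]; tauto
        simp [this]
    obtain ⟨G, X, g, s, I⟩ := pinv_finish ht hMI hd (2 * t - 2) _ _ _ _ _ (by omega) I0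
    have hX : ∀ u, nbF G u ≠ ∅ → u ∉ X := fun u hu h => hu (I.iso u h)
    have hX' : ∀ u, nbF G u ≠ ∅ → nbF G0 u ≠ ∅ := by
      intro u hu h
      have := I.deg u (hX u hu)
      rw [h, Finset.card_empty, Finset.card_eq_zero] at this
      exact hu this
    refine hMI (I.imm (ih G ?_ I.even ?_ ?_))
    · have : (Finset.univ.filter (fun u => nbF G u ≠ ∅)).card <
          (Finset.univ.filter (fun u => nbF G0 u ≠ ∅)).card := by
        apply Finset.card_lt_card
        rw [Finset.ssubset_iff_of_subset]
        · refine ⟨v, by simpa using hv, ?_⟩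
          simp only [Finset.mem_filter, Finset.mem_univ, true_and, not_not]
          exact I.iso v I.vX
        · intro u hu
          simp only [Finset.mem_filter, Finset.mem_univ, true_and] at hu ⊢
          exact hX' u hu
      omega
    · intro u hu
      rw [I.deg u (hX u hu)]
      exact hdeg u (hX' u hu)
    · have hsmall := I.small
      obtain ⟨u, hu, huX⟩ := Finset.exists_mem_notMem_of_card_lt_card
        (by omega : X.card < (nbF G0 v).card)
      refine ⟨u, fun h => ?_⟩
      have h1 := I.deg u huX
      rw [h, Finset.card_empty] at h1
      have h2 : v ∈ nbF G0 u := mem_nbF.2 (mem_nbF.1 hu).symm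
      rw [Finset.card_eq_zero.1 h1.symm] at h2
      simp at h2

end HelpersE

section HelpersF
open Classical

set_option maxHeartbeats 1000000 in
theorem phase1 {V : Type*} [Fintype V] {t : ℕ} {c : V → Bool} (n : ℕ) :
    ∀ (G : SimpleGraph V), (Finset.univ.filter (fun u => nbF G u ≠ ∅)).card ≤ n →
    (∀ u, Even (nbF G u).card) →
    (28 * t + 26) * (Finset.univ.filter (fun u => nbF G u ≠ ∅)).card ≤ ∑ u, (nbF G u).card →
    (∃ u, nbF G u ≠ ∅) → MonoImm t c G := by
  induction n with
  | zero =>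
    intro G hn _ _ ⟨u, hu⟩
    rw [Nat.le_zero, Finset.card_eq_zero] at hn
    have : u ∈ Finset.univ.filter (fun u => nbF G u ≠ ∅) := by simpa using hu
    rw [hn] at this
    simp at this
  | succ n ih =>
    intro G hn hev hsum hex
    by_cases hall : ∀ u, nbF G u ≠ ∅ → 24 * t + 31 ≤ (nbF G u).card
    · refine phase2 (n + 1) G hn hev (fun u hu => ?_) hex
      have := hall u hu
      omega
    push Not at hall
    obtain ⟨r, hr0, hrd⟩ := hall
    have hr : nbF G r ≠ ∅ := Finset.nonempty_iff_ne_empty.1 hr0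
    obtain ⟨μ, hμ, hmax⟩ := Finset.exists_max_image
      (Finset.univ.filter (fun μ : V → V => IsM (fun a b => ¬ G.Adj a b) (nbF G r) μ))
      (fun μ => (Finset.univ.filter (fun x => μ x ≠ x)).card)
      ⟨id, Finset.mem_filter.2 ⟨Finset.mem_univ _, fun _ => rfl, fun _ h => absurd rfl h⟩⟩
    simp only [Finset.mem_filter, Finset.mem_univ, true_and] at hμ hmax
    set U := (nbF G r).filter (fun x => μ x = x) with hU
    by_cases hbig : 2 * t ≤ U.card + 1
    · refine clique_imm U hbig (fun a ha b hb hab => ?_)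
      by_contra hadj
      obtain ⟨ha1, ha2⟩ := Finset.mem_filter.1 ha
      obtain ⟨hb1, hb2⟩ := Finset.mem_filter.1 hb
      have h1 := hmax _ (isM_add hμ ha1 hb1 hab hadj (fun h => hadj h.symm) ha2 hb2)
      have h2 : (Finset.univ.filter (fun x => μ x ≠ x)) ⊂ (Finset.univ.filter (fun x =>
          (fun x => if x = a then b else if x = b then a else μ x) x ≠ x)) := by
        rw [Finset.ssubset_iff_of_subset]
        · refine ⟨a, ?_, ?_⟩
          · simp [hab.symm]
          · simp [ha2]
        · intro x hx
          simp only [Finset.mem_filter, Finset.mem_univ, true_and] at hx ⊢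
          have : x ≠ a := fun h => hx (h ▸ ha2)
          have : x ≠ b := fun h => hx (h ▸ hb2)
          simp_all
      have h3 := Finset.card_lt_card h2
      exact absurd h1 (not_le.2 (lt_of_lt_of_eq h3 (by congr)))
    have hUev : Even U.card := by
      have h1 : Even ((nbF G r).filter (fun x => ¬ μ x = x)).card := by
        refine inv_even hμ.1 _ ?_ ?_
        · intro a ha
          have h2 := (Finset.mem_filter.1 ha).2
          have h3 : μ (μ a) ≠ μ a := by rw [hμ.1]; exact fun h => h2 h.symm
          exact Finset.mem_filter.2 ⟨(hμ.2 _ h3).1, h3⟩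
        · intro a ha
          exact (Finset.mem_filter.1 ha).2
      have h2 := Finset.card_filter_add_card_filter_not (s := nbF G r) (fun x => μ x = x)
      have h3 := hev r
      rw [← h2] at h3
      exact (Nat.even_add.1 h3).2 h1
    obtain ⟨τ, hτ, hτU⟩ := even_pair U hUev
    have hτU' : ∀ a, a ∈ U → τ a ∈ U := by
      intro a ha
      rw [← hτU, hτ]
      exact fun h => (hτU a).2 ha h.symm
    have hμU : ∀ a, a ∉ U → μ a ∉ U := by
      intro a ha h
      have h1 := (Finset.mem_filter.1 h).2
      rw [hμ.1] at h1
      rw [← h1] at h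
      exact ha h
    let σ : V → V := fun a => if a ∈ U then τ a else μ a
    have hi : ∀ a, σ (σ a) = a := by
      intro a
      by_cases ha : a ∈ U
      · simp only [σ, ha, hτU' a ha, if_true, hτ]
      · simp only [σ, ha, hμU a ha, if_false, hμ.1]
    have hs : ∀ a, σ a ≠ a ↔ G.Adj r a := by
      intro a
      by_cases ha : a ∈ U
      · simp only [σ, ha, if_true]
        have := (hτU a).2 ha
        have h2 := mem_nbF.1 (Finset.mem_filter.1 ha).1
        tauto
      · simp only [σ, ha, if_false]
        constructor
        · intro h
          exact mem_nbF.1 (hμ.2 a h).1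
        · intro h h'
          exact ha (Finset.mem_filter.2 ⟨mem_nbF.2 h, h'⟩)
    obtain ⟨e1, e2, e3, e4, -, e6⟩ := tog_spec hi hs U (by
      intro a ha hadj
      have h1 := (hs a).2 hadj
      simp only [σ, ha, if_false] at h1 ⊢
      exact (hμ.2 a h1).2) hev
    set G' := tog G r σ with hG'
    have hni : (Finset.univ.filter (fun u => nbF G' u ≠ ∅)) ⊆
        (Finset.univ.filter (fun u => nbF G u ≠ ∅)).erase r := by
      intro u hu
      simp only [Finset.mem_filter, Finset.mem_univ, true_and, Finset.mem_erase] at hu ⊢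
      have hur : u ≠ r := by rintro rfl; exact hu e2
      refine ⟨hur, fun h => hu ?_⟩
      rw [e4 u hur, h]
      intro hadj
      have : r ∈ nbF G u := mem_nbF.2 hadj.symm
      rw [h] at this
      simp at this
    have hrmem : r ∈ Finset.univ.filter (fun u => nbF G u ≠ ∅) := by simpa using hr
    have hc1 := Finset.card_le_card hni
    rw [Finset.card_erase_of_mem hrmem] at hc1
    have hn2 : 2 ≤ (Finset.univ.filter (fun u => nbF G u ≠ ∅)).card := by
      obtain ⟨w, hw⟩ := Finset.nonempty_iff_ne_empty.2 hr
      have hwr : r ≠ w := (mem_nbF.1 hw).ne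
      have : ({r, w} : Finset V) ⊆ Finset.univ.filter (fun u => nbF G u ≠ ∅) := by
        intro x hx
        rcases Finset.mem_insert.1 hx with rfl | hx
        · exact hrmem
        · rw [Finset.mem_singleton.1 hx]
          simp only [Finset.mem_filter, Finset.mem_univ, true_and]
          intro h
          have : r ∈ nbF G w := mem_nbF.2 (mem_nbF.1 hw).symm
          rw [h] at this
          simp at this
      have h2 := Finset.card_le_card this
      rwa [Finset.card_pair hwr] at h2
    have hdrop : ∑ u, (nbF G u).card ≤ ∑ u, (nbF G' u).card + ((nbF G r).card + 2 * U.card) := by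
      have h1 : ∑ u, (nbF G u).card ≤ ∑ u, ((nbF G' u).card + ((if u = r then (nbF G r).card else 0)
          + (if u ∈ U then 2 else 0))) := by
        refine Finset.sum_le_sum (fun u _ => ?_)
        by_cases hur : u = r
        · rw [if_pos hur, hur]; omega
        · by_cases huU : u ∈ U
          · have := e6 u hur
            rw [if_pos huU]; omega
          · rw [(e3 u huU hur).1]; omega
      refine h1.trans (le_of_eq ?_)
      rw [Finset.sum_add_distrib, Finset.sum_add_distrib, Finset.sum_ite_eq', ← Finset.sum_filter]
      simp [mul_comm]
    set N := (Finset.univ.filter (fun u => nbF G u ≠ ∅)).card with hN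
    obtain ⟨m, hm⟩ : ∃ m, N = m + 1 := ⟨N - 1, by omega⟩
    have hsum' : (28 * t + 26) * m ≤ ∑ u, (nbF G' u).card := by
      rw [hm, Nat.mul_succ] at hsum
      omega
    refine tog_imm hi hs (ih G' (by omega) e1 (le_trans (Nat.mul_le_mul_left _ (by omega)) hsum') ?_)
    by_contra hno
    push Not at hno
    have h0 : ∑ u, (nbF G' u).card = 0 := Finset.sum_eq_zero (fun u _ => by rw [hno u]; rfl)
    have h1 : 26 * 1 ≤ (28 * t + 26) * m := Nat.mul_le_mul (by omega) (by omega)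
    omega

end HelpersF

section HelpersG
open Classical

theorem max_cut {W : Type*} [Fintype W] (H : SimpleGraph W) :
    ∃ χ : W → Bool, ∑ u, (nbF H u).card ≤
      2 * ∑ u, ((nbF H u).filter (fun w => χ u ≠ χ w)).card := by
  have hflip : ∀ u w : W, u ≠ w → (∑ χ : W → Bool, 2 * (if χ u ≠ χ w then 1 else 0)) =
      ∑ χ : W → Bool, 1 := by
    intro u w huw
    have h1 : (∑ χ : W → Bool, (if χ u ≠ χ w then 1 else 0)) =
        ∑ χ : W → Bool, (if χ u = χ w then 1 else 0) := by
      refine Finset.sum_bij' (fun χ _ => Function.update χ u (!χ u))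
        (fun χ _ => Function.update χ u (!χ u)) (by simp) (by simp) (by simp) (by simp) ?_
      intro χ _
      simp only [Function.update_self, Function.update_of_ne huw.symm]
      cases χ u <;> cases χ w <;> simp
    rw [← Finset.mul_sum, two_mul]
    nth_rewrite 2 [h1]
    rw [← Finset.sum_add_distrib]
    refine Finset.sum_congr rfl (fun χ _ => ?_)
    by_cases h : χ u = χ w <;> simp [h]
  have key : ∑ χ : W → Bool, ∑ u, (nbF H u).card ≤
      ∑ χ : W → Bool, 2 * ∑ u, ((nbF H u).filter (fun w => χ u ≠ χ w)).card := by
    have e1 : ∀ χ : W → Bool, 2 * ∑ u, ((nbF H u).filter (fun w => χ u ≠ χ w)).card =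
        ∑ u, ∑ w ∈ nbF H u, 2 * (if χ u ≠ χ w then 1 else 0) := by
      intro χ
      rw [Finset.mul_sum]
      refine Finset.sum_congr rfl (fun u _ => ?_)
      rw [← Finset.mul_sum, Finset.card_filter]
    have e2 : ∀ χ : W → Bool, ∑ u, (nbF H u).card = ∑ u, ∑ w ∈ nbF H u, 1 := by
      intro χ
      simp
    simp only [e1]
    rw [Finset.sum_congr rfl (fun χ _ => e2 χ), Finset.sum_comm, Finset.sum_comm (s := Finset.univ (α := W → Bool))]
    refine Finset.sum_le_sum (fun u _ => ?_)
    rw [Finset.sum_comm, Finset.sum_comm (s := Finset.univ (α := W → Bool))]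
    refine Finset.sum_le_sum (fun w hw => ?_)
    rw [hflip u w (mem_nbF.1 hw).ne]
  obtain ⟨χ, -, h⟩ := Finset.exists_le_of_sum_le Finset.univ_nonempty key
  exact ⟨χ, h⟩

theorem even_sub {α W : Type*} [Fintype W] (E : Finset α) (p : α → W → ZMod 2) :
    ∃ J ⊆ E, (∑ e ∈ J, p e = 0) ∧ E.card ≤ J.card + Fintype.card W := by
  obtain ⟨J, hJ, hmax⟩ := Finset.exists_max_image (E.powerset.filter (fun J => ∑ e ∈ J, p e = 0))
    (fun J => J.card) ⟨∅, by simp⟩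
  simp only [Finset.mem_filter, Finset.mem_powerset] at hJ hmax
  refine ⟨J, hJ.1, hJ.2, ?_⟩
  by_contra hlt
  have hc : (E \ J).card + J.card = E.card := Finset.card_sdiff_add_card_eq_card hJ.1
  have hpig : (Finset.univ : Finset (W → ZMod 2)).card < (E \ J).powerset.card := by
    rw [Finset.card_powerset, Finset.card_univ, Fintype.card_fun, ZMod.card]
    exact Nat.pow_lt_pow_right (by norm_num) (by omega)
  obtain ⟨S, hS, T, hT, hne, heq⟩ := Finset.exists_ne_map_eq_of_card_lt_of_maps_to hpig
    (f := fun S => ∑ e ∈ S, p e) (fun _ _ => Finset.mem_coe.2 (Finset.mem_univ _))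
  rw [Finset.mem_powerset] at hS hT
  have hcap : ∀ S T : Finset α, ∑ e ∈ S \ T, p e + ∑ e ∈ S ∩ T, p e = ∑ e ∈ S, p e := by
    intro S T
    rw [add_comm]
    exact Finset.sum_inter_add_sum_sdiff S T p
  have h1 := hcap S T
  have h2 := hcap T S
  rw [Finset.inter_comm T S] at h2
  have h3 : ∑ e ∈ S \ T, p e = ∑ e ∈ T \ S, p e := by
    have : ∑ e ∈ S \ T, p e + ∑ e ∈ S ∩ T, p e = ∑ e ∈ T \ S, p e + ∑ e ∈ S ∩ T, p e := by
      rw [h1, h2, heq]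
    exact add_right_cancel this
  have hd1 : Disjoint (S \ T) (T \ S) := disjoint_sdiff_sdiff
  have hsub : (S \ T) ∪ (T \ S) ⊆ E \ J :=
    Finset.union_subset (Finset.sdiff_subset.trans hS) (Finset.sdiff_subset.trans hT)
  have hd2 : Disjoint J ((S \ T) ∪ (T \ S)) :=
    Finset.disjoint_of_subset_right hsub Finset.disjoint_sdiff
  have hpos : 0 < ((S \ T) ∪ (T \ S)).card := by
    rw [Finset.card_pos, Finset.nonempty_iff_ne_empty]
    intro h
    rw [Finset.union_eq_empty, Finset.sdiff_eq_empty_iff_subset, Finset.sdiff_eq_empty_iff_subset] at h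
    exact hne (Finset.Subset.antisymm h.1 h.2)
  have := hmax (J ∪ ((S \ T) ∪ (T \ S))) ⟨Finset.union_subset hJ.1 (hsub.trans Finset.sdiff_subset), by
    rw [Finset.sum_union hd2, Finset.sum_union hd1, hJ.2, h3, zero_add]
    ext u
    exact CharTwo.add_self_eq_zero _⟩
  rw [Finset.card_union_of_disjoint hd2] at this
  omega

theorem sum_nbF {W : Type*} [Fintype W] (H : SimpleGraph W) :
    ∑ u, (nbF H u).card = 2 * H.edgeFinset.card := by
  rw [← H.sum_degrees_eq_twice_card_edges]
  refine Finset.sum_congr rfl (fun u _ => ?_)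
  rw [← SimpleGraph.card_neighborFinset_eq_degree]
  congr 1
  ext w
  simp [mem_nbF]

theorem even_graph {W : Type*} [Fintype W] (B : SimpleGraph W) :
    ∃ B' ≤ B, (∀ u, Even (nbF B' u).card) ∧
      ∑ u, (nbF B u).card ≤ ∑ u, (nbF B' u).card + 2 * Fintype.card W := by
  obtain ⟨J, hJ, hpar, hcard⟩ := even_sub B.edgeFinset
    (fun e u => if u ∈ e then (1 : ZMod 2) else 0)
  have hJe : (SimpleGraph.fromEdgeSet (J : Set (Sym2 W))).edgeSet = (J : Set (Sym2 W)) := by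
    rw [SimpleGraph.edgeSet_fromEdgeSet, sdiff_eq_left, Set.disjoint_left]
    intro e he hd
    exact B.not_isDiag_of_mem_edgeSet (SimpleGraph.mem_edgeFinset.1 (hJ he)) hd
  have hJf : (SimpleGraph.fromEdgeSet (J : Set (Sym2 W))).edgeFinset = J := by
    ext e
    rw [SimpleGraph.mem_edgeFinset, hJe, Finset.mem_coe]
  refine ⟨SimpleGraph.fromEdgeSet (J : Set (Sym2 W)), ?_, ?_, ?_⟩
  · rw [← SimpleGraph.edgeSet_subset_edgeSet, hJe]
    intro e he
    exact SimpleGraph.mem_edgeFinset.1 (hJ he)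
  · intro u
    have h1 : (nbF (SimpleGraph.fromEdgeSet (J : Set (Sym2 W))) u).card =
        (J.filter (fun e => u ∈ e)).card := by
      have h2 := SimpleGraph.card_incidenceFinset_eq_degree (SimpleGraph.fromEdgeSet (J : Set (Sym2 W))) u
      rw [SimpleGraph.incidenceFinset_eq_filter, hJf, ← SimpleGraph.card_neighborFinset_eq_degree] at h2
      rw [h2]
      congr 1
      ext w
      simp [mem_nbF]
    rw [h1]
    have h3 := congrFun hpar u
    rw [Finset.sum_apply] at h3
    rw [← Finset.sum_filter, Finset.sum_const, nsmul_eq_mul, mul_one] at h3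
    exact (ZMod.natCast_eq_zero_iff_even).1 h3
  · have h4 := sum_nbF (SimpleGraph.fromEdgeSet (J : Set (Sym2 W)))
    have h5 : ∑ u, (nbF (SimpleGraph.fromEdgeSet (J : Set (Sym2 W))) u).card = 2 * J.card := by
      rw [h4]
      congr 2
      convert hJf
    rw [sum_nbF, h5]
    omega

/-- Replace each edge of a walk of `H` by the corresponding branch trail. -/
noncomputable def liftW {V W : Type*} {G : SimpleGraph V} {H : SimpleGraph W} (I : Immersion G H) :
    ∀ {u v : W}, H.Walk u v → G.Walk (I.φ u) (I.φ v)
  | _, _, .nil => .nil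
  | _, _, .cons h p => (I.trail h).append (liftW I p)

theorem liftW_edges {V W : Type*} {G : SimpleGraph V} {H : SimpleGraph W} (I : Immersion G H)
    {u v : W} (p : H.Walk u v) (e : Sym2 V) (he : e ∈ (liftW I p).edges) :
    ∃ (a b : W) (h : H.Adj a b), s(a, b) ∈ p.edges ∧ e ∈ (I.trail h).edges := by
  induction p with
  | nil => simp [liftW] at he
  | cons h p ih =>
    simp only [liftW, SimpleGraph.Walk.edges_append, List.mem_append] at he
    rcases he with he | he
    · exact ⟨_, _, h, by simp, he⟩
    · obtain ⟨a, b, hab, h1, h2⟩ := ih he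
      exact ⟨a, b, hab, by simp [h1], h2⟩

theorem liftW_trail {V W : Type*} {G : SimpleGraph V} {H : SimpleGraph W} (I : Immersion G H)
    {u v : W} (p : H.Walk u v) (hp : p.IsTrail) : (liftW I p).IsTrail := by
  induction p with
  | nil => simp [liftW]
  | cons h p ih =>
    rw [SimpleGraph.Walk.isTrail_cons] at hp
    rw [SimpleGraph.Walk.isTrail_def]
    simp only [liftW, SimpleGraph.Walk.edges_append]
    refine List.Nodup.append (I.isTrail h).edges_nodup (ih hp.1).edges_nodup ?_
    intro e he he'
    obtain ⟨a, b, hab, h1, h2⟩ := liftW_edges I p e he'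
    refine I.disjoint h hab ?_ he h2
    intro heq
    exact hp.2 (heq ▸ h1)

theorem liftW_parity {V W : Type*} {G : SimpleGraph V} {H : SimpleGraph W} (I : Immersion G H)
    (hI : ∀ ⦃u v : W⦄ (h : H.Adj u v), Odd (I.trail h).length)
    {u v : W} (p : H.Walk u v) : Even (liftW I p).length ↔ Even p.length := by
  induction p with
  | nil => simp [liftW]
  | cons h p ih =>
    simp only [liftW, SimpleGraph.Walk.length_append, SimpleGraph.Walk.length_cons]
    have := hI h
    rw [Nat.even_add, Nat.even_add, ih]
    rw [← Nat.not_even_iff_odd] at this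
    simp [this]

theorem bip_parity {W : Type*} {B : SimpleGraph W} (χ : W → Bool)
    (hχ : ∀ a b, B.Adj a b → χ a ≠ χ b) {u v : W} (p : B.Walk u v) :
    Even p.length ↔ χ u = χ v := by
  induction p with
  | nil => simp
  | @cons a b d h p ih =>
    have := hχ _ _ h
    rw [SimpleGraph.Walk.length_cons, Nat.even_add_one, ih]
    revert this
    cases χ a <;> cases χ b <;> cases χ d <;> simp

theorem finish_even {V W : Type*} {G : SimpleGraph V} {H B : SimpleGraph W} {t : ℕ} (χ : W → Bool)
    (hBH : B ≤ H) (hχ : ∀ a b, B.Adj a b → χ a ≠ χ b) (hM : MonoImm t χ B)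
    (hG : HasTotallyOddImmersion G H) :
    HasTotallyEvenImmersion G (⊤ : SimpleGraph (Fin t)) := by
  obtain ⟨I, hI⟩ := hG
  obtain ⟨f, D, hf, hc, hD, hr, hd⟩ := hM
  have hex : ∀ i j : Fin t, i ≠ j → ∃ T : G.Walk (I.φ (f i)) (I.φ (f j)), T.IsTrail ∧ Even T.length ∧
      ∀ e ∈ T.edges, ∃ (a b : W) (h : H.Adj a b), s(a, b) ∈ D s(i, j) ∧ e ∈ (I.trail h).edges := by
    intro i j hij
    obtain ⟨p, hp⟩ := (hr i j hij).exists_isPath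
    have hle : SimpleGraph.fromEdgeSet (D s(i, j)) ≤ B := by
      intro a b hab
      rw [SimpleGraph.fromEdgeSet_adj] at hab
      exact hD _ hab.1
    have hpar : Even p.length := (bip_parity χ (fun a b h => hχ a b (hle h)) p).2 (hc i j)
    refine ⟨liftW I (p.mapLe (hle.trans hBH)), ?_, ?_, ?_⟩
    · exact liftW_trail I _ ((SimpleGraph.Walk.isPath_mapLe _).2 hp).isTrail
    · rw [liftW_parity I hI]
      simpa using hpar
    · intro e he
      obtain ⟨a, b, h, h1, h2⟩ := liftW_edges I _ e he
      refine ⟨a, b, h, ?_, h2⟩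
      rw [SimpleGraph.Walk.edges_mapLe_eq_edges] at h1
      have := p.edges_subset_edgeSet h1
      rw [SimpleGraph.edgeSet_fromEdgeSet] at this
      exact this.1
  choose T hT1 hT2 hT3 using hex
  let tr : ∀ ⦃i j : Fin t⦄, (⊤ : SimpleGraph (Fin t)).Adj i j → G.Walk (I.φ (f i)) (I.φ (f j)) :=
    fun i j h => if i < j then T i j h.ne else (T j i h.ne.symm).reverse
  have htr : ∀ ⦃i j : Fin t⦄ (h : (⊤ : SimpleGraph (Fin t)).Adj i j), (tr h).IsTrail ∧ Even (tr h).length ∧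
      ∀ e ∈ (tr h).edges, ∃ (a b : W) (h : H.Adj a b), s(a, b) ∈ D s(i, j) ∧ e ∈ (I.trail h).edges := by
    intro i j h
    by_cases hij : i < j
    · simp only [tr, if_pos hij]
      exact ⟨hT1 _ _ _, hT2 _ _ _, hT3 _ _ _⟩
    · simp only [tr, if_neg hij]
      refine ⟨(hT1 _ _ _).reverse, by simpa using hT2 _ _ _, ?_⟩
      intro e he
      rw [SimpleGraph.Walk.edges_reverse, List.mem_reverse] at he
      rw [Sym2.eq_swap]
      exact hT3 _ _ _ e he
  refine ⟨⟨⟨fun i => I.φ (f i), fun i j h => hf (I.φ.injective h)⟩, tr, fun i j h => (htr h).1, ?_, ?_⟩,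
    fun i j h => (htr h).2.1⟩
  · intro i j h
    rcases lt_or_gt_of_ne h.ne with hij | hij
    · simp only [tr, if_pos hij, if_neg (not_lt_of_gt hij)]
    · simp only [tr, if_pos hij, if_neg (not_lt_of_gt hij), SimpleGraph.Walk.reverse_reverse]
  · intro u v a b h1 h2 hne e he he'
    obtain ⟨x, y, hxy, k1, k2⟩ := (htr h1).2.2 e he
    obtain ⟨x', y', hxy', k1', k2'⟩ := (htr h2).2.2 e he'
    refine I.disjoint hxy hxy' ?_ k2 k2'
    intro heq
    rw [heq] at k1
    exact Set.disjoint_left.1 (hd _ _ hne) k1 k1'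

theorem main_even {V W : Type*} [Fintype W] (t : ℕ) (H : SimpleGraph W)
    (hW : 0 < Fintype.card W) (he : (28 * t + 28) * Fintype.card W ≤ H.edgeFinset.card)
    (G : SimpleGraph V) (h : HasTotallyOddImmersion G H) :
    HasTotallyEvenImmersion G (⊤ : SimpleGraph (Fin t)) := by
  obtain ⟨χ, hχ⟩ := max_cut H
  let B : SimpleGraph W :=
    { Adj := fun a b => H.Adj a b ∧ χ a ≠ χ b
      symm := ⟨fun a b h => ⟨h.1.symm, h.2.symm⟩⟩
      loopless := ⟨fun a h => h.2 rfl⟩ }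
  have hB : ∀ u, nbF B u = (nbF H u).filter (fun w => χ u ≠ χ w) := by
    intro u
    ext w
    rw [mem_nbF, Finset.mem_filter, mem_nbF]
  simp only [← hB] at hχ
  rw [sum_nbF H] at hχ
  obtain ⟨B', hB', hev, hsum⟩ := even_graph B
  set n := Fintype.card W with hn
  have hn' : (Finset.univ.filter (fun u => nbF B' u ≠ ∅)).card ≤ n := Finset.card_le_univ _
  have key : (28 * t + 26) * n ≤ ∑ u, (nbF B' u).card := by
    have e1 : (28 * t + 28) * n = (28 * t + 26) * n + 2 * n := by ring
    omega
  refine finish_even χ (hB'.trans (fun a b h => h.1)) (fun a b h => (hB' h).2)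
    (phase1 n B' hn' hev ((Nat.mul_le_mul_left _ hn').trans key) ?_) h
  by_contra hno
  push Not at hno
  have h0 : ∑ u, (nbF B' u).card = 0 := Finset.sum_eq_zero (fun u _ => by rw [hno u]; rfl)
  have h1 : 26 * 1 ≤ (28 * t + 26) * n := Nat.mul_le_mul (by omega) (by omega)
  omega

theorem final_even {V W : Type*} [Fintype W] (t : ℕ) (H : SimpleGraph W)
    (havg : (56 * t + 56 : ℚ) ≤ 2 * (H.edgeSet.ncard : ℚ) / (Fintype.card W : ℚ))
    (G : SimpleGraph V) (h : HasTotallyOddImmersion G H) :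
    HasTotallyEvenImmersion G (⊤ : SimpleGraph (Fin t)) := by
  have hW : 0 < Fintype.card W := by
    by_contra h0
    have : Fintype.card W = 0 := by omega
    rw [this] at havg
    simp only [Nat.cast_zero, div_zero] at havg
    have : (0 : ℚ) ≤ (t : ℚ) := Nat.cast_nonneg t
    linarith
  refine main_even t H hW ?_ G h
  have hc : H.edgeSet.ncard = H.edgeFinset.card := by
    rw [← SimpleGraph.coe_edgeFinset, Set.ncard_coe_finset]
  have hWq : (0 : ℚ) < (Fintype.card W : ℚ) := by exact_mod_cast hW
  rw [hc, le_div_iff₀ hWq] at havg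
  have : (((28 * t + 28) * Fintype.card W : ℕ) : ℚ) ≤ ((H.edgeFinset.card : ℕ) : ℚ) := by
    push_cast
    linarith
  exact_mod_cast this

end HelpersG

/-- If H has average degree at least 56t + 56 and G admits a totally odd
immersion of H, then G admits a totally even immersion of K_t. -/
theorem totally_even_from_totally_odd_dense {V W : Type*} [Fintype V] [Fintype W]
    (t : ℕ) (ht : 1 ≤ t) (H : SimpleGraph W)
    (havg : (56 * t + 56 : ℚ) ≤ 2 * (H.edgeSet.ncard : ℚ) / (Fintype.card W : ℚ))
    (G : SimpleGraph V) (h : HasTotallyOddImmersion G H) :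
    HasTotallyEvenImmersion G (⊤ : SimpleGraph (Fin t)) := by
  exact final_even t H havg G h
end
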